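/- arXiv:math-ph/0504034 — 2 statements merged into one kernel-verified Lean document; each statement's English description precedes it below -/
import Mathlib

section
/- Eynard–Prats-Ferrer formula: let a, b : Fin N → ℂ be injective, A := diag(a), B := diag(b). For every function F : M_N(ℂ) × M_N(ℂ) → ℂ that is a finite product of traces of words in its two matrix arguments (i.e. F(X,Y) = ∏_{m=1}^{p} Tr(C_{m,1}·C_{m,2}⋯C_{m,ℓ_m}) with each C_{m,i} ∈ {X, Y}), one has ∫_{U(N)} F(A, U·B·U*) · exp(−Tr(A·U·B·U*)) dU = c_N / (N!·Δ(a)·Δ(b)) · Σ_{σ,τ ∈ S_N} sgn(σ)·sgn(τ)· exp(−Σ_i a_{τ(i)} b_{σ(i)}) · ∫_{T(N)} exp(−Tr(T·T*)) · F(A_τ + T, B_σ + T*) dT, where A_τ := diag(a∘τ), B_σ := diag(b∘σ), and c_N := (∏_{k=1}^{N−1} k!) · (−1)^{N(N−1)/2} / π^{N(N−1)/2}. -/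
open MeasureTheory Matrix

/-- The strictly upper triangular matrix built from a family of entries indexed by
pairs `(i,j)` with `i < j`. -/
noncomputable def strictUpper (N : ℕ) (t : {p : Fin N × Fin N // p.1 < p.2} → ℂ) :
    Matrix (Fin N) (Fin N) ℂ :=
  Matrix.of fun i j => if h : i < j then t ⟨(i, j), h⟩ else 0

namespace EPF
section Wick
open MvPolynomial

noncomputable def gw (z : ℂ) (α β : ℕ) : ℂ :=
  Complex.exp (-(z * star z)) * (z ^ α * (star z) ^ β)

lemma norm_gw (z : ℂ) (α β : ℕ) :
    ‖gw z α β‖ = ‖z‖ ^ ((α + β : ℕ) : ℝ) * Real.exp (-‖z‖ ^ (2 : ℝ)) := by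
  have h : z * star z = ((‖z‖ ^ 2 : ℝ) : ℂ) := by
    have := Complex.mul_conj' z
    simpa using this
  unfold gw
  rw [h, norm_mul, norm_mul, norm_pow, norm_pow, norm_star, ← pow_add, Complex.norm_exp,
    Real.rpow_natCast]
  rw [← Complex.ofReal_neg, Complex.ofReal_re, mul_comm]
  norm_num

lemma norm_gw_integral (k : ℕ) :
    ∫ z : ℂ, ‖z‖ ^ (k : ℝ) * Real.exp (-‖z‖ ^ (2 : ℝ)) =
      Real.pi * Real.Gamma ((k + 2) / 2) := by
  have := Complex.integral_rpow_mul_exp_neg_rpow (p := 2) (q := k) (by norm_num)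
    (by have : (0:ℝ) ≤ k := by positivity
        linarith)
  rw [this]; ring

lemma gw_integrable (α β : ℕ) : Integrable (fun z : ℂ => gw z α β) := by
  have h1 : Integrable (fun z : ℂ => ‖z‖ ^ ((α + β : ℕ) : ℝ) * Real.exp (-‖z‖ ^ (2 : ℝ))) := by
    by_contra h
    have h2 := integral_undef h
    rw [norm_gw_integral] at h2
    have : 0 < Real.pi * Real.Gamma ((((α + β : ℕ) : ℝ) + 2) / 2) :=
      mul_pos Real.pi_pos (Real.Gamma_pos_of_pos (by positivity))
    linarith
  refine h1.mono ?_ ?_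
  · apply Continuous.aestronglyMeasurable
    unfold gw; fun_prop
  · refine Filter.Eventually.of_forall fun z => ?_
    rw [norm_gw]
    exact le_abs_self _

lemma gw_integral_ne (α β : ℕ) (h : α ≠ β) : ∫ z : ℂ, gw z α β = 0 := by
  have hne : ((α : ℝ) - β) ≠ 0 := sub_ne_zero.2 (by exact_mod_cast h)
  set c : Circle := Circle.exp (Real.pi / ((α : ℝ) - β)) with hc
  have hcc : (c : ℂ) ^ α * (star (c : ℂ)) ^ β = -1 := by
    have h1 : (c : ℂ) = Complex.exp (((Real.pi / ((α : ℝ) - β) : ℝ) : ℂ) * Complex.I) := by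
      rw [hc, Circle.coe_exp]
    have h2 : star (c : ℂ) = Complex.exp (-(((Real.pi / ((α : ℝ) - β) : ℝ) : ℂ) * Complex.I)) := by
      rw [h1]
      change (starRingEnd ℂ) _ = _
      rw [← Complex.exp_conj]
      simp
    rw [h2, h1, ← Complex.exp_nat_mul, ← Complex.exp_nat_mul, ← Complex.exp_add,
      ← Complex.exp_pi_mul_I]
    congr 1
    have hne' : ((α : ℂ) - β) ≠ 0 := by exact_mod_cast hne
    push_cast
    field_simp
    ring
  have h3 := ((rotation c).measurePreserving).integral_comp
    (rotation c).toHomeomorph.measurableEmbedding (fun z => gw z α β)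
  have h4 : ∀ z, gw (rotation c z) α β = - gw z α β := by
    intro z
    have hn : (c : ℂ) * star (c : ℂ) = 1 := by
      have := Complex.mul_conj' (c : ℂ)
      rw [Circle.norm_coe] at this
      simpa using this
    unfold gw
    simp only [rotation_apply, star_mul']
    have : (c : ℂ) * z * (star (c : ℂ) * star z) = z * star z := by
      linear_combination (z * star z) * hn
    rw [this, mul_pow, mul_pow]
    linear_combination (Complex.exp (-(z * star z)) * z ^ α * star z ^ β) * hcc
  simp only [h4] at h3
  rw [integral_neg] at h3
  have : (2 : ℂ) * ∫ z : ℂ, gw z α β = 0 := by linear_combination -h3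
  simpa using this

lemma gw_integral_eq (α : ℕ) : ∫ z : ℂ, gw z α α = Real.pi * (α.factorial : ℂ) := by
  have h : ∀ z : ℂ, gw z α α =
      ((‖z‖ ^ ((α + α : ℕ) : ℝ) * Real.exp (-‖z‖ ^ (2 : ℝ)) : ℝ) : ℂ) := by
    intro z
    have h : z * star z = ((‖z‖ ^ 2 : ℝ) : ℂ) := by
      have := Complex.mul_conj' z
      simpa using this
    unfold gw
    rw [← mul_pow, h, Real.rpow_natCast]
    push_cast
    rw [← pow_mul, ← two_mul]
    norm_num
    ring
  simp only [h]
  rw [integral_complex_ofReal, norm_gw_integral]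
  have : ((((α + α : ℕ) : ℝ) + 2) / 2) = α + 1 := by push_cast; ring
  rw [this, Real.Gamma_nat_eq_factorial]
  push_cast; rfl

lemma gw_rec1 (α β : ℕ) : ∫ z : ℂ, gw z α (β + 1) = α * ∫ z : ℂ, gw z (α - 1) β := by
  by_cases h : α = β + 1
  · subst h
    rw [gw_integral_eq, Nat.add_sub_cancel, gw_integral_eq, Nat.factorial_succ]
    push_cast; ring
  · rw [gw_integral_ne _ _ h]
    rcases α with _ | α
    · simp
    · rw [Nat.add_sub_cancel, gw_integral_ne _ _ (by omega)]; simp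

lemma gw_rec2 (α β : ℕ) : ∫ z : ℂ, gw z (α + 1) β = β * ∫ z : ℂ, gw z α (β - 1) := by
  by_cases h : β = α + 1
  · subst h
    rw [gw_integral_eq, Nat.add_sub_cancel, gw_integral_eq, Nat.factorial_succ]
    push_cast; ring
  · rw [gw_integral_ne _ _ (Ne.symm h)]
    rcases β with _ | β
    · simp
    · rw [Nat.add_sub_cancel, gw_integral_ne _ _ (by omega)]; simp

variable {ι : Type*} [Fintype ι]

noncomputable def gaussEval (h : MvPolynomial (ι ⊕ ι) ℂ) (t : ι → ℂ) : ℂ :=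
  Complex.exp (-∑ i, t i * star (t i)) * eval (Sum.elim t (fun i => star (t i))) h

noncomputable def wick (h : MvPolynomial (ι ⊕ ι) ℂ) : ℂ := ∫ t : ι → ℂ, gaussEval h t

lemma gaussEval_monomial (m : ι ⊕ ι →₀ ℕ) (c : ℂ) (t : ι → ℂ) :
    gaussEval (monomial m c) t = c * ∏ i, gw (t i) (m (Sum.inl i)) (m (Sum.inr i)) := by
  unfold gaussEval gw
  rw [eval_monomial, Finsupp.prod_fintype _ _ (by simp), Fintype.prod_sum_type,
    ← Finset.sum_neg_distrib, Complex.exp_sum, Finset.prod_mul_distrib, Finset.prod_mul_distrib]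
  simp only [Sum.elim_inl, Sum.elim_inr]
  ring

lemma gaussEval_add (h k : MvPolynomial (ι ⊕ ι) ℂ) :
    gaussEval (h + k) = gaussEval h + gaussEval k := by
  funext t; simp [gaussEval, mul_add]

lemma gaussEval_integrable (h : MvPolynomial (ι ⊕ ι) ℂ) : Integrable (gaussEval h) := by
  induction h using MvPolynomial.induction_on' with
  | monomial m c =>
    have : gaussEval (monomial m c) =
        fun t => c * ∏ i, gw (t i) (m (Sum.inl i)) (m (Sum.inr i)) := by
      funext t; exact gaussEval_monomial m c t
    rw [this]
    apply Integrable.const_mul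
    exact Integrable.fintype_prod (f := fun i z => gw z (m (Sum.inl i)) (m (Sum.inr i)))
      (fun i => gw_integrable _ _)
  | add p q hp hq => rw [gaussEval_add]; exact hp.add hq

lemma wick_monomial (m : ι ⊕ ι →₀ ℕ) (c : ℂ) :
    wick (monomial m c) = c * ∏ i, ∫ z : ℂ, gw z (m (Sum.inl i)) (m (Sum.inr i)) := by
  unfold wick
  simp only [gaussEval_monomial]
  rw [integral_const_mul]
  congr 1
  exact integral_fintype_prod_volume_eq_prod
    (fun i z => gw z (m (Sum.inl i)) (m (Sum.inr i)))

lemma wick_add (h k : MvPolynomial (ι ⊕ ι) ℂ) : wick (h + k) = wick h + wick k := by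
  unfold wick
  rw [gaussEval_add]
  exact integral_add (gaussEval_integrable h) (gaussEval_integrable k)

lemma wick_smul (c : ℂ) (h : MvPolynomial (ι ⊕ ι) ℂ) : wick (c • h) = c * wick h := by
  unfold wick
  rw [← integral_const_mul]
  congr 1; funext t
  simp [gaussEval, smul_eval]; ring

noncomputable def wickL : MvPolynomial (ι ⊕ ι) ℂ →ₗ[ℂ] ℂ where
  toFun := wick
  map_add' := wick_add
  map_smul' := by intro c h; simpa using wick_smul c h

lemma wickL_apply (h : MvPolynomial (ι ⊕ ι) ℂ) : wickL h = wick h := rfl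

lemma wickL_one : wickL (1 : MvPolynomial (ι ⊕ ι) ℂ) = (Real.pi : ℂ) ^ Fintype.card ι := by
  rw [wickL_apply, ← C_1, ← monomial_zero', wick_monomial]
  simp [gw_integral_eq]

variable [DecidableEq ι]

lemma wickL_inr (p : ι) (h : MvPolynomial (ι ⊕ ι) ℂ) :
    wickL (X (Sum.inr p) * h) = wickL (pderiv (Sum.inl p) h) := by
  induction h using MvPolynomial.induction_on' with
  | monomial m c =>
    rw [pderiv_monomial, X, monomial_mul, wickL_apply, wickL_apply, wick_monomial, wick_monomial,
      ← Finset.mul_prod_erase _ _ (Finset.mem_univ p),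
      ← Finset.mul_prod_erase _ (fun i => ∫ z : ℂ, gw z
        ((m - Finsupp.single (Sum.inl p) 1 : ι ⊕ ι →₀ ℕ) (Sum.inl i))
        ((m - Finsupp.single (Sum.inl p) 1 : ι ⊕ ι →₀ ℕ) (Sum.inr i))) (Finset.mem_univ p)]
    have e1 : ∏ x ∈ Finset.univ.erase p, ∫ z : ℂ, gw z
        ((Finsupp.single (Sum.inr p) 1 + m : ι ⊕ ι →₀ ℕ) (Sum.inl x))
        ((Finsupp.single (Sum.inr p) 1 + m : ι ⊕ ι →₀ ℕ) (Sum.inr x)) =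
        ∏ x ∈ Finset.univ.erase p, ∫ z : ℂ, gw z ((m - Finsupp.single (Sum.inl p) 1 : ι ⊕ ι →₀ ℕ) (Sum.inl x))
        ((m - Finsupp.single (Sum.inl p) 1 : ι ⊕ ι →₀ ℕ) (Sum.inr x)) := by
      apply Finset.prod_congr rfl
      intro x hx
      have hx' : x ≠ p := Finset.ne_of_mem_erase hx
      have hx2 : p ≠ x := hx'.symm
      simp [hx2]
    rw [e1]
    simp only [Finsupp.add_apply, Finsupp.single_apply, Finsupp.tsub_apply, reduceCtorEq, if_false,
      if_true, zero_add, tsub_zero]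
    rw [add_comm 1, gw_rec1]
    ring
  | add p q hp hq => rw [mul_add, map_add, map_add, map_add, hp, hq]

lemma wickL_inl (p : ι) (h : MvPolynomial (ι ⊕ ι) ℂ) :
    wickL (X (Sum.inl p) * h) = wickL (pderiv (Sum.inr p) h) := by
  induction h using MvPolynomial.induction_on' with
  | monomial m c =>
    rw [pderiv_monomial, X, monomial_mul, wickL_apply, wickL_apply, wick_monomial, wick_monomial,
      ← Finset.mul_prod_erase _ _ (Finset.mem_univ p),
      ← Finset.mul_prod_erase _ (fun i => ∫ z : ℂ, gw z
        ((m - Finsupp.single (Sum.inr p) 1 : ι ⊕ ι →₀ ℕ) (Sum.inl i))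
        ((m - Finsupp.single (Sum.inr p) 1 : ι ⊕ ι →₀ ℕ) (Sum.inr i))) (Finset.mem_univ p)]
    have e1 : ∏ x ∈ Finset.univ.erase p, ∫ z : ℂ, gw z
        ((Finsupp.single (Sum.inl p) 1 + m : ι ⊕ ι →₀ ℕ) (Sum.inl x))
        ((Finsupp.single (Sum.inl p) 1 + m : ι ⊕ ι →₀ ℕ) (Sum.inr x)) =
        ∏ x ∈ Finset.univ.erase p, ∫ z : ℂ, gw z ((m - Finsupp.single (Sum.inr p) 1 : ι ⊕ ι →₀ ℕ) (Sum.inl x))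
        ((m - Finsupp.single (Sum.inr p) 1 : ι ⊕ ι →₀ ℕ) (Sum.inr x)) := by
      apply Finset.prod_congr rfl
      intro x hx
      have hx' : x ≠ p := Finset.ne_of_mem_erase hx
      have hx2 : p ≠ x := hx'.symm
      simp [hx2]
    rw [e1]
    simp only [Finsupp.add_apply, Finsupp.single_apply, Finsupp.tsub_apply, reduceCtorEq, if_false,
      if_true, zero_add, tsub_zero]
    rw [add_comm 1, gw_rec2]
    ring
  | add p q hp hq => rw [mul_add, map_add, map_add, map_add, hp, hq]

/-- expansion of a derivation on polynomials -/
lemma derivation_eq_sum {σ A : Type*} [Fintype σ] [CommRing A] [Algebra ℂ A]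
    (y : σ → A) (D : Derivation ℂ A A) (G : MvPolynomial σ ℂ) :
    D (aeval y G) = ∑ p, aeval y (pderiv p G) * D (y p) := by
  classical
  induction G using MvPolynomial.induction_on with
  | C a => simp
  | add p q hp hq => simp only [map_add, hp, hq, add_mul, Finset.sum_add_distrib]
  | mul_X p i hp =>
    simp only [map_mul, aeval_X, Derivation.leibniz, hp, smul_eq_mul, map_add, pderiv_X, add_mul,
      Finset.sum_add_distrib, Finset.mul_sum]
    have e : ∑ x, aeval y p * aeval y (Pi.single (M := fun _ => MvPolynomial σ ℂ) x 1 i) * D (y x)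
        = aeval y p * D (y i) := by
      rw [Finset.sum_eq_single i]
      · simp
      · intro b _ hb; simp [hb.symm]
      · simp
    rw [e]
    congr 1
    exact Finset.sum_congr rfl fun x _ => by ring

/-- Integration by parts along an arbitrary polynomial vector field. -/
lemma wickL_derivation (δ : Derivation ℂ (MvPolynomial (ι ⊕ ι) ℂ) (MvPolynomial (ι ⊕ ι) ℂ))
    (h : MvPolynomial (ι ⊕ ι) ℂ) :
    wickL (δ h) = wickL (h * ((∑ p, X (Sum.inr p) * δ (X (Sum.inl p)))
        + (∑ p, X (Sum.inl p) * δ (X (Sum.inr p)))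
        - (∑ p, pderiv (Sum.inl p) (δ (X (Sum.inl p))))
        - (∑ p, pderiv (Sum.inr p) (δ (X (Sum.inr p)))))) := by
  have h0 := derivation_eq_sum (X : ι ⊕ ι → MvPolynomial (ι ⊕ ι) ℂ) δ h
  simp only [aeval_X_left, AlgHom.id_apply, Fintype.sum_sum_type] at h0
  rw [h0]
  simp only [mul_add, mul_sub, Finset.mul_sum, map_add, map_sub, map_sum]
  have e1 : ∀ p, wickL (h * (X (Sum.inr p) * δ (X (Sum.inl p)))) =
      wickL (pderiv (Sum.inl p) h * δ (X (Sum.inl p))) +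
      wickL (h * pderiv (Sum.inl p) (δ (X (Sum.inl p)))) := by
    intro p
    rw [mul_left_comm, wickL_inr, pderiv_mul, map_add]
  have e2 : ∀ p, wickL (h * (X (Sum.inl p) * δ (X (Sum.inr p)))) =
      wickL (pderiv (Sum.inr p) h * δ (X (Sum.inr p))) +
      wickL (h * pderiv (Sum.inr p) (δ (X (Sum.inr p)))) := by
    intro p
    rw [mul_left_comm, wickL_inl, pderiv_mul, map_add]
  simp only [e1, e2, Finset.sum_add_distrib]
  ring

end Wick
end EPF

namespace EPF
section Tri
set_option linter.unusedSectionVars false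
set_option linter.unusedSimpArgs false

variable {N : ℕ} {R : Type*} [CommRing R] [Algebra ℂ R]

/-- strictly upper triangular -/
def SU (M : Matrix (Fin N) (Fin N) R) : Prop := ∀ i j, j ≤ i → M i j = 0

/-- upper triangular -/
def UT (M : Matrix (Fin N) (Fin N) R) : Prop := ∀ i j, j < i → M i j = 0

lemma SU.ut {M : Matrix (Fin N) (Fin N) R} (h : SU M) : UT M := fun i j hij => h i j hij.le

lemma SU.mul_ut {M K : Matrix (Fin N) (Fin N) R} (h : SU M) (hK : UT K) : SU (M * K) := by
  intro i j hij
  rw [Matrix.mul_apply]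
  refine Finset.sum_eq_zero fun k _ => ?_
  rcases le_or_gt k i with hk | hk
  · rw [h i k hk, zero_mul]
  · rw [hK k j (lt_of_le_of_lt hij hk), mul_zero]

lemma UT.mul_su {M K : Matrix (Fin N) (Fin N) R} (h : UT M) (hK : SU K) : SU (M * K) := by
  intro i j hij
  rw [Matrix.mul_apply]
  refine Finset.sum_eq_zero fun k _ => ?_
  rcases lt_or_ge k i with hk | hk
  · rw [h i k hk, zero_mul]
  · rw [hK k j (le_trans hij hk), mul_zero]

lemma SU.sub {M K : Matrix (Fin N) (Fin N) R} (h : SU M) (hK : SU K) : SU (M - K) := by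
  intro i j hij; simp [h i j hij, hK i j hij]

lemma SU.add {M K : Matrix (Fin N) (Fin N) R} (h : SU M) (hK : SU K) : SU (M + K) := by
  intro i j hij; simp [h i j hij, hK i j hij]

lemma SU.neg {M : Matrix (Fin N) (Fin N) R} (h : SU M) : SU (-M) := by
  intro i j hij; simp [h i j hij]

lemma UT.diag_mul {M K : Matrix (Fin N) (Fin N) R} (h : UT M) (hK : UT K) (i : Fin N) :
    (M * K) i i = M i i * K i i := by
  rw [Matrix.mul_apply]
  refine Finset.sum_eq_single i (fun k _ hk => ?_) (by simp)
  rcases lt_or_gt_of_ne hk with hk | hk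
  · rw [h i k hk, zero_mul]
  · rw [hK k i hk, mul_zero]

/-- diagonal matrix with complex entries -/
noncomputable def Am (R : Type*) [CommRing R] [Algebra ℂ R] (a : Fin N → ℂ) :
    Matrix (Fin N) (Fin N) R := Matrix.diagonal fun i => algebraMap ℂ R (a i)

lemma Am_ut (a : Fin N → ℂ) : UT (Am R a) := fun i j h => by
  simp [Am, Matrix.diagonal_apply_ne _ h.ne']

noncomputable def step (a : Fin N → ℂ) (T M : Matrix (Fin N) (Fin N) R) :
    Matrix (Fin N) (Fin N) R :=
  Matrix.of fun i j => if i = j then 1 else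
    if i < j then algebraMap ℂ R ((a j - a i)⁻¹) * (T * M) i j else 0

noncomputable def Sm (a : Fin N → ℂ) (T : Matrix (Fin N) (Fin N) R) :
    Matrix (Fin N) (Fin N) R := (step a T)^[N] 0

lemma step_iter (a : Fin N → ℂ) {T : Matrix (Fin N) (Fin N) R} (hT : SU T) (m : ℕ) :
    ∀ i j : Fin N, (j : ℕ) < i + m → (step a T)^[m + 1] 0 i j = (step a T)^[m] 0 i j := by
  induction m with
  | zero =>
    intro i j h
    have h' : j < i := by exact_mod_cast h
    simp [step, h'.ne', h'.not_gt]
  | succ m ih =>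
    intro i j h
    rw [Function.iterate_succ_apply', Function.iterate_succ_apply' _ m]
    simp only [step, Matrix.of_apply]
    split_ifs with h1 h2
    · rfl
    · congr 1
      rw [Matrix.mul_apply, Matrix.mul_apply]
      refine Finset.sum_congr rfl fun k _ => ?_
      rcases le_or_gt k i with hk | hk
      · rw [hT i k hk, zero_mul, zero_mul]
      · have : (j : ℕ) < k + m := by have : (i : ℕ) < k := hk; omega
        have e := ih k j this
        rw [Function.iterate_succ_apply'] at e
        exact congrArg (fun x => T i k * x) e
    · rfl

lemma step_Sm (a : Fin N → ℂ) {T : Matrix (Fin N) (Fin N) R} (hT : SU T) :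
    step a T (Sm a T) = Sm a T := by
  ext i j
  have := step_iter a hT N i j (by have := j.2; omega)
  rwa [Function.iterate_succ_apply'] at this

lemma Sm_diag (a : Fin N → ℂ) {T : Matrix (Fin N) (Fin N) R} (hT : SU T) (i : Fin N) :
    Sm a T i i = 1 := by
  rw [← step_Sm a hT]; simp [step]

lemma Sm_ut (a : Fin N → ℂ) {T : Matrix (Fin N) (Fin N) R} (hT : SU T) : UT (Sm a T) := by
  intro i j h
  rw [← step_Sm a hT]; simp [step, h.ne', h.not_gt]

lemma Sm_eq {a : Fin N → ℂ} (ha : Function.Injective a) {T : Matrix (Fin N) (Fin N) R}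
    (hT : SU T) : (Am R a + T) * Sm a T = Sm a T * Am R a := by
  ext i j
  rw [add_mul, Matrix.add_apply, Am, Matrix.diagonal_mul, Matrix.mul_diagonal]
  rcases lt_or_ge i j with h | h
  · have h0 : (T * Sm a T) i j = algebraMap ℂ R (a j - a i) * Sm a T i j := by
      conv_rhs => rw [← step_Sm a hT]
      have hne : a j - a i ≠ 0 := sub_ne_zero.2 fun e => h.ne (ha e).symm
      simp only [step, Matrix.of_apply, h.ne, h, if_true, if_false]
      rw [← mul_assoc, ← map_mul, mul_inv_cancel₀ hne, map_one, one_mul]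
    rw [h0, map_sub]; ring
  · rw [hT.mul_ut (Sm_ut a hT) i j h, add_zero]
    rcases eq_or_lt_of_le h with rfl | h
    · ring
    · rw [Sm_ut a hT i j h]; ring

lemma Sm_det (a : Fin N → ℂ) {T : Matrix (Fin N) (Fin N) R} (hT : SU T) : (Sm a T).det = 1 := by
  rw [Matrix.det_of_isUpperTriangular (fun i j h => Sm_ut a hT i j h)]
  simp [Sm_diag a hT]

lemma Sm_mul_inv (a : Fin N → ℂ) {T : Matrix (Fin N) (Fin N) R} (hT : SU T) :
    Sm a T * (Sm a T)⁻¹ = 1 := Matrix.mul_nonsing_inv _ (by rw [Sm_det a hT]; exact isUnit_one)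

lemma Sm_inv_mul (a : Fin N → ℂ) {T : Matrix (Fin N) (Fin N) R} (hT : SU T) :
    (Sm a T)⁻¹ * Sm a T = 1 := Matrix.nonsing_inv_mul _ (by rw [Sm_det a hT]; exact isUnit_one)

lemma Sm_inv_adj (a : Fin N → ℂ) {T : Matrix (Fin N) (Fin N) R} (hT : SU T) :
    (Sm a T)⁻¹ = (Sm a T).adjugate := by
  rw [Matrix.inv_def, Sm_det a hT]; simp

lemma Sm_inv_ut (a : Fin N → ℂ) {T : Matrix (Fin N) (Fin N) R} (hT : SU T) : UT (Sm a T)⁻¹ := by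
  have : Invertible (Sm a T) := (Sm a T).invertibleOfIsUnitDet (by rw [Sm_det a hT]; exact isUnit_one)
  have := Matrix.blockTriangular_inv_of_blockTriangular (M := Sm a T) (b := id)
    (fun i j h => Sm_ut a hT i j h)
  exact fun i j h => this h

lemma Sm_inv_diag (a : Fin N → ℂ) {T : Matrix (Fin N) (Fin N) R} (hT : SU T) (i : Fin N) :
    (Sm a T)⁻¹ i i = 1 := by
  have := (Sm_ut a hT).diag_mul (Sm_inv_ut a hT) i
  rw [Sm_mul_inv a hT, Sm_diag a hT, one_mul] at this
  simpa using this.symm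

lemma Sm_inv_eq {a : Fin N → ℂ} (ha : Function.Injective a) {T : Matrix (Fin N) (Fin N) R}
    (hT : SU T) : (Sm a T)⁻¹ * (Am R a + T) = Am R a * (Sm a T)⁻¹ := by
  have h := Sm_eq ha hT
  calc _ = (Sm a T)⁻¹ * (((Am R a + T) * Sm a T) * (Sm a T)⁻¹) := by
        rw [mul_assoc, Sm_mul_inv a hT, mul_one]
    _ = _ := by rw [h, mul_assoc, ← mul_assoc, Sm_inv_mul a hT, one_mul]

/-- commutator entries -/
lemma comm_entry (a : Fin N → ℂ) (m T : Matrix (Fin N) (Fin N) R) (p q : Fin N) :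
    (m * (Am R a + T) - (Am R a + T) * m) p q
      = algebraMap ℂ R (a q - a p) * m p q + ∑ k, (m p k * T k q - T p k * m k q) := by
  rw [mul_add, add_mul, Am, Matrix.sub_apply, Matrix.add_apply, Matrix.add_apply,
    Matrix.mul_diagonal, Matrix.diagonal_mul, Matrix.mul_apply, Matrix.mul_apply,
    Finset.sum_sub_distrib, map_sub]
  ring

/-- Lemma Z -/
lemma lemmaZ {a : Fin N → ℂ} (ha : Function.Injective a) {m T : Matrix (Fin N) (Fin N) R}
    (hT : SU T) (hm : SU m) (Q : Fin N → Fin N → Prop)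
    (hQ : ∀ p k q, p < k → k < q → Q p q → Q p k ∧ Q k q)
    (h : ∀ p q, p < q → Q p q → (m * (Am R a + T) - (Am R a + T) * m) p q = 0) :
    ∀ p q, Q p q → m p q = 0 := by
  have key : ∀ d : ℕ, ∀ p q : Fin N, (q : ℕ) < p + d → Q p q → m p q = 0 := by
    intro d
    induction d with
    | zero => intro p q hpq _; exact hm p q (by rw [Fin.le_def]; omega)
    | succ d ih =>
      intro p q hpq hq
      rcases le_or_gt q p with hle | hlt
      · exact hm p q hle
      · have h1 := h p q hlt hq
        rw [comm_entry, Finset.sum_eq_zero, add_zero] at h1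
        · have hne : a q - a p ≠ 0 := sub_ne_zero.2 fun e => hlt.ne (ha e).symm
          have h2 : algebraMap ℂ R ((a q - a p)⁻¹) * (algebraMap ℂ R (a q - a p) * m p q) = 0 := by
            rw [h1, mul_zero]
          rwa [← mul_assoc, ← map_mul, inv_mul_cancel₀ hne, map_one, one_mul] at h2
        · intro k _
          have e1 : m p k * T k q = 0 := by
            rcases le_or_gt k p with hk | hk
            · rw [hm p k hk, zero_mul]
            · rcases le_or_gt q k with hk2 | hk2
              · rw [hT k q hk2, mul_zero]
              · rw [ih p k (by have : (k:ℕ) < q := hk2; omega) (hQ p k q hk hk2 hq).1, zero_mul]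
          have e2 : T p k * m k q = 0 := by
            rcases le_or_gt k p with hk | hk
            · rw [hT p k hk, zero_mul]
            · rcases le_or_gt q k with hk2 | hk2
              · rw [hm k q hk2, mul_zero]
              · rw [ih k q (by have : (p:ℕ) < k := hk; omega) (hQ p k q hk hk2 hq).2, mul_zero]
          rw [e1, e2, sub_zero]
  intro p q
  exact key N p q (by have := q.2; omega)

lemma comm_unique {a : Fin N → ℂ} (ha : Function.Injective a) {m m' T : Matrix (Fin N) (Fin N) R}
    (hT : SU T) (hm : SU m) (hm' : SU m')
    (h : m * (Am R a + T) - (Am R a + T) * m = m' * (Am R a + T) - (Am R a + T) * m') :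
    m = m' := by
  have := lemmaZ ha hT (hm.sub hm') (fun _ _ => True) (by simp) (by
    intro p q _ _
    have : (m - m') * (Am R a + T) - (Am R a + T) * (m - m') = 0 := by
      rw [sub_mul, mul_sub, sub_sub_sub_comm, h, sub_self]
    rw [this]; rfl)
  ext p q
  have := this p q trivial
  rwa [Matrix.sub_apply, sub_eq_zero] at this

lemma SW_unique {a : Fin N → ℂ} (ha : Function.Injective a) {W T : Matrix (Fin N) (Fin N) R}
    (hT : SU T) (hW : SU W) (h : (Am R a + T) * W = W * Am R a) : W = 0 := by
  have h0 : W * (Sm a T)⁻¹ = 0 := by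
    refine comm_unique ha hT (hW.mul_ut (Sm_inv_ut a hT)) (fun _ _ _ => rfl) ?_
    rw [mul_assoc, Sm_inv_eq ha hT, ← mul_assoc, ← h]; simp [mul_assoc]
  calc W = W * (Sm a T)⁻¹ * Sm a T := by rw [mul_assoc, Sm_inv_mul a hT, mul_one]
    _ = 0 := by rw [h0, zero_mul]

/-! derivations on matrices -/
lemma map_der_mul (δ : Derivation ℂ R R) (M K : Matrix (Fin N) (Fin N) R) :
    (M * K).map δ = M.map δ * K + M * K.map δ := by
  ext i j
  simp only [Matrix.map_apply, Matrix.mul_apply, Matrix.add_apply, map_sum, Derivation.leibniz,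
    smul_eq_mul, Finset.sum_add_distrib]
  rw [add_comm]
  congr 1
  exact Finset.sum_congr rfl fun k _ => mul_comm _ _

lemma map_der_add (δ : Derivation ℂ R R) (M K : Matrix (Fin N) (Fin N) R) :
    (M + K).map δ = M.map δ + K.map δ := by
  ext i j; simp

lemma map_der_Am (δ : Derivation ℂ R R) (a : Fin N → ℂ) : (Am R a).map δ = 0 := by
  ext i j
  by_cases h : i = j
  · subst h; simp [Am]
  · simp [Am, h]

lemma map_der_one (δ : Derivation ℂ R R) : (1 : Matrix (Fin N) (Fin N) R).map δ = 0 := by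
  ext i j
  by_cases h : i = j
  · subst h; simp
  · simp [h]

/-- logarithmic derivative of S -/
noncomputable def logd (a : Fin N → ℂ) (T : Matrix (Fin N) (Fin N) R) (δ : Derivation ℂ R R) :
    Matrix (Fin N) (Fin N) R := (Sm a T).map δ * (Sm a T)⁻¹

lemma logd_mul (a : Fin N → ℂ) {T : Matrix (Fin N) (Fin N) R} (hT : SU T) (δ : Derivation ℂ R R) :
    (Sm a T).map δ = logd a T δ * Sm a T := by
  rw [logd, mul_assoc, Sm_inv_mul a hT, mul_one]

lemma logd_su (a : Fin N → ℂ) {T : Matrix (Fin N) (Fin N) R} (hT : SU T) (δ : Derivation ℂ R R) :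
    SU (logd a T δ) := by
  refine SU.mul_ut ?_ (Sm_inv_ut a hT)
  intro i j h
  rcases eq_or_lt_of_le h with rfl | h
  · simp [Sm_diag a hT]
  · simp [Sm_ut a hT i j h]

lemma logd_comm {a : Fin N → ℂ} (ha : Function.Injective a) {T : Matrix (Fin N) (Fin N) R}
    (hT : SU T) (δ : Derivation ℂ R R) :
    logd a T δ * (Am R a + T) - (Am R a + T) * logd a T δ = T.map δ := by
  have h := congrArg (fun M => M.map δ) (Sm_eq ha hT)
  simp only [map_der_mul, map_der_add, map_der_Am, zero_add, mul_zero, add_zero] at h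
  have h2 := congrArg (fun M => M * (Sm a T)⁻¹) h
  simp only [add_mul _ _ (Sm a T)⁻¹] at h2
  rw [mul_assoc (T.map δ), Sm_mul_inv a hT, mul_one, mul_assoc (Sm a T |>.map δ),
    ← Sm_inv_eq ha hT, mul_assoc (Am R a + T), ← mul_assoc (Sm a T |>.map δ)] at h2
  rw [logd, ← h2]; abel

lemma logd_eq {a : Fin N → ℂ} (ha : Function.Injective a) {T m : Matrix (Fin N) (Fin N) R}
    (hT : SU T) (δ : Derivation ℂ R R) (hm : SU m)
    (h : m * (Am R a + T) - (Am R a + T) * m = T.map δ) : logd a T δ = m :=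
  comm_unique ha hT (logd_su a hT δ) hm (by rw [h, logd_comm ha hT])

lemma map_der_inv (a : Fin N → ℂ) {T : Matrix (Fin N) (Fin N) R} (hT : SU T)
    (δ : Derivation ℂ R R) :
    ((Sm a T)⁻¹).map δ = - ((Sm a T)⁻¹ * logd a T δ) := by
  have h := congrArg (fun M => M.map δ) (Sm_inv_mul a hT)
  simp only [map_der_mul, map_der_one] at h
  have h2 := congrArg (fun M => M * (Sm a T)⁻¹) h
  simp only [add_mul, zero_mul] at h2
  rw [mul_assoc, Sm_mul_inv a hT, mul_one, mul_assoc] at h2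
  exact eq_neg_of_add_eq_zero_left h2

/-- derivative of S K S⁻¹ for constant K -/
lemma map_der_conj (a : Fin N → ℂ) {T K : Matrix (Fin N) (Fin N) R} (hT : SU T)
    (δ : Derivation ℂ R R) (hK : K.map δ = 0) :
    (Sm a T * K * (Sm a T)⁻¹).map δ = logd a T δ * (Sm a T * K * (Sm a T)⁻¹)
      - (Sm a T * K * (Sm a T)⁻¹) * logd a T δ := by
  rw [map_der_mul, map_der_mul, hK, map_der_inv a hT, logd_mul a hT]
  simp only [mul_zero, add_zero, mul_neg, mul_assoc, sub_eq_add_neg]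

/-- derivative of S⁻¹ Y S -/
lemma map_der_conj' (a : Fin N → ℂ) {T Y : Matrix (Fin N) (Fin N) R} (hT : SU T)
    (δ : Derivation ℂ R R) :
    ((Sm a T)⁻¹ * Y * Sm a T).map δ = (Sm a T)⁻¹ *
      (Y.map δ + (Y * logd a T δ - logd a T δ * Y)) * Sm a T := by
  rw [map_der_mul, map_der_mul, map_der_inv a hT, logd_mul a hT]
  simp only [neg_mul, mul_assoc, sub_eq_add_neg, add_mul, mul_add, mul_neg]
  abel

end Tri
end EPF

namespace EPF
section SDrho
set_option linter.unusedSectionVars false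
set_option linter.unusedSimpArgs false
open MvPolynomial

abbrev PP (N : ℕ) := {p : Fin N × Fin N // p.1 < p.2}
abbrev RR (N : ℕ) := MvPolynomial (PP N ⊕ PP N) ℂ
abbrev Poly (N : ℕ) := MvPolynomial (Fin N × Fin N) ℂ

variable {N : ℕ}

noncomputable def Tm (N : ℕ) : Matrix (Fin N) (Fin N) (RR N) :=
  Matrix.of fun i j => if h : i < j then X (Sum.inl ⟨(i, j), h⟩) else 0

noncomputable def Ts (N : ℕ) : Matrix (Fin N) (Fin N) (RR N) :=
  Matrix.of fun i j => if h : j < i then X (Sum.inr ⟨(j, i), h⟩) else 0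

lemma Tm_su : SU (Tm N) := fun i j h => by simp [Tm, h.not_gt]

noncomputable def Y0 (b : Fin N → ℂ) : Matrix (Fin N) (Fin N) (RR N) := Am (RR N) b + Ts N

noncomputable def Ym (a b : Fin N → ℂ) : Matrix (Fin N) (Fin N) (RR N) :=
  (Sm a (Tm N))⁻¹ * Y0 b * Sm a (Tm N)

/-- evaluation of a polynomial at a matrix -/
noncomputable def evM {R : Type*} [CommRing R] [Algebra ℂ R] (M : Matrix (Fin N) (Fin N) R) :
    Poly N →ₐ[ℂ] R := aeval fun pq : Fin N × Fin N => M pq.1 pq.2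

lemma evM_X {R : Type*} [CommRing R] [Algebra ℂ R] (M : Matrix (Fin N) (Fin N) R) (i j : Fin N) :
    evM M (X (i, j)) = M i j := by simp [evM]

noncomputable def Dd (i j : Fin N) : Derivation ℂ (Poly N) (Poly N) :=
  mkDerivation ℂ fun pq => (if pq.1 = i then X (j, pq.2) else 0) -
    (if pq.2 = j then X (pq.1, i) else 0)

lemma der_aeval {σ A : Type*} [Fintype σ] [CommRing A] [Algebra ℂ A] (y : σ → A)
    (δ : Derivation ℂ A A) (D : Derivation ℂ (MvPolynomial σ ℂ) (MvPolynomial σ ℂ))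
    (h : ∀ p, δ (y p) = aeval y (D (X p))) (G : MvPolynomial σ ℂ) :
    δ (aeval y G) = aeval y (D G) := by
  rw [derivation_eq_sum]
  have h0 := derivation_eq_sum (X : σ → MvPolynomial σ ℂ) D G
  simp only [aeval_X_left, AlgHom.id_apply] at h0
  rw [h0, map_sum]
  simp [h]

/-- a derivation acting on Y by [E_ij, Y] -/
lemma der_evM {R : Type*} [CommRing R] [Algebra ℂ R] (Y : Matrix (Fin N) (Fin N) R)
    (δ : Derivation ℂ R R) (i j : Fin N)
    (h : Y.map δ = single i j 1 * Y - Y * single i j 1) (G : Poly N) :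
    δ (evM Y G) = evM Y (Dd i j G) := by
  refine der_aeval _ δ (Dd i j) ?_ G
  rintro ⟨p, q⟩
  have := congrFun (congrFun h p) q
  simp only [Matrix.map_apply] at this
  rw [this, Dd, mkDerivation_X]
  simp only [Matrix.sub_apply, Matrix.mul_apply, Matrix.single_apply, map_sub]
  congr 1
  · by_cases hp : p = i
    · subst hp; simp
    · simp [hp, Ne.symm hp]
  · by_cases hq : q = j
    · subst hq; simp
    · simp [hq, Ne.symm hq]

lemma sumP {M : Type*} [AddCommMonoid M] (f : Fin N → Fin N → M) :
    ∑ p : PP N, f p.1.1 p.1.2 = ∑ i, ∑ j, if i < j then f i j else 0 := by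
  rw [← Fintype.sum_prod_type' (f := fun i j => if i < j then f i j else 0), ← Finset.sum_filter]
  symm
  exact Finset.sum_subtype (p := fun p : Fin N × Fin N => p.1 < p.2) _ (by simp) (fun p : Fin N × Fin N => f p.1 p.2)

variable {R : Type*} [CommRing R] [Algebra ℂ R]

lemma su_decomp {m : Matrix (Fin N) (Fin N) R} (hm : SU m) :
    m = ∑ p : PP N, m p.1.1 p.1.2 • single p.1.1 p.1.2 (1 : R) := by
  rw [sumP (fun i j => m i j • single i j (1 : R))]
  conv_lhs => rw [Matrix.matrix_eq_sum_single m]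
  refine Finset.sum_congr rfl fun i _ => Finset.sum_congr rfl fun j _ => ?_
  split_ifs with h
  · simp
  · rw [hm i j (not_lt.1 h)]; simp

lemma comm_decomp {m : Matrix (Fin N) (Fin N) R} (hm : SU m) (Z : Matrix (Fin N) (Fin N) R)
    (i j : Fin N) : (m * Z - Z * m) i j = ∑ p : PP N,
      (single p.1.1 p.1.2 (1 : R) * Z - Z * single p.1.1 p.1.2 (1 : R)) i j * m p.1.1 p.1.2 := by
  conv_lhs => rw [su_decomp hm]
  rw [Finset.sum_mul, Finset.mul_sum, ← Finset.sum_sub_distrib, Matrix.sum_apply]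
  refine Finset.sum_congr rfl fun p _ => ?_
  rw [smul_mul_assoc, mul_smul_comm, ← smul_sub, Matrix.smul_apply, smul_eq_mul, mul_comm]

lemma comm_single_diag (Z : Matrix (Fin N) (Fin N) R) (i j : Fin N) :
    (single i j (1 : R) * Z - Z * single i j (1 : R)) i j = Z j j - Z i i := by
  simp [Matrix.mul_apply, Matrix.single_apply]

/-- strictly upper part -/
def up (M : Matrix (Fin N) (Fin N) R) : Matrix (Fin N) (Fin N) R :=
  Matrix.of fun i j => if i < j then M i j else 0

lemma up_su (M : Matrix (Fin N) (Fin N) R) : SU (up M) := fun i j h => by simp [up, h.not_gt]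

lemma up_map (M : Matrix (Fin N) (Fin N) R) (δ : Derivation ℂ R R) :
    (up M).map δ = up (M.map δ) := by
  ext i j; by_cases h : i < j <;> simp [up, h]

lemma Tm_map_inl (p : PP N) : (Tm N).map (pderiv (Sum.inl p)) = single p.1.1 p.1.2 1 := by
  ext1 i j
  rcases p with ⟨⟨p, q⟩, hpq⟩
  simp only [Matrix.map_apply, Tm, Matrix.of_apply, Matrix.single_apply]
  split_ifs with h1 h2 h2
  · obtain ⟨rfl, rfl⟩ := h2; simp
  · rw [pderiv_X_of_ne]
    intro h; simp only [Sum.inl.injEq, Subtype.mk.injEq, Prod.mk.injEq] at h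
    exact h2 ⟨h.1.symm, h.2.symm⟩
  · obtain ⟨rfl, rfl⟩ := h2; exact absurd hpq h1
  · simp

lemma Tm_map_inr (p : PP N) : (Tm N).map (pderiv (Sum.inr p)) = 0 := by
  ext1 i j
  simp only [Matrix.map_apply, Tm, Matrix.of_apply]
  split_ifs with h1
  · rw [pderiv_X_of_ne (by simp)]; rfl
  · simp

lemma Ts_map_inr (p : PP N) : (Ts N).map (pderiv (Sum.inr p)) = single p.1.2 p.1.1 1 := by
  ext1 i j
  rcases p with ⟨⟨p, q⟩, hpq⟩
  simp only [Matrix.map_apply, Ts, Matrix.of_apply, Matrix.single_apply]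
  split_ifs with h1 h2 h2
  · obtain ⟨rfl, rfl⟩ := h2; simp
  · rw [pderiv_X_of_ne]
    intro h; simp only [Sum.inr.injEq, Subtype.mk.injEq, Prod.mk.injEq] at h
    exact h2 ⟨h.2.symm, h.1.symm⟩
  · obtain ⟨rfl, rfl⟩ := h2; exact absurd hpq h1
  · simp

lemma Y0_map (b : Fin N → ℂ) (δ : Derivation ℂ (RR N) (RR N)) : (Y0 b).map δ = (Ts N).map δ := by
  rw [Y0, map_der_add, map_der_Am, zero_add]

/-- m_ij -/
noncomputable def mm (a : Fin N → ℂ) (p : PP N) : Matrix (Fin N) (Fin N) (RR N) :=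
  logd a (Tm N) (pderiv (Sum.inl p))

lemma mm_su (a : Fin N → ℂ) (p : PP N) : SU (mm a p) := logd_su a Tm_su _

lemma mm_comm {a : Fin N → ℂ} (ha : Function.Injective a) (p : PP N) :
    mm a p * (Am (RR N) a + Tm N) - (Am (RR N) a + Tm N) * mm a p = single p.1.1 p.1.2 1 := by
  rw [← Tm_map_inl]; exact logd_comm ha Tm_su _

lemma logd_inr {a : Fin N → ℂ} (ha : Function.Injective a) (p : PP N) :
    logd a (Tm N) (pderiv (Sum.inr p)) = 0 :=
  logd_eq ha Tm_su _ (fun _ _ _ => rfl) (by rw [Tm_map_inr]; simp)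

/-- the trace identity -/
lemma div_trace {a : Fin N → ℂ} (ha : Function.Injective a) (Kt : Matrix (Fin N) (Fin N) (RR N)) :
    ∑ p : PP N, (up (mm a p * Kt - Kt * mm a p) * (Am (RR N) a + Tm N)
      - (Am (RR N) a + Tm N) * up (mm a p * Kt - Kt * mm a p)) p.1.1 p.1.2
    = ∑ p : PP N, (Kt p.1.2 p.1.2 - Kt p.1.1 p.1.1) := by
  set Φ : Matrix (PP N) (PP N) (RR N) := Matrix.of fun p q =>
    (single q.1.1 q.1.2 (1 : RR N) * (Am (RR N) a + Tm N)
      - (Am (RR N) a + Tm N) * single q.1.1 q.1.2 (1 : RR N)) p.1.1 p.1.2 with hΦ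
  set Ψ : Matrix (PP N) (PP N) (RR N) := Matrix.of fun p q =>
    (single q.1.1 q.1.2 (1 : RR N) * Kt
      - Kt * single q.1.1 q.1.2 (1 : RR N)) p.1.1 p.1.2 with hΨ
  set Q : Matrix (PP N) (PP N) (RR N) := Matrix.of fun p q => mm a q p.1.1 p.1.2 with hQ
  have h1 : Φ * Q = 1 := by
    ext1 p q
    rw [Matrix.mul_apply]
    simp only [hΦ, hQ, Matrix.of_apply]
    rw [← comm_decomp (mm_su a q), mm_comm ha, Matrix.single_apply, Matrix.one_apply]
    by_cases h : p = q
    · subst h; simp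
    · rw [if_neg h, if_neg]
      rintro ⟨h1, h2⟩
      exact h (Subtype.ext (Prod.ext h1.symm h2.symm))
  have h2 : Q * Φ = 1 := mul_eq_one_comm.1 h1
  have h3 : (Φ * (Ψ * Q)).trace = Ψ.trace := by
    rw [Matrix.trace_mul_comm, mul_assoc, h2, mul_one]
  have h4 : Ψ.trace = ∑ p : PP N, (Kt p.1.2 p.1.2 - Kt p.1.1 p.1.1) := by
    rw [Matrix.trace]
    refine Finset.sum_congr rfl fun p _ => ?_
    rw [Matrix.diag_apply, hΨ, Matrix.of_apply, comm_single_diag]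
  rw [← h4, ← h3, Matrix.trace]
  refine Finset.sum_congr rfl fun p _ => ?_
  rw [comm_decomp (up_su _), Matrix.diag_apply, Matrix.mul_apply]
  refine Finset.sum_congr rfl fun q _ => ?_
  congr 1
  rw [Matrix.mul_apply, up, Matrix.of_apply, if_pos q.2, comm_decomp (mm_su a p)]
  rfl

/-- trace pairing as sum over P -/
lemma trace_su {M Z : Matrix (Fin N) (Fin N) R} (hM : SU M) :
    (M * Z).trace = ∑ p : PP N, M p.1.1 p.1.2 * Z p.1.2 p.1.1 := by
  rw [sumP (fun i j => M i j * Z j i), Matrix.trace]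
  refine Finset.sum_congr rfl fun i _ => ?_
  rw [Matrix.diag_apply, Matrix.mul_apply]
  refine Finset.sum_congr rfl fun j _ => ?_
  split_ifs with h
  · rfl
  · rw [hM i j (not_lt.1 h), zero_mul]

end SDrho
end EPF

namespace EPF
section SDrho2
set_option linter.unusedSectionVars false
set_option linter.unusedSimpArgs false
open MvPolynomial
variable {N : ℕ} {R : Type*} [CommRing R] [Algebra ℂ R]

lemma UT.mul {M K : Matrix (Fin N) (Fin N) R} (h : UT M) (hK : UT K) : UT (M * K) := by
  intro i j hij
  rw [Matrix.mul_apply]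
  refine Finset.sum_eq_zero fun k _ => ?_
  rcases lt_or_ge k i with hk | hk
  · rw [h i k hk, zero_mul]
  · rw [hK k j (lt_of_lt_of_le hij hk), mul_zero]

lemma UT.comm_su {M K : Matrix (Fin N) (Fin N) R} (h : UT M) (hK : UT K) :
    SU (M * K - K * M) := by
  intro i j hij
  rcases eq_or_lt_of_le hij with rfl | hij
  · rw [Matrix.sub_apply, h.diag_mul hK, hK.diag_mul h]; ring
  · rw [Matrix.sub_apply, h.mul hK i j hij, hK.mul h i j hij, sub_zero]

lemma lower_comm {M K : Matrix (Fin N) (Fin N) R} (h : UT Mᵀ) (hK : UT Kᵀ) (i j : Fin N)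
    (hij : i ≤ j) : (M * K - K * M) i j = 0 := by
  have := h.comm_su hK j i hij
  rw [← Matrix.transpose_mul, ← Matrix.transpose_mul, ← Matrix.transpose_sub] at this
  have h2 : (K * M - M * K) i j = 0 := this
  rw [Matrix.sub_apply] at h2 ⊢
  linear_combination -h2

lemma lo_ut (M : Matrix (Fin N) (Fin N) R) : UT (M - up M)ᵀ := by
  intro i j h
  simp [up, h]

lemma Y0_ut (b : Fin N → ℂ) : UT (Y0 b)ᵀ := by
  intro i j h
  simp [Y0, Ts, Am, h.not_gt, h.ne]

lemma X_ut (a : Fin N → ℂ) : UT (Am (RR N) a + Tm N) := by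
  intro i j h
  rw [Matrix.add_apply, Am_ut a i j h, Tm_su i j h.le, add_zero]

noncomputable def vf (a b : Fin N → ℂ) (Kt : Matrix (Fin N) (Fin N) (RR N)) :
    Derivation ℂ (RR N) (RR N) :=
  mkDerivation ℂ (Sum.elim
    (fun p => -(up Kt * (Am (RR N) a + Tm N) - (Am (RR N) a + Tm N) * up Kt) p.1.1 p.1.2)
    (fun p => ((Kt - up Kt) * Y0 b - Y0 b * (Kt - up Kt)) p.1.2 p.1.1))

lemma vf_T (a b : Fin N → ℂ) (Kt : Matrix (Fin N) (Fin N) (RR N)) :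
    (Tm N).map (vf a b Kt) =
      -(up Kt * (Am (RR N) a + Tm N) - (Am (RR N) a + Tm N) * up Kt) := by
  ext1 i j
  rcases lt_or_ge i j with h | h
  · simp only [Matrix.map_apply]
    conv_lhs => rw [Tm, Matrix.of_apply, dif_pos h, vf, mkDerivation_X]
    rfl
  · rw [Matrix.map_apply, Tm_su i j h, map_zero, Matrix.neg_apply,
      (up_su Kt).ut.comm_su (X_ut a) i j h, neg_zero]

lemma vf_Y0 (a b : Fin N → ℂ) (Kt : Matrix (Fin N) (Fin N) (RR N)) :
    (Y0 b).map (vf a b Kt) = (Kt - up Kt) * Y0 b - Y0 b * (Kt - up Kt) := by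
  rw [Y0_map]
  ext1 i j
  rcases lt_or_ge j i with h | h
  · simp only [Matrix.map_apply]
    conv_lhs => rw [Ts, Matrix.of_apply, dif_pos h, vf, mkDerivation_X]
    rfl
  · rw [lower_comm (lo_ut Kt) (Y0_ut b) i j h, Matrix.map_apply]
    simp [Ts, h.not_gt]

lemma vf_energy (a b : Fin N → ℂ) (Kt : Matrix (Fin N) (Fin N) (RR N)) :
    (∑ p, X (Sum.inr p) * vf a b Kt (X (Sum.inl p)))
        + (∑ p, X (Sum.inl p) * vf a b Kt (X (Sum.inr p))) =
      -((Kt * (Am (RR N) a + Tm N) - (Am (RR N) a + Tm N) * Kt) * Y0 b).trace := by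
  have h1 : ∑ p, X (Sum.inr p) * vf a b Kt (X (Sum.inl p)) =
      (((Tm N).map (vf a b Kt)) * Y0 b).trace := by
    rw [trace_su (by intro i j h; simp [Tm_su i j h])]
    refine Finset.sum_congr rfl fun p _ => ?_
    rw [mul_comm]
    congr 1
    · rw [Matrix.map_apply, Tm, Matrix.of_apply, dif_pos p.2]
    · simp [Y0, Am, Ts, p.2, p.2.ne, p.2.ne']
  have h2 : ∑ p, X (Sum.inl p) * vf a b Kt (X (Sum.inr p)) =
      ((Tm N) * ((Y0 b).map (vf a b Kt))).trace := by
    rw [trace_su Tm_su]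
    refine Finset.sum_congr rfl fun p _ => ?_
    congr 1
    · rw [Tm, Matrix.of_apply, dif_pos p.2]
    · rw [Y0_map, Matrix.map_apply, Ts, Matrix.of_apply, dif_pos p.2]
  have h3 : (Am (RR N) a * ((Y0 b).map (vf a b Kt))).trace = 0 := by
    rw [Matrix.trace]
    refine Finset.sum_eq_zero fun i _ => ?_
    rw [Matrix.diag_apply, Am, Matrix.diagonal_mul, vf_Y0,
      lower_comm (lo_ut Kt) (Y0_ut b) i i le_rfl, mul_zero]
  have h4 : ((Tm N) * ((Y0 b).map (vf a b Kt))).trace =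
      ((Am (RR N) a + Tm N) * ((Y0 b).map (vf a b Kt))).trace := by
    rw [add_mul, Matrix.trace_add, h3, zero_add]
  rw [h1, h2, h4, vf_T, vf_Y0]
  set A := Am (RR N) a + Tm N
  set U := up Kt
  set Y := Y0 b
  have e : ∀ K : Matrix (Fin N) (Fin N) (RR N), (A * (K * Y - Y * K)).trace
      = -((K * A - A * K) * Y).trace := by
    intro K
    rw [mul_sub, sub_mul, Matrix.trace_sub, Matrix.trace_sub, ← mul_assoc, ← mul_assoc,
      Matrix.trace_mul_comm (A * Y) K, mul_assoc K A Y]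
    ring
  rw [e, ← Matrix.trace_neg, ← Matrix.trace_neg, ← Matrix.trace_add]
  congr 1
  noncomm_ring

lemma vf_div {a : Fin N → ℂ} (ha : Function.Injective a) (b : Fin N → ℂ)
    (K : Matrix (Fin N) (Fin N) (RR N)) (hK : ∀ δ : Derivation ℂ (RR N) (RR N), K.map δ = 0) :
    (∑ p, pderiv (Sum.inl p) (vf a b (Sm a (Tm N) * K * (Sm a (Tm N))⁻¹) (X (Sum.inl p))))
        + (∑ p, pderiv (Sum.inr p) (vf a b (Sm a (Tm N) * K * (Sm a (Tm N))⁻¹) (X (Sum.inr p))))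
      = 0 := by
  set Kt := Sm a (Tm N) * K * (Sm a (Tm N))⁻¹ with hKt
  have h1 : ∀ p : PP N, pderiv (Sum.inl p) (vf a b Kt (X (Sum.inl p))) =
      - (up (mm a p * Kt - Kt * mm a p) * (Am (RR N) a + Tm N)
      - (Am (RR N) a + Tm N) * up (mm a p * Kt - Kt * mm a p)) p.1.1 p.1.2 := by
    intro p
    have e1 : Kt.map (pderiv (Sum.inl p)) = mm a p * Kt - Kt * mm a p :=
      map_der_conj a Tm_su _ (hK _)
    have e2 : (Am (RR N) a + Tm N).map (pderiv (Sum.inl p)) = single p.1.1 p.1.2 1 := by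
      rw [map_der_add, map_der_Am, zero_add, Tm_map_inl]
    have e3 : (up Kt * (Am (RR N) a + Tm N) - (Am (RR N) a + Tm N) * up Kt).map
        (pderiv (Sum.inl p)) = (up (mm a p * Kt - Kt * mm a p) * (Am (RR N) a + Tm N)
      - (Am (RR N) a + Tm N) * up (mm a p * Kt - Kt * mm a p)) +
        (up Kt * single p.1.1 p.1.2 1 - single p.1.1 p.1.2 1 * up Kt) := by
      have : ∀ M M' : Matrix (Fin N) (Fin N) (RR N), (M - M').map (pderiv (Sum.inl p)) =
        M.map (pderiv (Sum.inl p)) - M'.map (pderiv (Sum.inl p)) := by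
          intro M M'; ext1 i j; simp
      rw [this, map_der_mul, map_der_mul, up_map, e1, e2]
      abel
    have e4 : (up Kt * single p.1.1 p.1.2 (1 : RR N) - single p.1.1 p.1.2 (1 : RR N) * up Kt) p.1.1 p.1.2 = 0 := by
      have := comm_single_diag (up Kt) p.1.1 p.1.2
      rw [up_su Kt _ _ le_rfl, up_su Kt _ _ le_rfl, Matrix.sub_apply] at this
      rw [Matrix.sub_apply]; linear_combination -this
    have e5 := congrFun (congrFun e3 p.1.1) p.1.2
    rw [Matrix.map_apply, Matrix.add_apply, e4, add_zero] at e5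
    rw [vf, mkDerivation_X, Sum.elim_inl, map_neg, e5]
  have h2 : ∀ p : PP N, pderiv (Sum.inr p) (vf a b Kt (X (Sum.inr p))) =
      Kt p.1.2 p.1.2 - Kt p.1.1 p.1.1 := by
    intro p
    have e1 : Kt.map (pderiv (Sum.inr p)) = 0 := by
      rw [map_der_conj a Tm_su _ (hK _), logd_inr ha]; simp
    have e2 : (Kt - up Kt).map (pderiv (Sum.inr p)) = 0 := by
      have : (Kt - up Kt).map (pderiv (Sum.inr p)) =
          Kt.map (pderiv (Sum.inr p)) - up (Kt.map (pderiv (Sum.inr p))) := by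
        rw [← up_map]; ext1 i j; simp
      rw [this, e1]; ext1 i j; simp [up]
    have e3 : ((Kt - up Kt) * Y0 b - Y0 b * (Kt - up Kt)).map (pderiv (Sum.inr p)) =
        (Kt - up Kt) * single p.1.2 p.1.1 1 - single p.1.2 p.1.1 1 * (Kt - up Kt) := by
      have : ∀ M M' : Matrix (Fin N) (Fin N) (RR N), (M - M').map (pderiv (Sum.inr p)) =
        M.map (pderiv (Sum.inr p)) - M'.map (pderiv (Sum.inr p)) := by
          intro M M'; ext1 i j; simp
      rw [this, map_der_mul, map_der_mul, e2, Y0_map, Ts_map_inr]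
      simp
    have e5 := congrFun (congrFun e3 p.1.2) p.1.1
    rw [Matrix.map_apply] at e5
    rw [vf, mkDerivation_X, Sum.elim_inr, e5]
    have := comm_single_diag (Kt - up Kt) p.1.2 p.1.1
    rw [Matrix.sub_apply] at this ⊢
    rw [Matrix.sub_apply, Matrix.sub_apply, up_su Kt _ _ le_rfl, up_su Kt _ _ le_rfl] at this
    linear_combination -this
  simp only [h1, h2]
  rw [Finset.sum_neg_distrib, div_trace ha, neg_add_cancel]

lemma trace_single_mul (i j : Fin N) (M : Matrix (Fin N) (Fin N) R) :
    (single i j (1 : R) * M).trace = M j i := by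
  simp [Matrix.trace, Matrix.mul_apply, Matrix.single_apply, ite_and]

lemma conj_comm {M : Type*} [Ring M] (S S' K Y : M) (h : S' * S = 1) :
    S' * (S * K * S' * Y - Y * (S * K * S')) * S = K * (S' * Y * S) - S' * Y * S * K := by
  rw [mul_sub, sub_mul]
  congr 1
  · rw [← mul_assoc, ← mul_assoc, ← mul_assoc, h, one_mul]; simp only [mul_assoc]
  · simp only [mul_assoc, h, mul_one]

lemma lo_comm_aux {M : Type*} [Ring M] (K U Y : M) :
    (K - U) * Y - Y * (K - U) + (Y * -U - -U * Y) = K * Y - Y * K := by noncomm_ring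

lemma neg_comm_aux {M : Type*} [Ring M] (U Z : M) : -U * Z - Z * -U = -(U * Z - Z * U) := by
  noncomm_ring

lemma trace_conj_aux (S K S' Y : Matrix (Fin N) (Fin N) R) :
    (S * K * S' * Y).trace = (K * (S' * Y * S)).trace := by
  rw [Matrix.mul_assoc, Matrix.mul_assoc, Matrix.trace_mul_comm, Matrix.mul_assoc,
    Matrix.mul_assoc]

lemma sd_wick {a : Fin N → ℂ} (ha : Function.Injective a) (b : Fin N → ℂ) (i j : Fin N)
    (G : Poly N) :
    wickL (evM (Ym a b) (Dd i j G)) = (a i - a j) * wickL (evM (Ym a b) (X (j, i) * G)) := by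
  set K : Matrix (Fin N) (Fin N) (RR N) := single i j 1 with hKdef
  have hK : ∀ δ : Derivation ℂ (RR N) (RR N), K.map δ = 0 := by
    intro δ; ext1 p q
    rw [Matrix.map_apply, hKdef, Matrix.single_apply]; split_ifs <;> simp
  set S := Sm a (Tm N) with hS
  set Kt := S * K * S⁻¹ with hKt
  have hSS : S⁻¹ * S = 1 := Sm_inv_mul a Tm_su
  have hSS' : S * S⁻¹ = 1 := Sm_mul_inv a Tm_su
  have hlog : logd a (Tm N) (vf a b Kt) = - up Kt := by
    refine logd_eq ha Tm_su _ (up_su Kt).neg ?_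
    rw [vf_T]; exact neg_comm_aux _ _
  have hY : (Ym a b).map (vf a b Kt) = K * Ym a b - Ym a b * K := by
    rw [Ym, map_der_conj' a Tm_su, hlog, vf_Y0, ← hS]
    rw [lo_comm_aux]
    exact conj_comm S S⁻¹ K (Y0 b) hSS
  rw [← der_evM (Ym a b) (vf a b Kt) i j hY G, wickL_derivation, sub_sub, vf_div ha b K hK,
    sub_zero, vf_energy]
  have hE : -((Kt * (Am (RR N) a + Tm N) - (Am (RR N) a + Tm N) * Kt) * Y0 b).trace
      = C (a i - a j) * Ym a b j i := by
    have e1 : Kt * (Am (RR N) a + Tm N) = S * (K * Am (RR N) a) * S⁻¹ := by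
      rw [hKt, mul_assoc, Sm_inv_eq ha Tm_su]; simp only [mul_assoc, hS]
    have e2 : (Am (RR N) a + Tm N) * Kt = S * (Am (RR N) a * K) * S⁻¹ := by
      rw [hKt, ← mul_assoc, ← mul_assoc, Sm_eq ha Tm_su]; simp only [mul_assoc, hS]
    have e3 : K * Am (RR N) a - Am (RR N) a * K = (C (a j - a i) : RR N) • K := by
      ext1 p q
      rw [hKdef, Am, Matrix.sub_apply, Matrix.mul_diagonal, Matrix.diagonal_mul, Matrix.smul_apply,
        Matrix.single_apply, smul_eq_mul, algebraMap_eq]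
      split_ifs with h
      · obtain ⟨rfl, rfl⟩ := h; rw [map_sub]; ring
      · ring
    have e4 : S⁻¹ * Y0 b * S = Ym a b := rfl
    rw [e1, e2, ← sub_mul, ← mul_sub, e3, trace_conj_aux, e4, smul_mul_assoc, Matrix.trace_smul,
      hKdef, trace_single_mul, smul_eq_mul, map_sub, map_sub]
    ring
  rw [hE, map_mul (evM (Ym a b)), evM_X]
  rw [show evM (Ym a b) G * (C (a i - a j) * Ym a b j i) = (a i - a j) •
    (Ym a b j i * evM (Ym a b) G) by rw [MvPolynomial.smul_eq_C_mul]; ring, map_smul, smul_eq_mul]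

end SDrho2
end EPF

namespace EPF
section HDsec
set_option linter.unusedSectionVars false
set_option linter.unusedSimpArgs false
open MvPolynomial Topology

inductive HD {R : Type*} [CommRing R] [Algebra ℂ R] (x0 : ℂ) : (ℂ → R) → R → Prop
  | smul (c : ℂ → ℂ) (c' : ℂ) (r : R) (h : HasDerivAt c c' x0) :
      HD x0 (fun x => c x • r) (c' • r)
  | add (f g : ℂ → R) (f' g' : R) (hf : HD x0 f f') (hg : HD x0 g g') :
      HD x0 (fun x => f x + g x) (f' + g')

variable {R : Type*} [CommRing R] [Algebra ℂ R] {x0 : ℂ}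

lemma HD.const (r : R) : HD x0 (fun _ => r) 0 := by
  have := HD.smul (x0 := x0) (fun _ => (1 : ℂ)) 0 r (hasDerivAt_const _ _)
  simpa using this

lemma HD.mul {f g : ℂ → R} {f' g' : R} (hf : HD x0 f f') (hg : HD x0 g g') :
    HD x0 (fun x => f x * g x) (f' * g x0 + f x0 * g') := by
  induction hf with
  | smul c c' r h =>
    induction hg with
    | smul d d' s h2 =>
      have := HD.smul (x0 := x0) _ _ (r * s) (h.mul h2)
      convert this using 1
      · funext x; simp only [smul_mul_smul_comm, Pi.mul_apply]
      · simp only [smul_mul_smul_comm, add_smul]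
    | add g1 g2 g1' g2' _ _ ih1 ih2 =>
      have := HD.add _ _ _ _ ih1 ih2
      convert this using 1
      · funext x; ring
      · ring
  | add f1 f2 f1' f2' _ _ ih1 ih2 =>
    have := HD.add _ _ _ _ ih1 ih2
    convert this using 1
    · funext x; ring
    · ring

lemma HD.algMap {c : ℂ → ℂ} {c' : ℂ} (h : HasDerivAt c c' x0) :
    HD x0 (fun x => algebraMap ℂ R (c x)) (algebraMap ℂ R c') := by
  have := HD.smul (x0 := x0) _ _ (1 : R) h
  simpa only [Algebra.algebraMap_eq_smul_one] using this

lemma HD.sum {ι : Type*} (s : Finset ι) {f : ι → ℂ → R} {f' : ι → R}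
    (h : ∀ i ∈ s, HD x0 (f i) (f' i)) : HD x0 (fun x => ∑ i ∈ s, f i x) (∑ i ∈ s, f' i) := by
  classical
  induction s using Finset.induction_on with
  | empty => simpa using HD.const (x0 := x0) (0 : R)
  | insert i s hi ih =>
    simp only [Finset.sum_insert hi]
    exact HD.add _ _ _ _ (h i (by simp)) (ih fun j hj => h j (by simp [hj]))

lemma HD.prodE {ι : Type*} (s : Finset ι) {f : ι → ℂ → R}
    (h : ∀ i ∈ s, ∃ f', HD x0 (f i) f') : ∃ f', HD x0 (fun x => ∏ i ∈ s, f i x) f' := by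
  classical
  induction s using Finset.induction_on with
  | empty => exact ⟨0, by simpa using HD.const (x0 := x0) (1 : R)⟩
  | insert i s hi ih =>
    simp only [Finset.prod_insert hi]
    obtain ⟨f1, h1⟩ := h i (by simp)
    obtain ⟨f2, h2⟩ := ih fun j hj => h j (by simp [hj])
    exact ⟨_, h1.mul h2⟩

lemma HD.sumE {ι : Type*} (s : Finset ι) {f : ι → ℂ → R}
    (h : ∀ i ∈ s, ∃ f', HD x0 (f i) f') : ∃ f', HD x0 (fun x => ∑ i ∈ s, f i x) f' := by
  classical
  choose! f' hf using h
  exact ⟨_, HD.sum s hf⟩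

lemma HD.lin {f : ℂ → R} {f' : R} (hf : HD x0 f f') (φ : R →ₗ[ℂ] ℂ) :
    HasDerivAt (fun x => φ (f x)) (φ f') x0 := by
  induction hf with
  | smul c c' r h => simpa using h.mul_const (φ r)
  | add f g f' g' _ _ h1 h2 =>
    simp only [map_add]
    exact h1.add h2

lemma HD.unique {σ : Type*} {f g : ℂ → MvPolynomial σ ℂ} {f' g' : MvPolynomial σ ℂ}
    (hf : HD x0 f f') (hg : HD x0 g g') (h : f =ᶠ[𝓝 x0] g) : f' = g' := by
  ext m
  have h1 := hf.lin (MvPolynomial.lcoeff ℂ m)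
  have h2 := hg.lin (MvPolynomial.lcoeff ℂ m)
  have h3 : (fun x => MvPolynomial.lcoeff ℂ m (f x)) =ᶠ[𝓝 x0]
    fun x => MvPolynomial.lcoeff ℂ m (g x) := h.mono fun x hx => by simp only [hx]
  exact h1.unique (h2.congr_of_eventuallyEq h3)

lemma HD.aeval {σ : Type*} {y : ℂ → σ → R} (δ : Derivation ℂ R R)
    (h : ∀ p, HD x0 (fun x => y x p) (-δ (y x0 p))) (G : MvPolynomial σ ℂ) :
    HD x0 (fun x => MvPolynomial.aeval (y x) G) (-δ (MvPolynomial.aeval (y x0) G)) := by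
  induction G using MvPolynomial.induction_on with
  | C a => simpa using HD.const (x0 := x0) (algebraMap ℂ R a)
  | add p q hp hq =>
    have := HD.add _ _ _ _ hp hq
    simp only [map_add]
    convert this using 1
    ring
  | mul_X p i hp =>
    have := hp.mul (h i)
    simp only [map_mul, MvPolynomial.aeval_X]
    convert this using 1
    simp only [Derivation.leibniz, smul_eq_mul]; ring

/-- matrix version -/
def HDM {N : ℕ} (x0 : ℂ) (f : ℂ → Matrix (Fin N) (Fin N) R) (f' : Matrix (Fin N) (Fin N) R) :
    Prop := ∀ i j, HD x0 (fun x => f x i j) (f' i j)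

variable {N : ℕ}

lemma HDM.mul {f g : ℂ → Matrix (Fin N) (Fin N) R} {f' g' : Matrix (Fin N) (Fin N) R}
    (hf : HDM x0 f f') (hg : HDM x0 g g') :
    HDM x0 (fun x => f x * g x) (f' * g x0 + f x0 * g') := by
  intro i j
  have := HD.sum Finset.univ (fun k _ => (hf i k).mul (hg k j))
  simp only [Matrix.mul_apply, Matrix.add_apply]
  rw [← Finset.sum_add_distrib]
  exact this

lemma HDM.const (M : Matrix (Fin N) (Fin N) R) : HDM x0 (fun _ => M) 0 :=
  fun i j => HD.const _

lemma HDM.add {f g : ℂ → Matrix (Fin N) (Fin N) R} {f' g' : Matrix (Fin N) (Fin N) R}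
    (hf : HDM x0 f f') (hg : HDM x0 g g') :
    HDM x0 (fun x => f x + g x) (f' + g') := fun i j => HD.add _ _ _ _ (hf i j) (hg i j)

lemma HDM.unique {σ : Type*} {f g : ℂ → Matrix (Fin N) (Fin N) (MvPolynomial σ ℂ)}
    {f' g' : Matrix (Fin N) (Fin N) (MvPolynomial σ ℂ)}
    (hf : HDM x0 f f') (hg : HDM x0 g g') (h : f =ᶠ[𝓝 x0] g) : f' = g' := by
  ext1 i j
  exact (hf i j).unique (hg i j) (h.mono fun x hx => by simp only [hx])

lemma HDM.adjE {f : ℂ → Matrix (Fin N) (Fin N) R} {f' : Matrix (Fin N) (Fin N) R}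
    (hf : HDM x0 f f') : ∃ g', HDM x0 (fun x => (f x).adjugate) g' := by
  have : ∀ i j, ∃ g', HD x0 (fun x => (f x).adjugate i j) g' := by
    intro i j
    simp only [Matrix.adjugate_apply, Matrix.det_apply']
    refine HD.sumE _ fun σ _ => ?_
    obtain ⟨g, hg⟩ := HD.prodE (x0 := x0) (R := R) Finset.univ
      (f := fun k x => (f x).updateRow j (Pi.single i 1) (σ k) k) (by
        intro k _
        by_cases h : σ k = j
        · simp only [Matrix.updateRow_apply, h, if_true]
          exact ⟨_, HD.const _⟩
        · simp only [Matrix.updateRow_apply, h, if_false]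
          exact ⟨_, hf _ _⟩)
    exact ⟨_, (HD.const _).mul hg⟩
  choose g' hg' using this
  exact ⟨Matrix.of g', hg'⟩

lemma hd_update (a : Fin N → ℂ) (l i : Fin N) :
    HasDerivAt (fun x => Function.update a l x i) (if i = l then 1 else 0) (a l) := by
  by_cases h : i = l
  · subst h; simpa using hasDerivAt_id' _
  · simpa [h] using hasDerivAt_const _ _

lemma hdm_Am (a : Fin N → ℂ) (l : Fin N) :
    HDM (a l) (fun x => Am R (Function.update a l x)) (single l l 1) := by
  intro i j
  by_cases h : i = j
  · subst h
    have := HD.algMap (R := R) (hd_update a l i)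
    simp only [Am, Matrix.diagonal_apply_eq]
    convert this using 1
    by_cases h : i = l
    · subst h; simp
    · simp [h, Matrix.single_apply, Ne.symm h]
  · simp only [Am, Matrix.diagonal_apply_ne _ h]
    have := HD.const (x0 := a l) (0 : R)
    convert this using 1
    rw [Matrix.single_apply, if_neg]
    rintro ⟨rfl, h2⟩; exact h h2

lemma hdm_Sm {a : Fin N → ℂ} (ha : Function.Injective a) (l : Fin N)
    (T : Matrix (Fin N) (Fin N) R) :
    ∃ S', HDM (a l) (fun x => Sm (Function.update a l x) T) S' := by
  have key : ∀ m : ℕ, ∃ S', HDM (a l) (fun x => (step (Function.update a l x) T)^[m] 0) S' := by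
    intro m
    induction m with
    | zero => exact ⟨_, HDM.const _⟩
    | succ m ih =>
      obtain ⟨S', hS'⟩ := ih
      simp only [Function.iterate_succ_apply']
      have : ∀ i j, ∃ g, HD (a l) (fun x => step (Function.update a l x) T
          ((step (Function.update a l x) T)^[m] 0) i j) g := by
        intro i j
        simp only [step, Matrix.of_apply]
        split_ifs with h1 h2
        · exact ⟨_, HD.const _⟩
        · have hd := ((hd_update a l j).sub (hd_update a l i)).inv (by
            simp only [Pi.sub_apply, Function.update_eq_self]
            exact sub_ne_zero.2 fun e => h2.ne (ha e).symm)
          exact ⟨_, (HD.algMap hd).mul ((HDM.const T).mul hS' i j)⟩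
        · exact ⟨_, HD.const _⟩
      choose g hg using this
      exact ⟨Matrix.of g, hg⟩
  exact key N

lemma update_inj_ev {a : Fin N → ℂ} (ha : Function.Injective a) (l : Fin N) :
    ∀ᶠ x in 𝓝 (a l), Function.Injective (Function.update a l x) := by
  have h : ∀ j : Fin N, ∀ᶠ x in 𝓝 (a l), j ≠ l → x ≠ a j := by
    intro j
    by_cases hj : j = l
    · simp [hj]
    · filter_upwards [isOpen_ne.mem_nhds (show a l ≠ a j from fun e => hj (ha e).symm)] with x hx _
      exact hx
  filter_upwards [Filter.eventually_all.2 h] with x hx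
  intro i j hij
  by_cases hi : i = l <;> by_cases hj : j = l
  · rw [hi, hj]
  · subst hi; simp [hj] at hij; exact absurd hij (hx j hj)
  · subst hj; simp [hi] at hij; exact absurd hij.symm (hx i hi)
  · simp [hi, hj] at hij; exact ha hij

end HDsec
end EPF

namespace EPF
section Evrho
set_option linter.unusedSectionVars false
set_option linter.unusedSimpArgs false
open MvPolynomial Topology
variable {N : ℕ}

noncomputable def tauM (a : Fin N → ℂ) (l : Fin N) : Matrix (Fin N) (Fin N) (RR N) :=
  Sm a (Tm N) * single l l 1 * (Sm a (Tm N))⁻¹ - single l l 1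

lemma single_ut {R : Type*} [CommRing R] (l : Fin N) : UT (single l l (1 : R)) := by
  intro i j h
  rw [Matrix.single_apply, if_neg]
  rintro ⟨rfl, rfl⟩; exact lt_irrefl _ h

lemma tauM_su (a : Fin N → ℂ) (l : Fin N) : SU (tauM a l) := by
  intro i j h
  rcases eq_or_lt_of_le h with rfl | h
  · rw [tauM, Matrix.sub_apply, ((Sm_ut a Tm_su).mul (single_ut l)).diag_mul (Sm_inv_ut a Tm_su),
      (Sm_ut a Tm_su).diag_mul (single_ut l), Sm_diag a Tm_su, Sm_inv_diag a Tm_su]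
    ring
  · rw [tauM, Matrix.sub_apply, ((Sm_ut a Tm_su).mul (single_ut l)).mul (Sm_inv_ut a Tm_su) i j h,
      single_ut l i j h, sub_zero]

noncomputable def tvf (a : Fin N → ℂ) (l : Fin N) : Derivation ℂ (RR N) (RR N) :=
  mkDerivation ℂ (Sum.elim (fun p => tauM a l p.1.1 p.1.2) (fun _ => 0))

lemma tvf_T (a : Fin N → ℂ) (l : Fin N) : (Tm N).map (tvf a l) = tauM a l := by
  ext1 i j
  rcases lt_or_ge i j with h | h
  · simp only [Matrix.map_apply]
    conv_lhs => rw [Tm, Matrix.of_apply, dif_pos h, tvf, mkDerivation_X]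
    rfl
  · rw [Matrix.map_apply, Tm_su i j h, map_zero, tauM_su a l i j h]

lemma tvf_Y0 (a b : Fin N → ℂ) (l : Fin N) : (Y0 b).map (tvf a l) = 0 := by
  rw [Y0_map]
  ext1 i j
  simp only [Matrix.map_apply, Ts, Matrix.of_apply]
  split_ifs with h
  · rw [tvf, mkDerivation_X]; rfl
  · simp

lemma hdm_S {a : Fin N → ℂ} (ha : Function.Injective a) (l : Fin N) :
    HDM (a l) (fun x => Sm (Function.update a l x) (Tm N)) (-(Sm a (Tm N)).map (tvf a l)) := by
  obtain ⟨S', hS'⟩ := hdm_Sm ha l (Tm N)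
  have h1 := ((hdm_Am (R := RR N) a l).add (HDM.const (Tm N))).mul hS'
  have h2 := hS'.mul (hdm_Am (R := RR N) a l)
  have h3 := h1.unique h2 (by
    filter_upwards [update_inj_ev ha l] with x hx
    exact Sm_eq hx Tm_su)
  simp only [Function.update_eq_self, add_zero] at h3
  have hsu : SU S' := by
    intro i j h
    refine (hS' i j).unique (HD.const (Sm a (Tm N) i j)) (Filter.Eventually.of_forall fun x => ?_)
    rcases eq_or_lt_of_le h with rfl | h
    · simp only [Sm_diag _ (Tm_su (N := N))]
    · simp only [Sm_ut _ (Tm_su (N := N)) i j h]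
  set S := Sm a (Tm N) with hS
  have h4 := congrArg (fun M => M.map (tvf a l)) (Sm_eq ha (Tm_su (N := N)))
  simp only [map_der_mul, map_der_add, map_der_Am, zero_add, mul_zero, add_zero, tvf_T,
    ← hS] at h4
  have h5 : tauM a l * S = S * single l l 1 - single l l 1 * S := by
    rw [tauM, sub_mul, ← hS, mul_assoc, mul_assoc, hS, Sm_inv_mul a Tm_su, mul_one]
  have hd : SU (S.map (tvf a l)) := by
    rw [hS, logd_mul a Tm_su]; exact (logd_su a Tm_su _).mul_ut (Sm_ut a Tm_su)
  have h6 : S' + S.map (tvf a l) = 0 := by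
    refine SW_unique ha Tm_su (hsu.add hd) ?_
    rw [mul_add, add_mul S', ← h4, h5]
    rw [← sub_eq_zero] at h3 ⊢
    rw [← h3]; abel
  rw [← eq_neg_of_add_eq_zero_left h6]; exact hS'

lemma hdm_Sinv {a : Fin N → ℂ} (ha : Function.Injective a) (l : Fin N) :
    HDM (a l) (fun x => (Sm (Function.update a l x) (Tm N))⁻¹)
      (-((Sm a (Tm N))⁻¹).map (tvf a l)) := by
  have hS := hdm_S ha l
  obtain ⟨g, hg⟩ := hS.adjE
  simp only [← Sm_inv_adj _ (Tm_su (N := N))] at hg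
  have h1 := (hg.mul hS).unique (HDM.const 1) (Filter.Eventually.of_forall fun x =>
    Sm_inv_mul _ Tm_su)
  simp only [Function.update_eq_self] at h1
  have h2 := congrArg (fun M => M.map (tvf a l)) (Sm_inv_mul a (Tm_su (N := N)))
  simp only [map_der_mul, map_der_one] at h2
  have h3 : (g + ((Sm a (Tm N))⁻¹).map (tvf a l)) * Sm a (Tm N) = 0 := by
    rw [add_mul, ← h1]
    rw [mul_neg] at *
    rw [eq_neg_of_add_eq_zero_left h2]
  have h4 : g + ((Sm a (Tm N))⁻¹).map (tvf a l) = 0 := by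
    calc _ = (g + ((Sm a (Tm N))⁻¹).map (tvf a l)) * Sm a (Tm N) * (Sm a (Tm N))⁻¹ := by
          rw [mul_assoc, Sm_mul_inv a Tm_su, mul_one]
      _ = 0 := by rw [h3, zero_mul]
  rw [← eq_neg_of_add_eq_zero_left h4]; exact hg

lemma hdm_Y {a : Fin N → ℂ} (ha : Function.Injective a) (b : Fin N → ℂ) (l : Fin N) :
    HDM (a l) (fun x => Ym (Function.update a l x) b) (-(Ym a b).map (tvf a l)) := by
  have h := ((hdm_Sinv ha l).mul (HDM.const (Y0 b))).mul (hdm_S ha l)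
  simp only [Function.update_eq_self] at h
  have : (-(Ym a b).map (tvf a l)) = (-((Sm a (Tm N))⁻¹).map (tvf a l) * Y0 b +
      (Sm a (Tm N))⁻¹ * 0) * Sm a (Tm N) + (Sm a (Tm N))⁻¹ * Y0 b * -(Sm a (Tm N)).map (tvf a l) := by
    rw [Ym, map_der_mul, map_der_mul, tvf_Y0]
    simp only [mul_zero, add_zero, neg_mul, mul_neg, neg_add]
  rw [this]; exact h

lemma hd_evM {a : Fin N → ℂ} (ha : Function.Injective a) (b : Fin N → ℂ) (l : Fin N) (G : Poly N) :
    HD (a l) (fun x => evM (Ym (Function.update a l x) b) G) (-(tvf a l) (evM (Ym a b) G)) := by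
  have := HD.aeval (x0 := a l) (y := fun x (pq : Fin N × Fin N) =>
    Ym (Function.update a l x) b pq.1 pq.2) (tvf a l) (by
      rintro ⟨i, j⟩
      have := hdm_Y ha b l i j
      simpa using this) G
  simp only [Function.update_eq_self] at this
  exact this

/-- log-derivative of the Vandermonde -/
noncomputable def vdl (a : Fin N → ℂ) (l : Fin N) : ℂ :=
  ∑ p : PP N, (((if p.1.2 = l then 1 else 0) - (if p.1.1 = l then 1 else 0)) *
    (a p.1.2 - a p.1.1)⁻¹)

lemma mm_zero {a : Fin N → ℂ} (ha : Function.Injective a) (p : PP N) (i j : Fin N)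
    (h : ¬ (i ≤ p.1.1 ∧ p.1.2 ≤ j)) : mm a p i j = 0 := by
  refine lemmaZ ha Tm_su (mm_su a p) (fun i j => ¬ (i ≤ p.1.1 ∧ p.1.2 ≤ j)) ?_ ?_ i j h
  · intro x k y hxk hky hQ
    constructor
    · rintro ⟨h1, h2⟩; exact hQ ⟨h1, h2.trans hky.le⟩
    · rintro ⟨h1, h2⟩; exact hQ ⟨hxk.le.trans h1, h2⟩
  · intro x y _ hQ
    rw [mm_comm ha, Matrix.single_apply, if_neg]
    rintro ⟨h1, h2⟩; exact hQ ⟨h1.ge, h2.le⟩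

lemma mm_diag {a : Fin N → ℂ} (ha : Function.Injective a) (p : PP N) :
    mm a p p.1.1 p.1.2 = C ((a p.1.2 - a p.1.1)⁻¹) := by
  have h := congrFun (congrFun (mm_comm ha p) p.1.1) p.1.2
  rw [comm_entry, Finset.sum_eq_zero, add_zero, Matrix.single_apply, if_pos ⟨rfl, rfl⟩] at h
  · have hne : a p.1.2 - a p.1.1 ≠ 0 := sub_ne_zero.2 fun e => p.2.ne (ha e).symm
    rw [algebraMap_eq] at h
    calc _ = C ((a p.1.2 - a p.1.1)⁻¹) * (C (a p.1.2 - a p.1.1) * mm a p p.1.1 p.1.2) := by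
          rw [← mul_assoc, ← C_mul, inv_mul_cancel₀ hne, C_1, one_mul]
      _ = _ := by rw [h, mul_one]
  · intro k _
    have e1 : mm a p p.1.1 k * Tm N k p.1.2 = 0 := by
      rcases le_or_gt p.1.2 k with hk | hk
      · rw [Tm_su k _ hk, mul_zero]
      · rw [mm_zero ha p _ _ (fun h => absurd h.2 hk.not_ge), zero_mul]
    have e2 : Tm N p.1.1 k * mm a p k p.1.2 = 0 := by
      rcases le_or_gt k p.1.1 with hk | hk
      · rw [Tm_su _ k hk, zero_mul]
      · rw [mm_zero ha p _ _ (fun h => absurd h.1 hk.not_ge), mul_zero]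
    rw [e1, e2, sub_zero]

lemma tau_div {a : Fin N → ℂ} (ha : Function.Injective a) (l : Fin N) :
    ∑ p : PP N, pderiv (Sum.inl p) (tauM a l p.1.1 p.1.2) = C (vdl a l) := by
  rw [vdl, map_sum]
  refine Finset.sum_congr rfl fun p _ => ?_
  have hK : ∀ δ : Derivation ℂ (RR N) (RR N), (single l l (1 : RR N)).map δ = 0 := by
    intro δ; ext1 p q
    rw [Matrix.map_apply, Matrix.single_apply]; split_ifs <;> simp
  have e0 : Sm a (Tm N) * single l l 1 * (Sm a (Tm N))⁻¹ = tauM a l + single l l 1 := by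
    rw [tauM]; abel
  have e1 : (tauM a l).map (pderiv (Sum.inl p)) = mm a p * (tauM a l + single l l 1) -
      (tauM a l + single l l 1) * mm a p := by
    have h1 := map_der_conj a (Tm_su (N := N)) (pderiv (Sum.inl p)) (hK _)
    rw [e0, map_der_add, hK, add_zero] at h1
    exact h1
  have e2 := congrFun (congrFun e1 p.1.1) p.1.2
  rw [Matrix.map_apply] at e2
  rw [e2, mul_add, add_mul, Matrix.sub_apply, Matrix.add_apply, Matrix.add_apply]
  have z1 : (mm a p * tauM a l) p.1.1 p.1.2 = 0 := by
    rw [Matrix.mul_apply]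
    refine Finset.sum_eq_zero fun k _ => ?_
    rcases le_or_gt p.1.2 k with hk | hk
    · rw [tauM_su a l k _ hk, mul_zero]
    · rw [mm_zero ha p _ _ (fun h => absurd h.2 hk.not_ge), zero_mul]
  have z2 : (tauM a l * mm a p) p.1.1 p.1.2 = 0 := by
    rw [Matrix.mul_apply]
    refine Finset.sum_eq_zero fun k _ => ?_
    rcases le_or_gt k p.1.1 with hk | hk
    · rw [tauM_su a l _ k hk, zero_mul]
    · rw [mm_zero ha p _ _ (fun h => absurd h.1 hk.not_ge), mul_zero]
  have z3 : (mm a p * single l l (1 : RR N)) p.1.1 p.1.2 =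
      (if p.1.2 = l then 1 else 0) * mm a p p.1.1 p.1.2 := by
    rw [Matrix.mul_apply]
    by_cases h : p.1.2 = l
    · simp [Matrix.single_apply, h]
    · simp [Matrix.single_apply, h, Ne.symm h]
  have z4 : (single l l (1 : RR N) * mm a p) p.1.1 p.1.2 =
      (if p.1.1 = l then 1 else 0) * mm a p p.1.1 p.1.2 := by
    rw [Matrix.mul_apply]
    by_cases h : p.1.1 = l
    · simp [Matrix.single_apply, h]
    · simp [Matrix.single_apply, h, Ne.symm h]
  rw [z1, z2, z3, z4, mm_diag ha, C_mul, map_sub]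
  simp only [apply_ite C, C_1, C_0]
  ring

lemma tau_energy (a b : Fin N → ℂ) (l : Fin N) :
    ∑ p : PP N, X (Sum.inr p) * tauM a l p.1.1 p.1.2 = Ym a b l l - C (b l) := by
  have h1 : ∑ p : PP N, X (Sum.inr p) * tauM a l p.1.1 p.1.2 = (tauM a l * Y0 b).trace := by
    rw [trace_su (tauM_su a l)]
    refine Finset.sum_congr rfl fun p _ => ?_
    rw [mul_comm]
    congr 1
    simp [Y0, Am, Ts, p.2, p.2.ne, p.2.ne']
  rw [h1, tauM, sub_mul, Matrix.trace_sub, trace_conj_aux, trace_single_mul, trace_single_mul]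
  congr 1
  simp [Y0, Am, Ts]

lemma ev_wick {a : Fin N → ℂ} (ha : Function.Injective a) (b : Fin N → ℂ) (l : Fin N)
    (G : Poly N) :
    HasDerivAt (fun x => wickL (evM (Ym (Function.update a l x) b) G))
      (-wickL (evM (Ym a b) (X (l, l) * G)) + (b l + vdl a l) * wickL (evM (Ym a b) G)) (a l) := by
  have h := (hd_evM ha b l G).lin wickL
  convert h using 1
  rw [map_neg, wickL_derivation]
  have e1 : ∀ p : PP N, tvf a l (X (Sum.inl p)) = tauM a l p.1.1 p.1.2 := by
    intro p; rw [tvf, mkDerivation_X]; rfl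
  have e2 : ∀ p : PP N, tvf a l (X (Sum.inr p)) = 0 := by
    intro p; rw [tvf, mkDerivation_X]; rfl
  simp only [e1, e2, mul_zero, Finset.sum_const_zero, add_zero, map_zero, sub_zero]
  rw [tau_energy a b l, tau_div ha, map_mul (evM (Ym a b)), evM_X]
  have : evM (Ym a b) G * (Ym a b l l - C (b l) - C (vdl a l)) =
      Ym a b l l * evM (Ym a b) G - (b l + vdl a l) • evM (Ym a b) G := by
    rw [MvPolynomial.smul_eq_C_mul, map_add]; ring
  rw [this, map_sub, map_smul, smul_eq_mul]
  ring

end Evrho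
end EPF

namespace EPF
section Abs
set_option linter.unusedSectionVars false
set_option linter.unusedSimpArgs false
open MvPolynomial Topology
variable {N : ℕ}

def SD (a : Fin N → ℂ) (E : Poly N →ₗ[ℂ] ℂ) : Prop :=
  ∀ i j, i ≠ j → ∀ G, (a i - a j) * E (X (j, i) * G) = E (Dd i j G)

def Ev (E : (Fin N → ℂ) → Poly N →ₗ[ℂ] ℂ) : Prop :=
  ∀ a, Function.Injective a → ∀ l G,
    HasDerivAt (fun x => E (Function.update a l x) G) (-E a (X (l, l) * G)) (a l)

/-- diagonal embedding -/
noncomputable def dE (N : ℕ) : MvPolynomial (Fin N) ℂ →ₐ[ℂ] Poly N := rename fun i => (i, i)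

lemma dE_X (i : Fin N) : dE N (X i) = X (i, i) := by simp [dE]

lemma Dd_hom (i j : Fin N) {n : ℕ} {G : Poly N} (hG : G.IsHomogeneous n) :
    (Dd i j G).IsHomogeneous n := by
  rcases n with _ | n
  · rw [← totalDegree_zero_iff_isHomogeneous, totalDegree_eq_zero_iff_eq_C] at hG
    rw [hG, ← algebraMap_eq, Derivation.map_algebraMap]
    exact isHomogeneous_zero _ _ _
  · have h0 := derivation_eq_sum (X : Fin N × Fin N → Poly N) (Dd i j) G
    simp only [aeval_X_left, AlgHom.id_apply] at h0
    rw [h0]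
    refine IsHomogeneous.sum _ _ _ fun p _ => ?_
    refine IsHomogeneous.mul (hG.pderiv (i := p)) ?_
    rw [Dd, mkDerivation_X]
    refine IsHomogeneous.sub ?_ ?_
    · split_ifs
      · exact isHomogeneous_X _ _
      · exact isHomogeneous_zero _ _ _
    · split_ifs
      · exact isHomogeneous_X _ _
      · exact isHomogeneous_zero _ _ _

lemma NF {a : Fin N → ℂ} (ha : Function.Injective a) (G : Poly N) :
    ∃ q : MvPolynomial (Fin N) ℂ, ∀ E : Poly N →ₗ[ℂ] ℂ, SD a E → E G = E (dE N q) := by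
  have hsum : ∀ {ι : Type} (s : Finset ι) (f : ι → Poly N),
      (∀ i ∈ s, ∃ q : MvPolynomial (Fin N) ℂ, ∀ E : Poly N →ₗ[ℂ] ℂ, SD a E →
        E (f i) = E (dE N q)) → ∃ q : MvPolynomial (Fin N) ℂ, ∀ E : Poly N →ₗ[ℂ] ℂ, SD a E →
        E (∑ i ∈ s, f i) = E (dE N q) := by
    intro ι s f h
    choose! q hq using h
    refine ⟨∑ i ∈ s, q i, fun E hE => ?_⟩
    rw [map_sum, map_sum, map_sum]
    exact Finset.sum_congr rfl fun i hi => hq i hi E hE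
  have key : ∀ n : ℕ, ∀ G : Poly N, G.IsHomogeneous n →
      ∃ q : MvPolynomial (Fin N) ℂ, ∀ E : Poly N →ₗ[ℂ] ℂ, SD a E → E G = E (dE N q) := by
    intro n
    induction n with
    | zero =>
      intro G hG
      rw [← totalDegree_zero_iff_isHomogeneous, totalDegree_eq_zero_iff_eq_C] at hG
      refine ⟨C (coeff 0 G), fun E _ => ?_⟩
      rw [dE, rename_C, ← hG]
    | succ n ih =>
      intro G hG
      rw [G.as_sum]
      refine hsum _ _ fun m hm => ?_
      have hdeg : m.degree = n + 1 := by
        have := hG (mem_support_iff.1 hm)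
        rw [Finsupp.degree_eq_weight_one]; exact this
      by_cases hdiag : ∀ p ∈ m.support, p.1 = p.2
      · obtain ⟨q, hq⟩ := exists_rename_eq_of_vars_subset_range (monomial m (coeff m G))
          (fun i : Fin N => (i, i)) (fun i j h => (Prod.ext_iff.1 h).1) (by
            rw [vars_monomial (mem_support_iff.1 hm)]
            intro p hp
            exact ⟨p.1, Prod.ext rfl (hdiag p hp)⟩)
        exact ⟨q, fun E _ => by rw [dE, hq]⟩
      · push Not at hdiag
        obtain ⟨⟨j, i⟩, hp, hne⟩ := hdiag
        have hle : Finsupp.single (j, i) 1 ≤ m := by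
          rw [Finsupp.single_le_iff]
          exact Nat.one_le_iff_ne_zero.2 (Finsupp.mem_support_iff.1 hp)
        set m' := m - Finsupp.single (j, i) 1 with hm'
        have hmm : m = Finsupp.single (j, i) 1 + m' := (add_tsub_cancel_of_le hle).symm
        have hd' : m'.degree = n := by
          have : m.degree = 1 + m'.degree := by
            conv_lhs => rw [hmm]
            simp
          omega
        have hmon : monomial m (coeff m G) = X (j, i) * monomial m' (coeff m G) := by
          rw [X, monomial_mul, one_mul, ← hmm]
        obtain ⟨q, hq⟩ := ih (Dd i j (monomial m' (coeff m G)))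
          (Dd_hom i j (isHomogeneous_monomial _ hd'))
        have hne' : a i - a j ≠ 0 := sub_ne_zero.2 fun e => hne (ha e).symm
        refine ⟨(a i - a j)⁻¹ • q, fun E hE => ?_⟩
        rw [hmon, map_smul, map_smul, ← hq E hE, ← hE i j (Ne.symm hne), smul_eq_mul,
          inv_mul_cancel_left₀ hne']
  rw [← sum_homogeneousComponent G]
  exact hsum _ _ fun n _ => key n _ (homogeneousComponent_isHomogeneous n G)

lemma fam_unique {E E' : (Fin N → ℂ) → Poly N →ₗ[ℂ] ℂ}
    (h1 : ∀ a, Function.Injective a → SD a (E a)) (h2 : ∀ a, Function.Injective a → SD a (E' a))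
    (h3 : Ev E) (h4 : Ev E') (h5 : ∀ a, Function.Injective a → E a 1 = E' a 1)
    (a : Fin N → ℂ) (ha : Function.Injective a) (G : Poly N) : E a G = E' a G := by
  have key : ∀ q : MvPolynomial (Fin N) ℂ, ∀ a, Function.Injective a →
      E a (dE N q) = E' a (dE N q) := by
    intro q
    induction q using MvPolynomial.induction_on with
    | C c =>
      intro a ha
      have : dE N (C c) = c • 1 := by rw [dE, rename_C, smul_eq_C_mul, mul_one]
      rw [this, map_smul, map_smul, h5 a ha]
    | add p q hp hq => intro a ha; rw [map_add, map_add, map_add, hp a ha, hq a ha]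
    | mul_X q l hq =>
      intro a ha
      rw [map_mul, dE_X, mul_comm]
      have e1 := h3 a ha l (dE N q)
      have e2 := h4 a ha l (dE N q)
      have e3 : (fun x => E (Function.update a l x) (dE N q)) =ᶠ[𝓝 (a l)]
          fun x => E' (Function.update a l x) (dE N q) := by
        filter_upwards [update_inj_ev ha l] with x hx
        exact hq _ hx
      have := e1.unique (e2.congr_of_eventuallyEq e3)
      exact neg_injective this
  obtain ⟨q, hq⟩ := NF ha G
  rw [hq _ (h1 a ha), hq _ (h2 a ha), key q a ha]

/-- Vandermonde -/
def Vd (a : Fin N → ℂ) : ℂ := ∏ p : PP N, (a p.1.2 - a p.1.1)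

lemma Vd_ne {a : Fin N → ℂ} (ha : Function.Injective a) : Vd a ≠ 0 :=
  Finset.prod_ne_zero_iff.2 fun p _ => sub_ne_zero.2 fun e => p.2.ne (ha e).symm

lemma Vd_deriv {a : Fin N → ℂ} (ha : Function.Injective a) (l : Fin N) :
    HasDerivAt (fun x => Vd (Function.update a l x)) (vdl a l * Vd a) (a l) := by
  have := HasDerivAt.fun_finsetProd (u := Finset.univ) (x := a l)
    (f := fun (p : PP N) x => Function.update a l x p.1.2 - Function.update a l x p.1.1)
    (fun p _ => (hd_update a l p.1.2).sub (hd_update a l p.1.1))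
  refine HasDerivAt.congr_deriv this ?_
  symm
  rw [vdl, Finset.sum_mul]
  refine Finset.sum_congr rfl fun p _ => ?_
  simp only [Function.update_eq_self, smul_eq_mul]
  rw [Vd, ← Finset.prod_erase_mul _ _ (Finset.mem_univ p)]
  have hne : a p.1.2 - a p.1.1 ≠ 0 := sub_ne_zero.2 fun e => p.2.ne (ha e).symm
  field_simp

noncomputable def rho (b a : Fin N → ℂ) : Poly N →ₗ[ℂ] ℂ :=
  (Complex.exp (-∑ i, a i * b i) * (Vd a)⁻¹) • (wickL ∘ₗ (evM (Ym a b)).toLinearMap)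

lemma rho_apply (b a : Fin N → ℂ) (G : Poly N) : rho b a G =
    Complex.exp (-∑ i, a i * b i) * (Vd a)⁻¹ * wickL (evM (Ym a b) G) := rfl

lemma rho_SD (b : Fin N → ℂ) {a : Fin N → ℂ} (ha : Function.Injective a) : SD a (rho b a) := by
  intro i j _ G
  rw [rho_apply, rho_apply, sd_wick ha]; ring

lemma exp_deriv (a b : Fin N → ℂ) (l : Fin N) :
    HasDerivAt (fun x => Complex.exp (-∑ i, Function.update a l x i * b i))
      (-b l * Complex.exp (-∑ i, a i * b i)) (a l) := by
  have h1 : HasDerivAt (fun x => -∑ i, Function.update a l x i * b i) (-b l) (a l) := by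
    have := (HasDerivAt.fun_sum (u := Finset.univ) (x := a l)
      (fun i _ => (hd_update a l i).mul_const (b i))).neg
    refine HasDerivAt.congr_deriv this ?_
    simp
  have := h1.cexp
  simp only [Function.update_eq_self] at this
  refine HasDerivAt.congr_deriv this ?_
  ring

lemma rho_Ev (b : Fin N → ℂ) : Ev (rho b) := by
  intro a ha l G
  have h1 := exp_deriv a b l
  have h2 := (Vd_deriv ha l).inv (by simpa using Vd_ne ha)
  have h3 := ev_wick ha b l G
  have := (h1.mul h2).mul h3
  refine HasDerivAt.congr_deriv this ?_
  rw [rho_apply]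
  simp only [Pi.mul_apply, Pi.inv_apply, Function.update_eq_self]
  have := Vd_ne ha
  field_simp
  ring

lemma rho_one (b a : Fin N → ℂ) : rho b a 1 =
    Complex.exp (-∑ i, a i * b i) * (Vd a)⁻¹ * (Real.pi : ℂ) ^ Fintype.card (PP N) := by
  rw [rho_apply, map_one, wickL_one]

lemma evM_charpoly {R : Type*} [CommRing R] [Algebra ℂ R] (M : Matrix (Fin N) (Fin N) R) (k : ℕ) :
    evM M ((Matrix.charpoly.univ ℂ (Fin N)).coeff k) = M.charpoly.coeff k := by
  have := Matrix.charpoly.univ_coeff_eval₂Hom (Fin N) (algebraMap ℂ R)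
    (fun pq : Fin N × Fin N => M pq.1 pq.2) k
  exact this

lemma charpoly_Y (a b : Fin N → ℂ) :
    (Ym a b).charpoly = (∏ j, (Polynomial.X - Polynomial.C (b j))).map (C : ℂ →+* RR N) := by
  have h0 : (Ym a b).charpoly = (Y0 b).charpoly := by
    let u : (Matrix (Fin N) (Fin N) (RR N))ˣ :=
      ⟨Sm a (Tm N), (Sm a (Tm N))⁻¹, Sm_mul_inv a Tm_su, Sm_inv_mul a Tm_su⟩
    exact Matrix.charpoly_units_conj' u (Y0 b)
  rw [h0, ← Matrix.charpoly_transpose, Matrix.charpoly_of_isUpperTriangular _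
    (fun i j h => Y0_ut b i j h), Polynomial.map_prod]
  refine Finset.prod_congr rfl fun i _ => ?_
  simp [Y0, Am, Ts]

lemma wickL_C (c : ℂ) : wickL (C c : RR N) = c * wickL (1 : RR N) := by
  have : (C c : RR N) = c • 1 := by rw [smul_eq_C_mul, mul_one]
  rw [this, map_smul, smul_eq_mul]

lemma rho_charpoly (b a : Fin N → ℂ) (k : ℕ) :
    rho b a ((Matrix.charpoly.univ ℂ (Fin N)).coeff k) =
      (∏ j, (Polynomial.X - Polynomial.C (b j))).coeff k * rho b a 1 := by
  rw [rho_apply, rho_apply, evM_charpoly, charpoly_Y, Polynomial.coeff_map, map_one, wickL_C]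
  ring

end Abs
end EPF

namespace EPF
section Uni
set_option linter.unusedSectionVars false
set_option linter.unusedSimpArgs false
open MvPolynomial Topology
variable {N : ℕ}

instance compU : CompactSpace (Matrix.unitaryGroup (Fin N) ℂ) := by
  refine isCompact_iff_compactSpace (s := (unitaryGroup (Fin N) ℂ : Set (Matrix (Fin N) (Fin N) ℂ))).1 ?_
  have hK : IsCompact (Set.pi Set.univ fun _ : Fin N => Set.pi Set.univ fun _ : Fin N =>
      Metric.closedBall (0 : ℂ) 1) :=
    isCompact_univ_pi fun _ => isCompact_univ_pi fun _ => isCompact_closedBall _ _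
  refine hK.of_isClosed_subset (isClosed_unitary (R := Matrix (Fin N) (Fin N) ℂ)) ?_
  intro U hU i _ j _
  simpa using entry_norm_bound_of_unitary hU i j

variable [MeasurableSpace (Matrix.unitaryGroup (Fin N) ℂ)]
    [BorelSpace (Matrix.unitaryGroup (Fin N) ℂ)]
    (μ : Measure (Matrix.unitaryGroup (Fin N) ℂ)) [IsProbabilityMeasure μ]

lemma intU {f : Matrix.unitaryGroup (Fin N) ℂ → ℂ} (hf : Continuous f) : Integrable f μ := by
  rw [← integrableOn_univ]
  exact hf.continuousOn.integrableOn_compact isCompact_univ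

lemma deriv_int {𝕜 : Type*} [RCLike 𝕜] [NormedSpace 𝕜 ℂ]
    {f f' : 𝕜 → Matrix.unitaryGroup (Fin N) ℂ → ℂ}
    (hf : ∀ x, Continuous (f x)) (hf' : Continuous (Function.uncurry f'))
    (h : ∀ x u, HasDerivAt (fun y => f y u) (f' x u) x) (x0 : 𝕜) :
    HasDerivAt (fun x => ∫ u, f x u ∂μ) (∫ u, f' x0 u ∂μ) x0 := by
  have hc : IsCompact (Metric.closedBall x0 1 ×ˢ
      (Set.univ : Set (Matrix.unitaryGroup (Fin N) ℂ))) :=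
    (isCompact_closedBall x0 1).prod isCompact_univ
  obtain ⟨B, hB⟩ := hc.exists_bound_of_continuousOn hf'.continuousOn
  refine (hasDerivAt_integral_of_dominated_loc_of_deriv_le (bound := fun _ => B)
    (Metric.closedBall_mem_nhds x0 one_pos)
    (Filter.Eventually.of_forall fun x => (intU μ (hf x)).aestronglyMeasurable)
    (intU μ (hf x0))
    (intU μ (hf'.comp (Continuous.prodMk_right x0))).aestronglyMeasurable
    (Filter.Eventually.of_forall fun u x hx => hB (x, u) ⟨hx, trivial⟩)
    (integrable_const _)
    (Filter.Eventually.of_forall fun u x _ => h x u)).2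

/-- the conjugate `U B U*` -/
noncomputable def WU (b : Fin N → ℂ) (U : Matrix.unitaryGroup (Fin N) ℂ) :
    Matrix (Fin N) (Fin N) ℂ := U.1 * Matrix.diagonal b * star U.1

lemma WU_cont (b : Fin N → ℂ) : Continuous (WU b) := by
  unfold WU
  fun_prop

lemma evM_cont (G : Poly N) : Continuous fun M : Matrix (Fin N) (Fin N) ℂ => evM M G := by
  induction G using MvPolynomial.induction_on with
  | C c => simpa [evM] using continuous_const
  | add p q hp hq => simp only [map_add]; exact hp.add hq
  | mul_X p i hp =>
    simp only [map_mul]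
    refine hp.mul ?_
    obtain ⟨i, j⟩ := i
    simp only [evM_X]
    exact continuous_apply_apply i j

/-- weight -/
noncomputable def wt (a : Fin N → ℂ) (M : Matrix (Fin N) (Fin N) ℂ) : ℂ :=
  Complex.exp (-∑ i, a i * M i i)

lemma wt_cont (a : Fin N → ℂ) : Continuous (wt a) := by
  unfold wt; fun_prop

lemma integrand_cont (a b : Fin N → ℂ) (G : Poly N) :
    Continuous fun U => evM (WU b U) G * wt a (WU b U) :=
  ((evM_cont G).comp (WU_cont b)).mul ((wt_cont a).comp (WU_cont b))

noncomputable def lam (b a : Fin N → ℂ) : Poly N →ₗ[ℂ] ℂ where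
  toFun G := ∫ U, evM (WU b U) G * wt a (WU b U) ∂μ
  map_add' G H := by
    rw [← integral_add (intU μ (integrand_cont a b G)) (intU μ (integrand_cont a b H))]
    simp only [map_add, add_mul]
  map_smul' c G := by
    simp only [map_smul, smul_eq_mul, mul_assoc, RingHom.id_apply]
    rw [integral_const_mul]

lemma lam_apply (b a : Fin N → ℂ) (G : Poly N) :
    lam μ b a G = ∫ U, evM (WU b U) G * wt a (WU b U) ∂μ := rfl

lemma lam_Ev' (b a : Fin N → ℂ) (l : Fin N) (G : Poly N) :
    HasDerivAt (fun x => lam μ b (Function.update a l x) G) (-lam μ b a (X (l, l) * G)) (a l) := by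
  simp only [lam_apply]
  have hs : ∀ (x : ℂ) (M : Matrix (Fin N) (Fin N) ℂ), wt (Function.update a l x) M =
      Complex.exp (-x * M l l) * wt (Function.update a l 0) M := by
    intro x M
    rw [wt, wt, ← Complex.exp_add]
    congr 1
    rw [← Finset.add_sum_erase _ _ (Finset.mem_univ l),
      ← Finset.add_sum_erase Finset.univ (fun i => Function.update a l 0 i * M i i)
        (Finset.mem_univ l)]
    simp only [Function.update_self]
    have : ∀ y, ∑ i ∈ Finset.univ.erase l, Function.update a l y i * M i i =
        ∑ i ∈ Finset.univ.erase l, a i * M i i := fun y =>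
      Finset.sum_congr rfl fun i hi => by
        rw [Function.update_of_ne (Finset.ne_of_mem_erase hi)]
    rw [this, this]; ring
  have := deriv_int (𝕜 := ℂ) μ
    (f := fun x U => evM (WU b U) G * wt (Function.update a l x) (WU b U))
    (f' := fun x U => -(evM (WU b U) (X (l, l) * G) * wt (Function.update a l x) (WU b U)))
    (fun x => integrand_cont _ b G) ?_ ?_ (a l)
  · refine this.congr_deriv ?_
    rw [← integral_neg]
    simp only [Function.update_eq_self]
  · have h1 : Continuous fun p : ℂ × Matrix.unitaryGroup (Fin N) ℂ => evM (WU b p.2) (X (l, l) * G) :=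
      ((evM_cont _).comp (WU_cont b)).comp continuous_snd
    have h2 : Continuous fun p : ℂ × Matrix.unitaryGroup (Fin N) ℂ =>
        wt (Function.update a l p.1) (WU b p.2) := by
      unfold wt
      have := (WU_cont b).comp (continuous_snd (X := ℂ))
      have h3 : ∀ i, Continuous fun p : ℂ × Matrix.unitaryGroup (Fin N) ℂ => WU b p.2 i i :=
        fun i => (continuous_apply_apply i i).comp this
      have h4 : ∀ i, Continuous fun p : ℂ × Matrix.unitaryGroup (Fin N) ℂ =>
          Function.update a l p.1 i := fun i =>
        (continuous_apply i).comp ((continuous_const (y := a)).update l continuous_fst)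
      exact Complex.continuous_exp.comp
        (continuous_finsetSum _ fun i _ => (h4 i).mul (h3 i)).neg
    exact (h1.mul h2).neg
  · intro x U
    have e : (fun y => evM (WU b U) G * wt (Function.update a l y) (WU b U)) = fun y =>
        evM (WU b U) G * (Complex.exp (-y * WU b U l l) * wt (Function.update a l 0) (WU b U)) :=
      funext fun y => by rw [hs]
    rw [e, hs x]
    have h1 : HasDerivAt (fun y : ℂ => -y * WU b U l l) (-1 * WU b U l l) x :=
      ((hasDerivAt_id x).neg).mul_const _
    have h2 := (h1.cexp.mul_const (wt (Function.update a l 0) (WU b U))).const_mul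
      (evM (WU b U) G)
    refine h2.congr_deriv ?_
    rw [map_mul, evM_X]; ring

lemma lam_Ev (b : Fin N → ℂ) : Ev (lam μ b) := fun a _ l G => lam_Ev' μ b a l G

end Uni
end EPF

namespace EPF
section Uni
set_option linter.unusedSectionVars false
set_option linter.unusedSimpArgs false
open MvPolynomial Topology
variable {N : ℕ}

def MD (M : ℝ → Matrix (Fin N) (Fin N) ℂ) (M' : Matrix (Fin N) (Fin N) ℂ) (t : ℝ) : Prop :=
  ∀ p q, HasDerivAt (fun s => M s p q) (M' p q) t

lemma MD.mul {M P : ℝ → Matrix (Fin N) (Fin N) ℂ} {M' P' : Matrix (Fin N) (Fin N) ℂ} {t : ℝ}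
    (h1 : MD M M' t) (h2 : MD P P' t) :
    MD (fun s => M s * P s) (M' * P t + M t * P') t := by
  intro p q
  simp only [Matrix.mul_apply, Matrix.add_apply, ← Finset.sum_add_distrib]
  exact HasDerivAt.fun_sum fun k _ => (h1 p k).mul (h2 k q)

lemma MD.const (M : Matrix (Fin N) (Fin N) ℂ) (t : ℝ) : MD (fun _ => M) 0 t :=
  fun _ _ => hasDerivAt_const _ _

lemma MD.star {M : ℝ → Matrix (Fin N) (Fin N) ℂ} {M' : Matrix (Fin N) (Fin N) ℂ} {t : ℝ}
    (h1 : MD M M' t) : MD (fun s => star (M s)) (star M') t := by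
  intro p q
  exact (h1 q p).star

lemma evM_deriv {W : ℝ → Matrix (Fin N) (Fin N) ℂ} {t : ℝ}
    (D : Derivation ℂ (Poly N) (Poly N))
    (h : ∀ p q, HasDerivAt (fun s => W s p q) (evM (W t) (D (X (p, q)))) t) (G : Poly N) :
    HasDerivAt (fun s => evM (W s) G) (evM (W t) (D G)) t := by
  induction G using MvPolynomial.induction_on with
  | C c =>
    rw [← algebraMap_eq, Derivation.map_algebraMap, map_zero]
    simp only [AlgHom.commutes]
    exact hasDerivAt_const _ _
  | add p q hp hq => 
    simp only [map_add]; exact hp.add hq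
  | mul_X p i hp =>
    obtain ⟨i, j⟩ := i
    have h2 := h i j
    have e : (fun s => evM (W s) (p * X (i, j))) = fun s => evM (W s) p * W s i j := by
      funext s; rw [map_mul, evM_X]
    rw [e]
    refine (hp.mul h2).congr_deriv ?_
    rw [Derivation.leibniz, smul_eq_mul, smul_eq_mul, map_add, map_mul, map_mul, evM_X]
    ring

/-- one-parameter rotation -/
noncomputable def Vt (K : Matrix (Fin N) (Fin N) ℂ) (t : ℝ) : Matrix (Fin N) (Fin N) ℂ :=
  1 + (Complex.sin t) • K + (1 - Complex.cos t) • (K * K)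

lemma Vt_star {K : Matrix (Fin N) (Fin N) ℂ} (hs : star K = -K) (t : ℝ) :
    star (Vt K t) = 1 - (Complex.sin t) • K + (1 - Complex.cos t) • (K * K) := by
  have e1 : star (Complex.sin t) = Complex.sin t := by
    rw [← Complex.ofReal_sin]; exact Complex.conj_ofReal _
  have e2 : star (Complex.cos t) = Complex.cos t := by
    rw [← Complex.ofReal_cos]; exact Complex.conj_ofReal _
  rw [Vt, star_add, star_add, star_smul, star_smul, star_mul, hs, star_sub, e1, e2]
  simp [sub_eq_add_neg]

lemma Vt_mem {K : Matrix (Fin N) (Fin N) ℂ} (hs : star K = -K) (h3 : K * K * K = -K) (t : ℝ) :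
    Vt K t ∈ Matrix.unitaryGroup (Fin N) ℂ := by
  rw [Matrix.mem_unitaryGroup_iff, Vt_star hs, Vt]
  have h4 : K * K * (K * K) = -(K * K) := by rw [← mul_assoc, h3, neg_mul]
  have h3' : K * (K * K) = -K := by rw [← mul_assoc, h3]
  simp only [mul_add, add_mul, mul_sub, sub_mul, smul_mul_assoc, mul_smul_comm, h4, h3, h3', mul_one, one_mul]
  have e := Complex.sin_sq_add_cos_sq (t : ℂ)
  match_scalars
  · ring
  · ring
  · linear_combination -e

lemma Vt_MD {K : Matrix (Fin N) (Fin N) ℂ} (h3 : K * K * K = -K) (t : ℝ) :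
    MD (Vt K) (K * Vt K t) t := by
  have e : K * Vt K t = (Complex.cos t) • K + (Complex.sin t) • (K * K) := by
    have h3' : K * (K * K) = -K := by rw [← mul_assoc, h3]
    rw [Vt, mul_add, mul_add, mul_smul_comm, mul_smul_comm, h3', mul_one]
    module
  rw [e]
  intro p q
  have h1 : HasDerivAt (fun s : ℝ => Complex.sin s) (Complex.cos t) t :=
    (Complex.hasDerivAt_sin t).comp_ofReal
  have h2 : HasDerivAt (fun s : ℝ => 1 - Complex.cos s) (Complex.sin t) t := by
    have := (Complex.hasDerivAt_cos (t : ℂ)).comp_ofReal.const_sub 1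
    exact this.congr_deriv (by ring)
  have := ((h1.mul_const (K p q)).const_add ((1 : Matrix (Fin N) (Fin N) ℂ) p q)).add (h2.mul_const ((K * K) p q))
  exact this

lemma Vt_cont (K : Matrix (Fin N) (Fin N) ℂ) : Continuous (Vt K) := by
  unfold Vt; fun_prop

variable [MeasurableSpace (Matrix.unitaryGroup (Fin N) ℂ)]
    [BorelSpace (Matrix.unitaryGroup (Fin N) ℂ)]
    (μ : Measure (Matrix.unitaryGroup (Fin N) ℂ)) [IsProbabilityMeasure μ] [μ.IsHaarMeasure]

lemma WU_mul (b : Fin N → ℂ) (V U : Matrix.unitaryGroup (Fin N) ℂ) :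
    WU b (V * U) = V.1 * WU b U * star V.1 := by
  simp only [WU, Submonoid.coe_mul, star_mul, mul_assoc]

lemma lam_K (b a : Fin N → ℂ) {K : Matrix (Fin N) (Fin N) ℂ} (hs : star K = -K)
    (h3 : K * K * K = -K) (D : Derivation ℂ (Poly N) (Poly N))
    (hD : ∀ (M : Matrix (Fin N) (Fin N) ℂ) p q, evM M (D (X (p, q))) = (K * M - M * K) p q)
    (G : Poly N) :
    lam μ b a (D G) = lam μ b a ((∑ i, a i • D (X (i, i))) * G) := by
  set V : ℝ → Matrix.unitaryGroup (Fin N) ℂ := fun t => ⟨Vt K t, Vt_mem hs h3 t⟩ with hV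
  have hVc : Continuous V := (Vt_cont K).subtype_mk _
  set Φ : Poly N := D G - (∑ i, a i • D (X (i, i))) * G with hΦ
  have hd : ∀ (t : ℝ) U, MD (fun s => WU b (V s * U))
      (K * WU b (V t * U) - WU b (V t * U) * K) t := by
    intro t U
    simp only [WU_mul]
    have h1 := Vt_MD h3 t
    have := (h1.mul (MD.const (WU b U) t)).mul h1.star
    have e : K * Vt K t * WU b U * star (Vt K t) + Vt K t * WU b U * star (K * Vt K t) =
       K * (Vt K t * WU b U * star (Vt K t)) - (Vt K t * WU b U * star (Vt K t)) * K := by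
      rw [star_mul, hs]
      simp only [mul_assoc, mul_neg, sub_eq_add_neg]
    simp only [mul_zero, add_zero] at this
    rw [e] at this
    exact this
  have main := deriv_int (𝕜 := ℝ) μ
    (f := fun t U => evM (WU b (V t * U)) G * wt a (WU b (V t * U)))
    (f' := fun t U => evM (WU b (V t * U)) Φ * wt a (WU b (V t * U)))
    (fun x => (integrand_cont a b G).comp (continuous_const.mul continuous_id)) ?_ ?_ 0
  · have c : (fun t : ℝ => ∫ U, evM (WU b (V t * U)) G * wt a (WU b (V t * U)) ∂μ) =
        fun _ => lam μ b a G := by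
      funext t
      exact integral_mul_left_eq_self (fun U => evM (WU b U) G * wt a (WU b U)) (V t)
    rw [c] at main
    have e0 := main.unique (hasDerivAt_const _ _)
    have V0 : V 0 = 1 := by
      apply Subtype.ext
      simp [hV, Vt]
    simp only [V0, one_mul] at e0
    rw [← lam_apply, hΦ, map_sub, sub_eq_zero] at e0
    exact e0
  · exact (integrand_cont a b Φ).comp ((hVc.comp continuous_fst).mul continuous_snd)
  · intro t U
    have h1 := evM_deriv D (W := fun s => WU b (V s * U)) (t := t)
      (fun p q => by rw [hD]; exact hd t U p q) G
    have h2 : HasDerivAt (fun s => wt a (WU b (V s * U)))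
        (wt a (WU b (V t * U)) * -∑ i, a i * evM (WU b (V t * U)) (D (X (i, i)))) t := by
      unfold wt
      refine HasDerivAt.cexp (f := fun s => -∑ i, a i * WU b (V s * U) i i) ?_
      refine HasDerivAt.neg (f := fun s => ∑ i, a i * WU b (V s * U) i i) ?_
      exact HasDerivAt.fun_sum fun i _ => HasDerivAt.const_mul _ (by rw [hD]; exact hd t U i i)
    refine (h1.mul h2).congr_deriv ?_
    rw [hΦ, map_sub, map_mul, map_sum]
    simp only [map_smul, smul_eq_mul]
    ring

lemma evM_Dd (M : Matrix (Fin N) (Fin N) ℂ) (i j p q : Fin N) :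
    evM M (Dd i j (X (p, q))) = (Matrix.single i j (1 : ℂ) * M - M * Matrix.single i j (1 : ℂ)) p q := by
  rw [Dd, mkDerivation_X]
  simp only [Matrix.sub_apply, Matrix.mul_apply, Matrix.single_apply, map_sub]
  congr 1
  · by_cases hp : p = i
    · subst hp; simp [evM_X]
    · simp [hp, Ne.symm hp]
  · by_cases hq : q = j
    · subst hq; simp [evM_X]
    · simp [hq, Ne.symm hq]

lemma Dd_tr (a : Fin N → ℂ) (i j : Fin N) :
    ∑ k, a k • Dd i j (X (k, k)) = (a i - a j) • (X (j, i) : Poly N) := by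
  simp only [Dd, mkDerivation_X, smul_sub, Finset.sum_sub_distrib, smul_ite, smul_zero,
    Finset.sum_ite_eq', Finset.mem_univ, if_true, sub_smul]

lemma lam_SD (b a : Fin N → ℂ) : SD a (lam μ b a) := by
  intro i j hij G
  have key : ∀ α : ℂ, α * star α = 1 →
      lam μ b a ((α • Dd i j - star α • Dd j i) G) =
      lam μ b a ((α • (a i - a j) • X (j, i) - star α • (a j - a i) • X (i, j)) * G) := by
    intro α hα
    have hα' : star α * α = 1 := by rw [mul_comm, hα]
    have := lam_K μ b a (K := α • Matrix.single i j 1 - star α • Matrix.single j i 1) ?_ ?_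
      (α • Dd i j - star α • Dd j i) ?_ G
    · rw [this]
      congr 2
      simp only [Derivation.sub_apply, Derivation.smul_apply, smul_sub, Finset.sum_sub_distrib]
      rw [← Dd_tr a i j, ← Dd_tr a j i, Finset.smul_sum, Finset.smul_sum]
      simp only [smul_comm α, smul_comm (star α)]
    · simp [star_sub, star_smul, Matrix.star_eq_conjTranspose]
    · simp only [sub_mul, mul_sub, smul_mul_assoc, mul_smul_comm, Matrix.single_mul_single_same,
        Matrix.single_mul_single_of_ne, hij, hij.symm, ne_eq, not_false_eq_true, smul_zero,
        mul_one, sub_zero, zero_sub, zero_mul, mul_zero, smul_neg, neg_mul, mul_neg, neg_zero]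
      simp only [smul_smul]
      have e1 : α * (star α * α) = α := by rw [hα', mul_one]
      have e2 : star α * (α * star α) = star α := by rw [hα, mul_one]
      rw [e1, e2]; abel
    · intro M p q
      simp only [Derivation.sub_apply, Derivation.smul_apply, map_sub, map_smul, evM_Dd]
      simp only [sub_mul, mul_sub, smul_mul_assoc, mul_smul_comm, Matrix.sub_apply, Matrix.smul_apply, smul_eq_mul]
      ring
  have k1 := key 1 (by simp)
  have k2 := key Complex.I (by simp)
  simp only [star_one, one_smul, Derivation.sub_apply, Derivation.smul_apply, sub_mul, smul_mul_assoc, map_sub, map_smul, smul_eq_mul, Complex.star_def, Complex.conj_I] at k1 k2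
  have hI := Complex.I_mul_I
  linear_combination (-1/2 : ℂ) * k1 + (Complex.I / 2) * k2 + (1 / 2 : ℂ) * ((a i - a j) *
    (lam μ b a (X (j, i) * G) - lam μ b a (X (i, j) * G)) - lam μ b a (Dd i j G) -
    lam μ b a (Dd j i G)) * hI

end Uni
end EPF

namespace EPF
section Jet
set_option linter.unusedSectionVars false
set_option linter.unusedSimpArgs false
open MvPolynomial Topology
variable {N : ℕ}

abbrev DP (N : ℕ) := MvPolynomial (Fin N) ℂ

def JetAt (J : (Fin N → ℂ) → DP N →ₗ[ℂ] ℂ) (a : Fin N → ℂ) : Prop :=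
  ∀ l r, HasDerivAt (fun x => J (Function.update a l x) r) (-J a (X l * r)) (a l)

noncomputable def mulOp (p : PP N) (a : Fin N → ℂ) : DP N →ₗ[ℂ] DP N :=
  (a p.1.2 - a p.1.1) • LinearMap.id - ((pderiv p.1.2).toLinearMap - (pderiv p.1.1).toLinearMap)

lemma mulOp_apply (p : PP N) (a : Fin N → ℂ) (r : DP N) :
    mulOp p a r = (a p.1.2 - a p.1.1) • r - (pderiv p.1.2 r - pderiv p.1.1 r) := rfl

noncomputable def opList : List (PP N) → (Fin N → ℂ) → DP N →ₗ[ℂ] DP N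
  | [], _ => LinearMap.id
  | p :: L, a => mulOp p a ∘ₗ opList L a

lemma JetAt.mulOp {J : (Fin N → ℂ) → DP N →ₗ[ℂ] ℂ} {a : Fin N → ℂ} (h : JetAt J a) (p : PP N) :
    JetAt (fun a => J a ∘ₗ mulOp p a) a := by
  intro l r
  obtain ⟨⟨i, j⟩, hp⟩ := p
  have e : (fun x => (J (Function.update a l x) ∘ₗ EPF.mulOp ⟨(i, j), hp⟩ (Function.update a l x)) r) =
      fun x => (Function.update a l x j - Function.update a l x i) * J (Function.update a l x) r -
        J (Function.update a l x) (pderiv j r - pderiv i r) := by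
    funext x
    rw [LinearMap.comp_apply, mulOp_apply, map_sub, map_smul, smul_eq_mul]
  beta_reduce
  rw [e]
  have h1 := (hd_update a l j).sub (hd_update a l i)
  have h2 := (h1.mul (h l r)).sub (h l (pderiv j r - pderiv i r))
  refine h2.congr_deriv ?_
  simp only [Function.update_eq_self, Pi.sub_apply]
  rw [LinearMap.comp_apply, mulOp_apply, map_sub, map_smul, smul_eq_mul]
  have e2 : pderiv j (X l * r) - pderiv i (X l * r) =
      ((if j = l then 1 else 0) - (if i = l then 1 else 0) : ℂ) • r
        + X l * (pderiv j r - pderiv i r) := by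
    rw [pderiv_mul, pderiv_mul, pderiv_X, pderiv_X, sub_smul]
    have : ∀ k, (Pi.single k (1 : DP N) : Fin N → DP N) l * r = (if k = l then (1 : ℂ) else 0) • r := by
      intro k
      by_cases hk : k = l
      · subst hk; simp
      · simp [hk, Pi.single_apply, Ne.symm hk]
    rw [← this, ← this]
    simp only [Pi.single_apply]
    ring
  simp only []
  rw [e2, map_add, map_smul, smul_eq_mul]
  ring

lemma JetAt.opList {J : (Fin N → ℂ) → DP N →ₗ[ℂ] ℂ} {a : Fin N → ℂ} (h : JetAt J a)
    (L : List (PP N)) : JetAt (fun a => J a ∘ₗ opList L a) a := by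
  induction L generalizing J with
  | nil => exact h
  | cons p L ih => exact ih (h.mulOp p)

lemma cont_opList {J : (Fin N → ℂ) → DP N →ₗ[ℂ] ℂ} (h : ∀ r, Continuous fun a => J a r)
    (L : List (PP N)) (r : DP N) : Continuous fun a => J a (opList L a r) := by
  induction L generalizing J with
  | nil => exact h r
  | cons p L ih =>
    refine ih (J := fun a => J a ∘ₗ EPF.mulOp p a) fun r => ?_
    have e : (fun a => (J a ∘ₗ EPF.mulOp p a) r) = fun a => (a p.1.2 - a p.1.1) * J a r -
        J a (pderiv p.1.2 r - pderiv p.1.1 r) := by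
      funext x
      rw [LinearMap.comp_apply, mulOp_apply, map_sub, map_smul, smul_eq_mul]
    rw [e]
    have h1 := h r
    have h2 := h (pderiv p.1.2 r - pderiv p.1.1 r)
    fun_prop

lemma opList_one (L : List (PP N)) (a : Fin N → ℂ) :
    opList L a 1 = (L.map fun p => a p.1.2 - a p.1.1).prod • (1 : DP N) := by
  induction L with
  | nil => simp [opList]
  | cons p L ih =>
    rw [opList, LinearMap.comp_apply, ih, map_smul, mulOp_apply, ← C_1, pderiv_C, pderiv_C]
    simp only [sub_zero, List.map_cons, List.prod_cons, smul_smul]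
    rw [mul_comm]

lemma mulOp_surj (p : PP N) {a : Fin N → ℂ} (ha : Function.Injective a) :
    Function.Surjective (mulOp p a) := by
  have hc : a p.1.2 - a p.1.1 ≠ 0 := sub_ne_zero.2 fun e => p.2.ne (ha e).symm
  have key : ∀ n : ℕ, ∀ r : DP N, r.IsHomogeneous n → r ∈ LinearMap.range (mulOp p a) := by
    intro n
    induction n with
    | zero =>
      intro r hr
      rw [← totalDegree_zero_iff_isHomogeneous, totalDegree_eq_zero_iff_eq_C] at hr
      refine ⟨(a p.1.2 - a p.1.1)⁻¹ • r, ?_⟩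
      rw [map_smul, mulOp_apply, hr, pderiv_C, pderiv_C, sub_zero, sub_zero, smul_smul,
        inv_mul_cancel₀ hc, one_smul]
    | succ n ih =>
      intro r hr
      obtain ⟨s, hs⟩ := ih (pderiv p.1.2 r - pderiv p.1.1 r)
        ((hr.pderiv (i := p.1.2)).sub (hr.pderiv (i := p.1.1)))
      refine ⟨(a p.1.2 - a p.1.1)⁻¹ • (r + s), ?_⟩
      rw [map_smul, map_add, hs, mulOp_apply, sub_add_cancel, smul_smul,
        inv_mul_cancel₀ hc, one_smul]
  intro r
  rw [← LinearMap.mem_range, ← sum_homogeneousComponent r]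
  exact Submodule.sum_mem _ fun n _ => key n _ (homogeneousComponent_isHomogeneous n r)

lemma opList_surj (L : List (PP N)) {a : Fin N → ℂ} (ha : Function.Injective a) :
    Function.Surjective (opList L a) := by
  induction L with
  | nil => exact Function.surjective_id
  | cons p L ih => exact (mulOp_surj p ha).comp ih

/-- the full product operator -/
noncomputable def Mop (a : Fin N → ℂ) : DP N →ₗ[ℂ] DP N := opList Finset.univ.toList a

lemma Mop_one (a : Fin N → ℂ) : Mop a 1 = Vd a • (1 : DP N) := by
  rw [Mop, opList_one, Finset.prod_map_toList, Vd]

lemma Mop_surj {a : Fin N → ℂ} (ha : Function.Injective a) : Function.Surjective (Mop a) :=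
  opList_surj _ ha

lemma jet_unique {J J' : (Fin N → ℂ) → DP N →ₗ[ℂ] ℂ}
    (h1 : ∀ a, Function.Injective a → JetAt J a) (h2 : ∀ a, Function.Injective a → JetAt J' a)
    (h : ∀ a, Function.Injective a → J a 1 = J' a 1) (r : DP N) :
    ∀ a, Function.Injective a → J a r = J' a r := by
  induction r using MvPolynomial.induction_on with
  | C c =>
    intro a ha
    have : (C c : DP N) = c • 1 := by rw [smul_eq_C_mul, mul_one]
    rw [this, map_smul, map_smul, h a ha]
  | add p q hp hq => intro a ha; rw [map_add, map_add, hp a ha, hq a ha]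
  | mul_X q l hq =>
    intro a ha
    rw [mul_comm]
    have e3 : (fun x => J (Function.update a l x) q) =ᶠ[𝓝 (a l)]
        fun x => J' (Function.update a l x) q := by
      filter_upwards [update_inj_ev ha l] with x hx
      exact hq _ hx
    exact neg_injective ((h1 a ha l q).unique ((h2 a ha l q).congr_of_eventuallyEq e3))

lemma Ev.jet {E : (Fin N → ℂ) → Poly N →ₗ[ℂ] ℂ} (h : Ev E) (a : Fin N → ℂ)
    (ha : Function.Injective a) : JetAt (fun a => E a ∘ₗ (dE N).toLinearMap) a := by
  intro l r
  have := h a ha l (dE N r)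
  refine this.congr_deriv ?_
  rw [LinearMap.comp_apply, AlgHom.toLinearMap_apply, map_mul (dE N), dE_X]

lemma rho_Mop (b : Fin N → ℂ) {a : Fin N → ℂ} (ha : Function.Injective a) (r : DP N) :
    rho b a (dE N (Mop a r)) = Complex.exp (-∑ i, a i * b i) *
      (Real.pi : ℂ) ^ Fintype.card (PP N) * eval b r := by
  refine jet_unique (J := fun a => (rho b a ∘ₗ (dE N).toLinearMap) ∘ₗ Mop a)
    (J' := fun a => (Complex.exp (-∑ i, a i * b i) * (Real.pi : ℂ) ^ Fintype.card (PP N)) •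
      (aeval b).toLinearMap)
    (fun a ha => ((rho_Ev b).jet a ha).opList _) ?_ ?_ r a ha
  · intro a ha l r
    have := ((exp_deriv a b l).mul_const ((Real.pi : ℂ) ^ Fintype.card (PP N))).mul_const (eval b r)
    refine this.congr_deriv ?_
    simp only [LinearMap.smul_apply, AlgHom.toLinearMap_apply, map_mul, aeval_X, smul_eq_mul, coe_aeval_eq_eval, RingHom.coe_coe]
    simp only [aeval_eq_eval, RingHom.coe_coe]
    ring
  · intro a ha
    simp only [LinearMap.comp_apply, AlgHom.toLinearMap_apply, Mop_one, map_smul, map_one, rho_one, LinearMap.smul_apply, smul_eq_mul]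
    have := Vd_ne ha
    field_simp

end Jet
end EPF

namespace EPF
section Psis
set_option linter.unusedSectionVars false
set_option linter.unusedSimpArgs false
open MvPolynomial Topology
variable {N : ℕ}

lemma ext_inj {f g : (Fin N → ℂ) → ℂ} (hf : Continuous f) (hg : Continuous g)
    (h : ∀ a, Function.Injective a → f a = g a) (a : Fin N → ℂ) : f a = g a := by
  set c : ℂ → Fin N → ℂ := fun t i => a i + t * (i : ℕ) with hc
  have hcc : Continuous c := by fun_prop
  set S : Set ℂ := Set.range fun p : Fin N × Fin N => (a p.1 - a p.2) / ((p.2 : ℕ) - (p.1 : ℕ) : ℂ)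
  have hS : S.Finite := Set.finite_range _
  have hd : Dense Sᶜ := hS.countable.dense_compl ℂ
  have := Continuous.ext_on hd (hf.comp hcc) (hg.comp hcc) (fun t ht => h _ ?_)
  · have h0 := congrFun this 0
    simpa [hc] using h0
  · intro i j hij
    by_contra hne
    apply ht
    refine ⟨(i, j), ?_⟩
    have h1 : ((j : ℕ) - (i : ℕ) : ℂ) ≠ 0 := by
      rw [sub_ne_zero]; intro e; exact hne (Fin.ext (by exact_mod_cast e.symm))
    simp only [hc] at hij
    field_simp
    linear_combination hij

/-- coefficients of the characteristic polynomial of `B` -/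
noncomputable def cb (b : Fin N → ℂ) (k : ℕ) : ℂ :=
  (∏ j, (Polynomial.X - Polynomial.C (b j))).coeff k

noncomputable def epsP (N : ℕ) : Polynomial (DP N) :=
  ∏ j, (Polynomial.X - Polynomial.C (X j))

lemma eval_eps (b : Fin N → ℂ) (k : ℕ) : eval b ((epsP N).coeff k) = cb b k := by
  rw [← Polynomial.coeff_map, epsP, Polynomial.map_prod, cb]
  simp

variable [MeasurableSpace (Matrix.unitaryGroup (Fin N) ℂ)]
    [BorelSpace (Matrix.unitaryGroup (Fin N) ℂ)]
    (μ : Measure (Matrix.unitaryGroup (Fin N) ℂ)) [IsProbabilityMeasure μ] [μ.IsHaarMeasure]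

lemma lam_cont (b : Fin N → ℂ) (G : Poly N) : Continuous fun a => lam μ b a G := by
  simp only [lam_apply]
  have := continuous_parametric_integral_of_continuous (μ := μ) (X := Fin N → ℂ)
    (f := fun a U => evM (WU b U) G * wt a (WU b U)) ?_ (isCompact_univ)
  · simpa using this
  · have h1 : Continuous fun p : (Fin N → ℂ) × Matrix.unitaryGroup (Fin N) ℂ => evM (WU b p.2) G :=
      ((evM_cont _).comp (WU_cont b)).comp continuous_snd
    have h2 : Continuous fun p : (Fin N → ℂ) × Matrix.unitaryGroup (Fin N) ℂ =>
        wt p.1 (WU b p.2) := by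
      unfold wt
      have := (WU_cont b).comp (continuous_snd (X := Fin N → ℂ))
      have h3 : ∀ i, Continuous fun p : (Fin N → ℂ) × Matrix.unitaryGroup (Fin N) ℂ => WU b p.2 i i :=
        fun i => (continuous_apply_apply i i).comp this
      fun_prop
    exact h1.mul h2

noncomputable def Psi (b a : Fin N → ℂ) : DP N →ₗ[ℂ] ℂ :=
  (lam μ b a ∘ₗ (dE N).toLinearMap) ∘ₗ Mop a

lemma Psi_apply (b a : Fin N → ℂ) (r : DP N) : Psi μ b a r = lam μ b a (dE N (Mop a r)) := rfl

lemma Psi_jet (b a : Fin N → ℂ) : JetAt (Psi μ b) a := by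
  have : JetAt (fun a => lam μ b a ∘ₗ (dE N).toLinearMap) a := by
    intro l r
    refine (lam_Ev' μ b a l (dE N r)).congr_deriv ?_
    rw [LinearMap.comp_apply, AlgHom.toLinearMap_apply, map_mul (dE N), dE_X]
  exact this.opList _

lemma Psi_cont (b : Fin N → ℂ) (r : DP N) : Continuous fun a => Psi μ b a r :=
  cont_opList (J := fun a => lam μ b a ∘ₗ (dE N).toLinearMap)
    (fun r => lam_cont μ b (dE N r)) Finset.univ.toList r

lemma Psi_one (b a : Fin N → ℂ) : Psi μ b a 1 = Vd a * lam μ b a 1 := by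
  rw [Psi_apply, Mop_one, map_smul, map_smul, map_one, smul_eq_mul]

lemma WU_charpoly (b : Fin N → ℂ) (U : Matrix.unitaryGroup (Fin N) ℂ) :
    (WU b U).charpoly = ∏ j, (Polynomial.X - Polynomial.C (b j)) := by
  have h1 := Matrix.mem_unitaryGroup_iff.1 U.2
  have h2 := Matrix.mem_unitaryGroup_iff'.1 U.2
  let u : (Matrix (Fin N) (Fin N) ℂ)ˣ := ⟨U.1, star U.1, h1, h2⟩
  rw [show WU b U = (u : Matrix (Fin N) (Fin N) ℂ) * Matrix.diagonal b *
    ((u⁻¹ : (Matrix (Fin N) (Fin N) ℂ)ˣ) : Matrix (Fin N) (Fin N) ℂ) from rfl,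
    Matrix.coe_units_inv, Matrix.charpoly_units_conj, Matrix.charpoly_diagonal]

lemma lam_charpoly (b a : Fin N → ℂ) (k : ℕ) :
    lam μ b a ((Matrix.charpoly.univ ℂ (Fin N)).coeff k) = cb b k * lam μ b a 1 := by
  rw [lam_apply, lam_apply, ← integral_const_mul]
  simp only [evM_charpoly, WU_charpoly, map_one, one_mul]
  rfl

lemma Psi_eps_one (b a : Fin N → ℂ) (k : ℕ) :
    Psi μ b a ((epsP N).coeff k) = cb b k * Psi μ b a 1 := by
  refine ext_inj (f := fun a => Psi μ b a ((epsP N).coeff k))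
    (g := fun a => cb b k * Psi μ b a 1) (Psi_cont μ b _) ((Psi_cont μ b _).const_mul _) ?_ a
  intro a ha
  obtain ⟨q, hq⟩ := NF ha ((Matrix.charpoly.univ ℂ (Fin N)).coeff k)
  obtain ⟨r0, hr0⟩ := Mop_surj ha q
  have hV := Vd_ne ha
  have e0 : Vd a • r0 = (epsP N).coeff k := by
    refine MvPolynomial.funext fun b' => ?_
    have h1 := rho_charpoly b' a k
    rw [hq _ (rho_SD b' ha), ← hr0, rho_Mop b' ha, rho_one] at h1
    rw [eval_eps, smul_eval, cb]
    have hpi : (Real.pi : ℂ) ≠ 0 := by exact_mod_cast Real.pi_ne_zero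
    have he := Complex.exp_ne_zero (-∑ i, a i * b' i)
    have hp : (Real.pi : ℂ) ^ Fintype.card (PP N) ≠ 0 := pow_ne_zero _ hpi
    field_simp at h1
    linear_combination h1
  have h2 := lam_charpoly μ b a k
  rw [hq _ (lam_SD μ b a), ← hr0, ← Psi_apply] at h2
  rw [← e0, map_smul, h2, Psi_one, smul_eq_mul]
  ring

lemma Psi_eps (b : Fin N → ℂ) (k : ℕ) (r : DP N) : ∀ a,
    Psi μ b a ((epsP N).coeff k * r) = cb b k * Psi μ b a r := by
  induction r using MvPolynomial.induction_on with
  | C c =>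
    intro a
    have : (C c : DP N) = c • 1 := by rw [smul_eq_C_mul, mul_one]
    rw [this, mul_smul_comm, map_smul, map_smul, mul_one, Psi_eps_one, smul_eq_mul, smul_eq_mul]
    ring
  | add p q hp hq => intro a; rw [mul_add, map_add, map_add, hp a, hq a]; ring
  | mul_X q l hq =>
    intro a
    have h1 := Psi_jet μ b a l ((epsP N).coeff k * q)
    have h2 := (Psi_jet μ b a l q).const_mul (cb b k)
    simp only [hq] at h1
    have := h1.unique h2
    rw [mul_left_comm] at this
    rw [mul_comm q]
    linear_combination -this

lemma Psi_kill (b a : Fin N → ℂ) (i : Fin N) (r : DP N) :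
    Psi μ b a ((∏ j, (X i - C (b j))) * r) = 0 := by
  have hdeg : ∀ {R : Type} [CommRing R] [Nontrivial R] (c : Fin N → R),
      (∏ j, (Polynomial.X - Polynomial.C (c j))).natDegree = N := by
    intro R _ _ c
    rw [Polynomial.natDegree_finsetProd_X_sub_C_eq_card]; simp
  have e1 : (∏ j, (X i - C (b j)) : DP N) = ∑ k ∈ Finset.range (N + 1), C (cb b k) * X i ^ k := by
    have : (∏ j, (X i - C (b j)) : DP N) =
        Polynomial.aeval (X i : DP N) (∏ j, (Polynomial.X - Polynomial.C (b j))) := by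
      rw [map_prod]; simp [algebraMap_eq]
    rw [this, Polynomial.aeval_eq_sum_range, hdeg]
    refine Finset.sum_congr rfl fun k _ => ?_
    rw [smul_eq_C_mul]; rfl
  have e2 : (0 : DP N) = ∑ k ∈ Finset.range (N + 1), (epsP N).coeff k * X i ^ k := by
    have : (epsP N).eval (X i) = 0 := by
      rw [epsP, Polynomial.eval_prod]
      exact Finset.prod_eq_zero (Finset.mem_univ i) (by simp)
    rw [← this, Polynomial.eval_eq_sum_range, epsP, hdeg]
  rw [e1, Finset.sum_mul, map_sum]
  have e3 : ∀ k, Psi μ b a (C (cb b k) * X i ^ k * r) =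
      Psi μ b a ((epsP N).coeff k * (X i ^ k * r)) := by
    intro k
    rw [Psi_eps, mul_assoc, ← smul_eq_C_mul, map_smul, smul_eq_mul]
  simp only [e3]
  rw [← map_sum]
  simp only [← mul_assoc]
  rw [← Finset.sum_mul, ← e2, zero_mul, map_zero]

end Psis
end EPF

namespace EPF
section HC
set_option linter.unusedSectionVars false
set_option linter.unusedSimpArgs false
open MvPolynomial Topology
variable {N : ℕ}

lemma coord_const {h : (Fin N → ℂ) → ℂ}
    (hd : ∀ a l, HasDerivAt (fun x => h (Function.update a l x)) 0 (a l)) (a : Fin N → ℂ) :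
    h a = h 0 := by
  have step : ∀ a l x, h (Function.update a l x) = h a := by
    intro a l x
    have hx : ∀ x, HasDerivAt (fun x => h (Function.update a l x)) 0 x := by
      intro x
      have := hd (Function.update a l x) l
      simpa using this
    have := is_const_of_deriv_eq_zero (fun x => (hx x).differentiableAt) (fun x => (hx x).deriv)
      x (a l)
    simpa using this
  have key : ∀ s : Finset (Fin N), h (s.piecewise a 0) = h 0 := by
    intro s
    induction s using Finset.induction_on with
    | empty => simp
    | insert i s hi ih => rw [Finset.piecewise_insert, step, ih]
  simpa using key Finset.univ

lemma coord_exp {g : (Fin N → ℂ) → ℂ} {c : Fin N → ℂ}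
    (hd : ∀ a l, HasDerivAt (fun x => g (Function.update a l x)) (-c l * g a) (a l))
    (a : Fin N → ℂ) : g a = g 0 * Complex.exp (-∑ i, a i * c i) := by
  have h0 := coord_const (h := fun a => g a * Complex.exp (-∑ i, a i * (-c i))) (fun a l => by
    have := (hd a l).mul (exp_deriv a (fun i => -c i) l)
    refine this.congr_deriv ?_
    simp only [Function.update_eq_self]
    ring) a
  simp only [Pi.zero_apply, zero_mul, Finset.sum_const_zero, neg_zero, Complex.exp_zero,
    mul_one, mul_neg, Finset.sum_neg_distrib, neg_neg] at h0
  rw [← h0, mul_assoc, ← Complex.exp_add]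
  simp

lemma prodP {M : Type*} [CommMonoid M] (f : Fin N → Fin N → M) :
    ∏ p : PP N, f p.1.1 p.1.2 = ∏ i, ∏ j ∈ Finset.Ioi i, f i j := by
  have h : ∀ i, ∏ j ∈ Finset.Ioi i, f i j = ∏ j, if i < j then f i j else 1 := by
    intro i
    rw [← Finset.prod_filter]
    congr 1; ext; simp
  simp only [h]
  rw [← Fintype.prod_prod_type' (f := fun i j => if i < j then f i j else 1), ← Finset.prod_filter]
  symm
  exact Finset.prod_subtype (p := fun p : Fin N × Fin N => p.1 < p.2) _ (by simp)
    (fun p : Fin N × Fin N => f p.1 p.2)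

lemma Vd_eq (a : Fin N → ℂ) : Vd a = ∏ i, ∏ j ∈ Finset.Ioi i, (a j - a i) :=
  prodP fun i j => a j - a i

lemma Vd_det (a : Fin N → ℂ) : Vd a = (Matrix.vandermonde a).det := by
  rw [Vd_eq, Matrix.det_vandermonde]

lemma Vd_perm (a : Fin N → ℂ) (τ : Equiv.Perm (Fin N)) :
    Vd (a ∘ τ) = ((Equiv.Perm.sign τ : ℤ) : ℂ) * Vd a := by
  rw [Vd_det, Vd_det, ← Matrix.det_permute]
  rfl

lemma card_PP : Fintype.card (PP N) = N * (N - 1) / 2 := by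
  have h1 : Fintype.card (PP N) = ∑ p : PP N, 1 := by simp
  rw [h1, sumP (fun _ _ => 1), ← Finset.sum_range_id, Finset.sum_comm,
    ← Fin.sum_univ_eq_sum_range (fun i => i) N]
  refine Finset.sum_congr rfl fun j _ => ?_
  rw [← Finset.sum_filter, Finset.sum_const, smul_eq_mul, mul_one, ← Fin.card_Iio j]
  congr 1; ext; simp

variable [MeasurableSpace (Matrix.unitaryGroup (Fin N) ℂ)]
    [BorelSpace (Matrix.unitaryGroup (Fin N) ℂ)]
    (μ : Measure (Matrix.unitaryGroup (Fin N) ℂ)) [IsProbabilityMeasure μ] [μ.IsHaarMeasure]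

lemma psi_exp (hN : 1 ≤ N) {b : Fin N → ℂ} (hb : Function.Injective b) :
    ∃ Cf : (Fin N → Fin N) → ℂ, ∀ a, Psi μ b a 1 =
      ∑ f, Cf f * Complex.exp (-∑ i, a i * b (f i)) := by
  set ℓ : Fin N → Fin N → DP N := fun m i =>
    Polynomial.aeval (X i : DP N) (Lagrange.basis Finset.univ b m) with hℓ
  set Pf : (Fin N → Fin N) → DP N := fun f => ∏ i, ℓ (f i) i with hPf
  have hsum : ∑ f, Pf f = 1 := by
    have h1 : ∀ i, ∑ m, ℓ m i = 1 := by
      intro i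
      rw [hℓ, ← map_sum, Lagrange.sum_basis hb.injOn ⟨⟨0, hN⟩, Finset.mem_univ _⟩, map_one]
    have h2 := Finset.prod_univ_sum (fun _ : Fin N => (Finset.univ : Finset (Fin N)))
      (fun i m => ℓ m i)
    simp only [h1, Finset.prod_const_one, Fintype.piFinset_univ] at h2
    exact h2.symm
  have hker : ∀ f l a, Psi μ b a (X l * Pf f) = b (f l) * Psi μ b a (Pf f) := by
    intro f l a
    have e : ∃ r : DP N, (X l - C (b (f l))) * Pf f = (∏ j, (X l - C (b j))) * r := by
      refine ⟨C (∏ j ∈ Finset.univ.erase (f l), (b (f l) - b j)⁻¹) *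
        ∏ i ∈ Finset.univ.erase l, ℓ (f i) i, ?_⟩
      have h1 : ℓ (f l) l = C (∏ j ∈ Finset.univ.erase (f l), (b (f l) - b j)⁻¹) *
          ∏ j ∈ Finset.univ.erase (f l), (X l - C (b j)) := by
        simp only [hℓ, Lagrange.basis, Lagrange.basisDivisor, map_prod, map_mul,
          Finset.prod_mul_distrib, Polynomial.aeval_C, algebraMap_eq, map_sub, Polynomial.aeval_X]
      rw [hPf]
      simp only []
      rw [← Finset.mul_prod_erase _ _ (Finset.mem_univ l), h1,
        ← Finset.mul_prod_erase _ (fun j => (X l - C (b j) : DP N)) (Finset.mem_univ (f l))]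
      ring
    obtain ⟨r, hr⟩ := e
    have h0 := Psi_kill μ b a l r
    rw [← hr, sub_mul, map_sub, ← smul_eq_C_mul, map_smul, smul_eq_mul, sub_eq_zero] at h0
    exact h0
  refine ⟨fun f => Psi μ b 0 (Pf f), fun a => ?_⟩
  rw [← hsum, map_sum]
  refine Finset.sum_congr rfl fun f _ => ?_
  refine coord_exp (g := fun a => Psi μ b a (Pf f)) (c := fun i => b (f i)) (fun a l => ?_) a
  refine (Psi_jet μ b a l (Pf f)).congr_deriv ?_
  rw [hker]; ring

lemma lam_perm (b a : Fin N → ℂ) (τ : Equiv.Perm (Fin N)) :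
    lam μ b (a ∘ τ) 1 = lam μ b a 1 := by
  set P : Matrix (Fin N) (Fin N) ℂ := (1 : Matrix (Fin N) (Fin N) ℂ).submatrix τ id with hP
  have hPM : ∀ M : Matrix (Fin N) (Fin N) ℂ, P * M * star P = M.submatrix τ τ := by
    intro M
    ext i j
    simp [hP, Matrix.mul_apply, Matrix.one_apply, Matrix.star_apply, apply_ite (starRingEnd ℂ)]
  have hmem : P ∈ Matrix.unitaryGroup (Fin N) ℂ := by
    rw [Matrix.mem_unitaryGroup_iff]
    have := hPM 1
    rw [mul_one] at this
    rw [this]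
    exact Matrix.submatrix_one_equiv τ
  have := integral_mul_left_eq_self (μ := μ)
    (fun U => evM (WU b U) 1 * wt (a ∘ τ) (WU b U)) ⟨P, hmem⟩
  rw [lam_apply, ← this, lam_apply]
  congr 1
  funext U
  rw [WU_mul, hPM]
  simp only [map_one, one_mul, wt, Matrix.submatrix_apply, Function.comp]
  rw [← Equiv.sum_comp τ (fun i => a i * WU b U i i)]

/-- exponential matrix -/
noncomputable def Ed (a b : Fin N → ℂ) : Matrix (Fin N) (Fin N) ℂ :=
  Matrix.of fun i j => Complex.exp (-(a i * b j))

lemma sum_exp_det (a b : Fin N → ℂ) : ∑ τ : Equiv.Perm (Fin N), ((Equiv.Perm.sign τ : ℤ) : ℂ) *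
    Complex.exp (-∑ i, a (τ i) * b i) = (Ed a b).det := by
  rw [Matrix.det_apply']
  refine Finset.sum_congr rfl fun τ _ => ?_
  rw [← Finset.sum_neg_distrib, Complex.exp_sum]
  rfl

lemma Psi_perm (b a : Fin N → ℂ) (τ : Equiv.Perm (Fin N)) :
    Psi μ b (a ∘ τ) 1 = ((Equiv.Perm.sign τ : ℤ) : ℂ) * Psi μ b a 1 := by
  rw [Psi_one, Psi_one, Vd_perm, lam_perm]; ring

lemma sign_sq (τ : Equiv.Perm (Fin N)) :
    ((Equiv.Perm.sign τ : ℤ) : ℂ) * ((Equiv.Perm.sign τ : ℤ) : ℂ) = 1 := by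
  rcases Int.units_eq_one_or (Equiv.Perm.sign τ) with h | h <;> simp [h]

lemma hciz0 (hN : 1 ≤ N) {b : Fin N → ℂ} (hb : Function.Injective b) :
    ∃ c : ℂ, ∀ a, Psi μ b a 1 = c * (Ed a b).det := by
  obtain ⟨Cf, hC⟩ := psi_exp μ hN hb
  have hdet : ∀ f : Fin N → Fin N, ∃ d : ℂ, ∀ a : Fin N → ℂ,
      (Ed a (b ∘ f)).det = d * (Ed a b).det := by
    intro f
    by_cases hf : Function.Injective f
    · have hbij : Function.Bijective f := Finite.injective_iff_bijective.1 hf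
      refine ⟨((Equiv.Perm.sign (Equiv.ofBijective f hbij) : ℤ) : ℂ), fun a => ?_⟩
      rw [← Matrix.det_permute']
      rfl
    · refine ⟨0, fun a => ?_⟩
      rw [Function.Injective] at hf
      push Not at hf
      obtain ⟨i, j, h1, h2⟩ := hf
      rw [zero_mul]
      exact Matrix.det_zero_of_column_eq h2 fun k => by simp [Ed, h1]
  choose d hd using hdet
  refine ⟨(N.factorial : ℂ)⁻¹ * ∑ f, Cf f * d f, fun a => ?_⟩
  have hfac : (N.factorial : ℂ) ≠ 0 := by exact_mod_cast N.factorial_ne_zero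
  have e1 : (N.factorial : ℂ) * Psi μ b a 1 =
      ∑ τ : Equiv.Perm (Fin N), ((Equiv.Perm.sign τ : ℤ) : ℂ) * Psi μ b (a ∘ τ) 1 := by
    simp only [Psi_perm, ← mul_assoc, sign_sq, one_mul]
    simp [Fintype.card_perm]
  have e2 : ∑ τ : Equiv.Perm (Fin N), ((Equiv.Perm.sign τ : ℤ) : ℂ) * Psi μ b (a ∘ τ) 1 =
      (∑ f, Cf f * d f) * (Ed a b).det := by
    simp only [hC, Finset.mul_sum]
    rw [Finset.sum_comm, Finset.sum_mul]
    refine Finset.sum_congr rfl fun f _ => ?_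
    rw [mul_assoc, ← hd, ← sum_exp_det, Finset.mul_sum]
    refine Finset.sum_congr rfl fun τ _ => ?_
    simp only [Function.comp]
    ring
  rw [mul_assoc, ← e2, ← e1, inv_mul_cancel_left₀ hfac]

lemma lam_zero (b : Fin N → ℂ) : lam μ b 0 1 = 1 := by
  simp [lam_apply, wt]

lemma hciz_const (b : Fin N → ℂ) {c : ℂ}
    (hc : ∀ a, Psi μ b a 1 = c * (Ed a b).det) :
    c * ((-1) ^ Fintype.card (PP N) * Vd b) = Vd (fun i : Fin N => ((i : ℕ) : ℂ)) := by
  set ι : Fin N → ℂ := fun i => ((i : ℕ) : ℂ) with hι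
  have h1 : ∀ t : ℂ, t ≠ 0 → Vd ι * lam μ b (fun i => t * ι i) 1 =
      c * ∏ p : PP N, (t⁻¹ • (Complex.exp (-(t * b p.1.2)) - Complex.exp (-(t * b p.1.1)))) := by
    intro t ht
    have h2 := hc (fun i => t * ι i)
    rw [Psi_one] at h2
    have h3 : Vd (fun i => t * ι i) = t ^ Fintype.card (PP N) * Vd ι := by
      simp only [Vd, ← mul_sub, Finset.prod_mul_distrib, Finset.prod_const, Finset.card_univ]
    have h4 : (Ed (fun i => t * ι i) b).det =
        ∏ p : PP N, (Complex.exp (-(t * b p.1.2)) - Complex.exp (-(t * b p.1.1))) := by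
      have : Ed (fun i => t * ι i) b =
          (Matrix.vandermonde fun j => Complex.exp (-(t * b j)))ᵀ := by
        ext i j
        simp only [Ed, Matrix.of_apply, Matrix.transpose_apply, Matrix.vandermonde_apply, hι]
        rw [← Complex.exp_nat_mul]
        congr 1; ring
      rw [this, Matrix.det_transpose, ← Vd_det, Vd]
    rw [h3, h4] at h2
    simp only [smul_eq_mul, Finset.prod_mul_distrib, Finset.prod_const, Finset.card_univ, inv_pow]
    have ht' : t ^ Fintype.card (PP N) ≠ 0 := pow_ne_zero _ ht
    field_simp
    linear_combination h2
  have l1 : Filter.Tendsto (fun t : ℂ => Vd ι * lam μ b (fun i => t * ι i) 1) (𝓝[≠] 0)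
      (𝓝 (Vd ι)) := by
    have hcont : Continuous fun t : ℂ => Vd ι * lam μ b (fun i => t * ι i) 1 :=
      ((lam_cont μ b 1).comp (by fun_prop : Continuous fun (t : ℂ) (i : Fin N) => t * ι i)).const_mul _
    have := (hcont.tendsto 0).mono_left (nhdsWithin_le_nhds (s := {0}ᶜ))
    have e : lam μ b (fun i => 0 * ι i) 1 = 1 := by
      rw [← lam_zero μ b]; congr 2; simp only [zero_mul]; rfl
    rwa [e, mul_one] at this
  have l2 : Filter.Tendsto (fun t : ℂ => c * ∏ p : PP N, (t⁻¹ • (Complex.exp (-(t * b p.1.2)) -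
      Complex.exp (-(t * b p.1.1))))) (𝓝[≠] 0)
      (𝓝 (c * ∏ p : PP N, (-b p.1.2 - -b p.1.1))) := by
    refine Filter.Tendsto.const_mul _ (tendsto_finsetProd _ fun p _ => ?_)
    have hd : ∀ z : ℂ, HasDerivAt (fun t : ℂ => Complex.exp (-(t * z))) (-z) 0 := by
      intro z
      have h0 : HasDerivAt (fun t : ℂ => -(t * z)) (-(1 * z)) 0 :=
        ((hasDerivAt_id (0 : ℂ)).mul_const z).neg
      exact h0.cexp.congr_deriv (by simp)
    have := ((hd (b p.1.2)).sub (hd (b p.1.1))).tendsto_slope_zero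
    simpa using this
  have l3 := l1.congr' (f₂ := fun t : ℂ => c * ∏ p : PP N, (t⁻¹ • (Complex.exp (-(t * b p.1.2)) -
      Complex.exp (-(t * b p.1.1))))) (by
    filter_upwards [self_mem_nhdsWithin] with t ht
    exact h1 t ht)
  have := tendsto_nhds_unique l2 l3
  rw [← this, Vd]
  congr 1
  rw [← Finset.card_univ, ← Finset.prod_const, ← Finset.prod_mul_distrib]
  exact Finset.prod_congr rfl fun p _ => by ring

lemma Vd_iota (hN : 1 ≤ N) : Vd (fun i : Fin N => ((i : ℕ) : ℂ)) =
    ∏ k ∈ Finset.Icc 1 (N - 1), (Nat.factorial k : ℂ) := by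
  obtain ⟨n, rfl⟩ : ∃ n, N = n + 1 := ⟨N - 1, by omega⟩
  have := Matrix.det_vandermonde_id_eq_superFactorial (R := ℂ) n
  rw [Vd_det]
  rw [Nat.add_sub_cancel, ← Nat.cast_prod, Nat.prod_Icc_factorial]
  exact this

/-- HCIZ formula -/
lemma hciz (hN : 1 ≤ N) {a b : Fin N → ℂ} (ha : Function.Injective a)
    (hb : Function.Injective b) : lam μ b a 1 =
    (∏ k ∈ Finset.Icc 1 (N - 1), (Nat.factorial k : ℂ)) * (-1) ^ Fintype.card (PP N) /
      (Vd a * Vd b) * (Ed a b).det := by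
  obtain ⟨c, hc⟩ := hciz0 μ hN hb
  have h1 := hciz_const μ b hc
  have h2 := hc a
  rw [Psi_one] at h2
  rw [Vd_iota hN] at h1
  have hVa := Vd_ne ha
  have hVb := Vd_ne hb
  have hs : ((-1 : ℂ) ^ Fintype.card (PP N)) * (-1) ^ Fintype.card (PP N) = 1 := by
    rw [← mul_pow]; simp
  rw [← h1]
  field_simp
  linear_combination h2 - c * (Ed a b).det * hs

end HC
end EPF

namespace EPF
section FIN
set_option linter.unusedSectionVars false
set_option linter.unusedSimpArgs false
open MvPolynomial Topology
variable {N : ℕ}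

/-- relabelling of the variables by a permutation -/
noncomputable def rn (τ : Equiv.Perm (Fin N)) : Poly N →ₐ[ℂ] Poly N :=
  rename fun p => (τ.symm p.1, τ.symm p.2)

lemma rn_X (τ : Equiv.Perm (Fin N)) (i j : Fin N) :
    rn τ (X (i, j)) = X (τ.symm i, τ.symm j) := by simp [rn]

lemma rn_Dd (τ : Equiv.Perm (Fin N)) (i j : Fin N) (G : Poly N) :
    rn τ (Dd i j G) = Dd (τ.symm i) (τ.symm j) (rn τ G) := by
  induction G using MvPolynomial.induction_on with
  | C c =>
    have h1 : rn τ (C c) = C c := by simp [rn]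
    rw [h1, ← algebraMap_eq, Derivation.map_algebraMap, Derivation.map_algebraMap, map_zero]
  | add p q hp hq => simp only [map_add, hp, hq]
  | mul_X p k hp =>
    obtain ⟨k, l⟩ := k
    rw [map_mul (rn τ), Derivation.leibniz, Derivation.leibniz, map_add, smul_eq_mul, smul_eq_mul,
      smul_eq_mul, smul_eq_mul, map_mul (rn τ), map_mul (rn τ), hp, rn_X]
    congr 2
    rw [Dd, Dd, mkDerivation_X, mkDerivation_X]
    simp only [EmbeddingLike.apply_eq_iff_eq, map_sub]
    congr 1 <;> split_ifs <;> simp [rn_X]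

lemma evM_rn {R : Type*} [CommRing R] [Algebra ℂ R] (M : Matrix (Fin N) (Fin N) R)
    (τ : Equiv.Perm (Fin N)) (G : Poly N) :
    evM M (rn τ G) = evM (M.submatrix τ.symm τ.symm) G := by
  simp only [evM, rn, aeval_rename]
  rfl

/-- contribution of one pair of permutations -/
noncomputable def ch (b : Fin N → ℂ) (σ τ : Equiv.Perm (Fin N)) (a : Fin N → ℂ) :
    Poly N →ₗ[ℂ] ℂ :=
  rho (b ∘ σ) (a ∘ τ) ∘ₗ (rn τ).toLinearMap

lemma ch_apply (b : Fin N → ℂ) (σ τ : Equiv.Perm (Fin N)) (a : Fin N → ℂ) (G : Poly N) :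
    ch b σ τ a G = rho (b ∘ σ) (a ∘ τ) (rn τ G) := rfl

lemma ch_SD (b : Fin N → ℂ) (σ τ : Equiv.Perm (Fin N)) {a : Fin N → ℂ}
    (ha : Function.Injective a) : SD a (ch b σ τ a) := by
  intro i j hij G
  rw [ch_apply, ch_apply, map_mul, rn_X, rn_Dd]
  have := rho_SD (b ∘ σ) (ha.comp τ.injective) (τ.symm i) (τ.symm j) (by simpa using hij) (rn τ G)
  simpa using this

lemma ch_Ev (b : Fin N → ℂ) (σ τ : Equiv.Perm (Fin N)) : Ev (ch b σ τ) := by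
  intro a ha l G
  have h := rho_Ev (b ∘ σ) (a ∘ τ) (ha.comp τ.injective) (τ.symm l) (rn τ G)
  have e : ∀ x, Function.update a l x ∘ τ = Function.update (a ∘ τ) (τ.symm l) x := by
    intro x
    funext i
    by_cases hi : τ i = l
    · subst hi; simp
    · have : i ≠ τ.symm l := fun e => hi (by rw [e]; simp)
      simp [Function.update_of_ne hi, Function.update_of_ne this]
  simp only [ch_apply, map_mul, rn_X, e]
  simpa using h

/-- the right hand side family -/
noncomputable def rhsE (c : ℂ) (b : Fin N → ℂ) (a : Fin N → ℂ) : Poly N →ₗ[ℂ] ℂ :=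
  c • ∑ σ : Equiv.Perm (Fin N), ∑ τ : Equiv.Perm (Fin N),
    ((Equiv.Perm.sign σ : ℤ) : ℂ) • ch b σ τ a

lemma rhsE_apply (c : ℂ) (b a : Fin N → ℂ) (G : Poly N) : rhsE c b a G =
    c * ∑ σ : Equiv.Perm (Fin N), ∑ τ : Equiv.Perm (Fin N),
    ((Equiv.Perm.sign σ : ℤ) : ℂ) * ch b σ τ a G := by
  simp only [rhsE, LinearMap.smul_apply, LinearMap.sum_apply, smul_eq_mul]

lemma rhsE_SD (c : ℂ) (b : Fin N → ℂ) {a : Fin N → ℂ}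
    (ha : Function.Injective a) : SD a (rhsE c b a) := by
  intro i j hij G
  rw [rhsE_apply, rhsE_apply, mul_left_comm, Finset.mul_sum]
  congr 1
  refine Finset.sum_congr rfl fun σ _ => ?_
  rw [Finset.mul_sum]
  refine Finset.sum_congr rfl fun τ _ => ?_
  rw [mul_left_comm, ch_SD b σ τ ha i j hij]

lemma rhsE_Ev (c : ℂ) (b : Fin N → ℂ) : Ev (rhsE c b) := by
  intro a ha l G
  simp only [rhsE_apply]
  refine (HasDerivAt.const_mul c (HasDerivAt.fun_sum fun σ _ => HasDerivAt.fun_sum fun τ _ =>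
    HasDerivAt.const_mul _ (ch_Ev b σ τ a ha l G))).congr_deriv ?_
  simp [Finset.sum_neg_distrib]

lemma Ed_perm (a b : Fin N → ℂ) (σ : Equiv.Perm (Fin N)) :
    (Ed a (b ∘ σ)).det = ((Equiv.Perm.sign σ : ℤ) : ℂ) * (Ed a b).det := by
  rw [← Matrix.det_permute']
  rfl

lemma sign_inv' (τ : Equiv.Perm (Fin N)) :
    (((Equiv.Perm.sign τ : ℤ) : ℂ))⁻¹ = ((Equiv.Perm.sign τ : ℤ) : ℂ) := by
  rcases Int.units_eq_one_or (Equiv.Perm.sign τ) with h | h <;> simp [h]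

variable [MeasurableSpace (Matrix.unitaryGroup (Fin N) ℂ)]
  [BorelSpace (Matrix.unitaryGroup (Fin N) ℂ)] in
lemma rhsE_one (c : ℂ) (b a : Fin N → ℂ) : rhsE c b a 1 =
    c * (N.factorial * (Real.pi : ℂ) ^ Fintype.card (PP N) * (Vd a)⁻¹ * (Ed a b).det) := by
  rw [rhsE_apply]
  congr 1
  have : ∀ σ : Equiv.Perm (Fin N), ∑ τ : Equiv.Perm (Fin N),
      ((Equiv.Perm.sign σ : ℤ) : ℂ) * ch b σ τ a 1 =
      (Real.pi : ℂ) ^ Fintype.card (PP N) * (Vd a)⁻¹ * (Ed a b).det := by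
    intro σ
    have h := sum_exp_det a (b ∘ σ)
    rw [Ed_perm] at h
    have h2 : (Ed a b).det = ((Equiv.Perm.sign σ : ℤ) : ℂ) *
        (((Equiv.Perm.sign σ : ℤ) : ℂ) * (Ed a b).det) := by
      rw [← mul_assoc, sign_sq, one_mul]
    rw [h2, ← h, Finset.mul_sum, Finset.mul_sum]
    refine Finset.sum_congr rfl fun τ _ => ?_
    rw [ch_apply, map_one, rho_one, Vd_perm, mul_inv, sign_inv']
    simp only [Function.comp]
    ring
  rw [Finset.sum_congr rfl fun σ _ => this σ]
  simp [Fintype.card_perm]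
  ring

section words
variable {R R' : Type*} [CommRing R] [CommRing R']

def Fw (L : List (List Bool)) (X Y : Matrix (Fin N) (Fin N) R) : R :=
  (L.map fun w => ((w.map fun cc => cond cc X Y).prod).trace).prod

lemma Fw_map (L : List (List Bool)) (φ : Matrix (Fin N) (Fin N) R →* Matrix (Fin N) (Fin N) R')
    (f : R →* R') (h : ∀ M, (φ M).trace = f M.trace) (X Y : Matrix (Fin N) (Fin N) R) :
    Fw L (φ X) (φ Y) = f (Fw L X Y) := by
  unfold Fw
  rw [map_list_prod, List.map_map]
  congr 1
  refine List.map_congr_left fun w _ => ?_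
  simp only [Function.comp]
  rw [← h, map_list_prod, List.map_map]
  congr 3
  funext cc
  cases cc <;> rfl

lemma Fw_ringHom (L : List (List Bool)) (f : R →+* R') (X Y : Matrix (Fin N) (Fin N) R) :
    Fw L (X.map f) (Y.map f) = f (Fw L X Y) := by
  refine Fw_map L (f.mapMatrix : Matrix (Fin N) (Fin N) R →+* Matrix (Fin N) (Fin N) R').toMonoidHom
    f.toMonoidHom ?_ X Y
  intro M
  simp [Matrix.trace]

lemma Fw_perm (L : List (List Bool)) (e : Equiv.Perm (Fin N)) (X Y : Matrix (Fin N) (Fin N) R) :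
    Fw L (X.submatrix e e) (Y.submatrix e e) = Fw L X Y := by
  refine Fw_map L ⟨⟨fun M => M.submatrix e e, by simp⟩, fun A B => by
    simp⟩ (MonoidHom.id R) ?_ X Y
  intro M
  simp [Matrix.trace]
  exact Equiv.sum_comp e fun i => M i i

lemma Fw_conj (L : List (List Bool)) (S S' : Matrix (Fin N) (Fin N) R) (h : S' * S = 1)
    (h' : S * S' = 1) (X Y : Matrix (Fin N) (Fin N) R) :
    Fw L (S' * X * S) (S' * Y * S) = Fw L X Y := by
  have hm : ∀ A B : Matrix (Fin N) (Fin N) R, S' * (A * B) * S = (S' * A * S) * (S' * B * S) := by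
    intro A B
    calc S' * (A * B) * S = S' * A * 1 * B * S := by simp [Matrix.mul_assoc]
      _ = S' * A * (S * S') * B * S := by rw [h']
      _ = _ := by simp only [Matrix.mul_assoc]
  refine Fw_map L ⟨⟨fun M => S' * M * S, by simp [h]⟩, hm⟩ (MonoidHom.id R) ?_ X Y
  intro M
  simp
  rw [Matrix.trace_mul_comm, ← Matrix.mul_assoc, h', one_mul]

end words

/-- generic matrix -/
noncomputable def genM (N : ℕ) : Matrix (Fin N) (Fin N) (Poly N) := Matrix.of fun i j => X (i, j)

noncomputable def GF (L : List (List Bool)) (a : Fin N → ℂ) : Poly N :=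
  Fw L (Am (Poly N) a) (genM N)

lemma Am_map {R R' : Type*} [CommRing R] [CommRing R'] [Algebra ℂ R] [Algebra ℂ R']
    (f : R →ₐ[ℂ] R') (a : Fin N → ℂ) : (Am R a).map (f : R →+* R') = Am R' a := by
  ext i j
  by_cases h : i = j
  · subst h; simp [Am]
  · simp [Am, h]

lemma evM_GF {R : Type*} [CommRing R] [Algebra ℂ R] (M : Matrix (Fin N) (Fin N) R)
    (L : List (List Bool)) (a : Fin N → ℂ) : evM M (GF L a) = Fw L (Am R a) M := by
  have := Fw_ringHom L (evM M : Poly N →+* R) (Am (Poly N) a) (genM N)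
  rw [Am_map] at this
  rw [GF]
  refine this.symm.trans ?_
  congr 1
  ext i j
  simp [genM, evM_X]

lemma Am_C (a : Fin N → ℂ) : Am ℂ a = Matrix.diagonal a := rfl

lemma ch_GF (L : List (List Bool)) (b : Fin N → ℂ) (σ τ : Equiv.Perm (Fin N)) {a : Fin N → ℂ}
    (ha : Function.Injective a) : evM (Ym (a ∘ τ) (b ∘ σ)) (rn τ (GF L a)) =
    Fw L (Am (RR N) (a ∘ τ) + Tm N) (Y0 (b ∘ σ)) := by
  have haτ := ha.comp τ.injective
  rw [evM_rn, evM_GF, ← Fw_perm L τ]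
  have e1 : (Am (RR N) a).submatrix τ τ = Am (RR N) (a ∘ τ) := by
    ext1 i j
    simp [Am, Matrix.diagonal_apply]
  have e2 : ((Ym (a ∘ τ) (b ∘ σ)).submatrix τ.symm τ.symm).submatrix τ τ =
      Ym (a ∘ τ) (b ∘ σ) := by
    ext1 i j
    simp
  rw [e1, e2, ← Fw_conj L (Sm (a ∘ τ) (Tm N)) (Sm (a ∘ τ) (Tm N))⁻¹ (Sm_inv_mul _ Tm_su)
    (Sm_mul_inv _ Tm_su) (Am (RR N) (a ∘ τ) + Tm N), Matrix.mul_assoc, Sm_eq haτ Tm_su,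
    ← Matrix.mul_assoc, Sm_inv_mul _ Tm_su, one_mul]
  rfl

lemma trace_strictUpper (t : PP N → ℂ) : (strictUpper N t * star (strictUpper N t)).trace =
    ∑ p, t p * star (t p) := by
  have h : ∀ p : PP N, t p * star (t p) = (fun i j => strictUpper N t i j *
      star (strictUpper N t i j)) p.1.1 p.1.2 := by
    rintro ⟨⟨i, j⟩, hij⟩
    have hij' : i < j := hij
    simp [strictUpper, hij']
  rw [Finset.sum_congr rfl fun p _ => h p]
  refine Eq.trans ?_ (sumP (fun i j => strictUpper N t i j * star (strictUpper N t i j))).symm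
  simp only [Matrix.trace, Matrix.diag, Matrix.mul_apply, Matrix.star_apply]
  refine Finset.sum_congr rfl fun i _ => Finset.sum_congr rfl fun j _ => ?_
  split_ifs with hij
  · rfl
  · simp [strictUpper, hij]

lemma wick_Fw (L : List (List Bool)) (a b : Fin N → ℂ) :
    wickL (Fw L (Am (RR N) a + Tm N) (Y0 b)) = ∫ t : PP N → ℂ,
      Complex.exp (-(strictUpper N t * star (strictUpper N t)).trace) *
        Fw L (Matrix.diagonal a + strictUpper N t) (Matrix.diagonal b + star (strictUpper N t)) := by
  rw [wickL_apply, wick]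
  congr 1
  funext t
  rw [gaussEval, trace_strictUpper]
  congr 1
  rw [← Fw_ringHom]
  congr 1
  · ext i j
    by_cases h : i < j
    · simp [Am, Tm, strictUpper, h, h.ne]
    · by_cases hij : i = j
      · subst hij; simp [Am, Tm, strictUpper]
      · simp [Am, Tm, strictUpper, h, hij]
  · ext i j
    by_cases h : j < i
    · simp [Y0, Am, Ts, strictUpper, h, h.ne']
    · by_cases hij : i = j
      · subst hij; simp [Y0, Am, Ts, strictUpper]
      · simp [Y0, Am, Ts, strictUpper, h, hij]

end FIN
end EPF

theorem eynard_prats_ferrer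
    (N : ℕ) (hN : 1 ≤ N)
    [MeasurableSpace (Matrix.unitaryGroup (Fin N) ℂ)]
    [BorelSpace (Matrix.unitaryGroup (Fin N) ℂ)]
    (μ : Measure (Matrix.unitaryGroup (Fin N) ℂ))
    [μ.IsHaarMeasure] [IsProbabilityMeasure μ]
    (a b : Fin N → ℂ) (ha : Function.Injective a) (hb : Function.Injective b)
    (F : Matrix (Fin N) (Fin N) ℂ → Matrix (Fin N) (Fin N) ℂ → ℂ)
    (L : List (List Bool)) (hL : ∀ w ∈ L, w ≠ [])
    (hF : ∀ X Y, F X Y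
      = (L.map fun w => ((w.map fun cc => cond cc X Y).prod).trace).prod) :
    (∫ U : Matrix.unitaryGroup (Fin N) ℂ,
        F (Matrix.diagonal a) (U.1 * Matrix.diagonal b * star U.1) *
          Complex.exp (-(Matrix.diagonal a * U.1 * Matrix.diagonal b * star U.1).trace) ∂μ)
      = ((∏ k ∈ Finset.Icc 1 (N - 1), (Nat.factorial k : ℂ)) * (-1) ^ (N * (N - 1) / 2) /
            (Real.pi : ℂ) ^ (N * (N - 1) / 2)) /
          ((N.factorial : ℂ) * (∏ i : Fin N, ∏ j ∈ Finset.Ioi i, (a j - a i)) *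
            (∏ i : Fin N, ∏ j ∈ Finset.Ioi i, (b j - b i))) *
        ∑ σ : Equiv.Perm (Fin N), ∑ τ : Equiv.Perm (Fin N),
          ((Equiv.Perm.sign σ : ℤ) : ℂ) * ((Equiv.Perm.sign τ : ℤ) : ℂ) *
            Complex.exp (-∑ i : Fin N, a (τ i) * b (σ i)) *
            ∫ t : {p : Fin N × Fin N // p.1 < p.2} → ℂ,
              Complex.exp (-(strictUpper N t * star (strictUpper N t)).trace) *
                F (Matrix.diagonal (a ∘ τ) + strictUpper N t)
                  (Matrix.diagonal (b ∘ σ) + star (strictUpper N t)) := by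
  have hFw : F = EPF.Fw L := by
    funext X Y
    exact hF X Y
  subst hFw
  have hpi : (Real.pi : ℂ) ^ Fintype.card (EPF.PP N) ≠ 0 :=
    pow_ne_zero _ (by exact_mod_cast Real.pi_ne_zero)
  have hfac : (N.factorial : ℂ) ≠ 0 := by exact_mod_cast N.factorial_ne_zero
  have hVb := EPF.Vd_ne hb
  have hVa := EPF.Vd_ne ha
  obtain ⟨c, hc⟩ : ∃ c : ℂ, c = (∏ k ∈ Finset.Icc 1 (N - 1), (Nat.factorial k : ℂ)) *
      (-1) ^ Fintype.card (EPF.PP N) / ((Real.pi : ℂ) ^ Fintype.card (EPF.PP N) *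
        N.factorial * EPF.Vd b) := ⟨_, rfl⟩
  have main := EPF.fam_unique (E := EPF.lam μ b) (E' := EPF.rhsE c b)
    (fun a _ => EPF.lam_SD μ b a) (fun a ha => EPF.rhsE_SD c b ha)
    (EPF.lam_Ev μ b) (EPF.rhsE_Ev c b) (by
      intro a ha
      rw [EPF.hciz μ hN ha hb, EPF.rhsE_one, hc]
      have hVa := EPF.Vd_ne ha
      field_simp) a ha (EPF.GF L a)
  have hl : EPF.lam μ b a (EPF.GF L a) = ∫ U : Matrix.unitaryGroup (Fin N) ℂ,
        EPF.Fw L (Matrix.diagonal a) (U.1 * Matrix.diagonal b * star U.1) *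
          Complex.exp (-(Matrix.diagonal a * U.1 * Matrix.diagonal b * star U.1).trace) ∂μ := by
    rw [EPF.lam_apply]
    congr 1
    funext U
    rw [EPF.evM_GF, EPF.Am_C, EPF.wt, EPF.WU]
    congr 3
    rw [Matrix.mul_assoc (Matrix.diagonal a), Matrix.mul_assoc (Matrix.diagonal a)]
    simp only [Matrix.trace, Matrix.diag, Matrix.diagonal_mul]
  rw [← hl, main, EPF.rhsE_apply, ← EPF.card_PP, ← EPF.Vd_eq, ← EPF.Vd_eq, Finset.mul_sum,
    Finset.mul_sum]
  refine Finset.sum_congr rfl fun σ _ => ?_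
  rw [Finset.mul_sum, Finset.mul_sum]
  refine Finset.sum_congr rfl fun τ _ => ?_
  rw [← EPF.wick_Fw, EPF.ch_apply, EPF.rho_apply, EPF.ch_GF L b σ τ ha, EPF.Vd_perm, mul_inv,
    EPF.sign_inv', hc]
  simp only [Function.comp_apply]
  field_simp
end

section
/- Heine formula for the biorthogonal polynomials of the two-matrix model: for every n ≥ 1, (a) the partition function Z_n := ∫_{ℝⁿ×ℝⁿ} Δ(x)·Δ(y)·∏_{i=1}^{n} w(x_i,y_i) dx dy is a finite strictly positive real number; (b) the function π_n(ξ) := Z_n⁻¹ · ∫_{ℝⁿ×ℝⁿ} (∏_{i=1}^{n}(ξ−x_i)) · Δ(x)·Δ(y)·∏_{i} w(x_i,y_i) dx dy is a monic polynomial of degree n in ξ, and likewise σ_n(η) := Z_n⁻¹ · ∫ (∏_{i}(η−y_i)) · Δ(x)·Δ(y)·∏_{i} w(x_i,y_i) dx dy is a monic polynomial of degree n; (c) the two families are biorthogonal: for all m ≠ n, ∫∫_{ℝ²} π_n(ξ)·σ_m(η)·w(ξ,η) dξ dη = 0. -/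
open MeasureTheory

/-- Vandermonde product `Δ(x) = ∏_{i<j} (x_j - x_i)`. -/
noncomputable def vand {n : ℕ} (x : Fin n → ℝ) : ℝ :=
  ∏ i : Fin n, ∏ j ∈ Finset.Ioi i, (x j - x i)

/-- The two-matrix model weight `w(x,y) = exp(-(N/T)(V₁(x)+V₂(y)-xy))`. -/
noncomputable def tmWeight (N : ℕ) (T : ℝ) (V₁ V₂ : Polynomial ℝ) (x y : ℝ) : ℝ :=
  Real.exp (-((N : ℝ) / T) * (V₁.eval x + V₂.eval y - x * y))

/-- The partition function `Z_n`. -/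
noncomputable def Zpart (N : ℕ) (T : ℝ) (V₁ V₂ : Polynomial ℝ) (n : ℕ) : ℝ :=
  ∫ p : (Fin n → ℝ) × (Fin n → ℝ),
    vand p.1 * vand p.2 * ∏ i, tmWeight N T V₁ V₂ (p.1 i) (p.2 i)

/-- Heine-type formula for `π_n`. -/
noncomputable def piPoly (N : ℕ) (T : ℝ) (V₁ V₂ : Polynomial ℝ) (n : ℕ) (ξ : ℝ) : ℝ :=
  (Zpart N T V₁ V₂ n)⁻¹ *
    ∫ p : (Fin n → ℝ) × (Fin n → ℝ),
      (∏ i, (ξ - p.1 i)) * (vand p.1 * vand p.2 * ∏ i, tmWeight N T V₁ V₂ (p.1 i) (p.2 i))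

/-- Heine-type formula for `σ_n`. -/
noncomputable def sigmaPoly (N : ℕ) (T : ℝ) (V₁ V₂ : Polynomial ℝ) (n : ℕ) (η : ℝ) : ℝ :=
  (Zpart N T V₁ V₂ n)⁻¹ *
    ∫ p : (Fin n → ℝ) × (Fin n → ℝ),
      (∏ i, (η - p.2 i)) * (vand p.1 * vand p.2 * ∏ i, tmWeight N T V₁ V₂ (p.1 i) (p.2 i))


theorem vand_eq_det {n : ℕ} (x : Fin n → ℝ) : vand x = (Matrix.vandermonde x).det := by
  rw [Matrix.det_vandermonde]; rfl

theorem vand_perm {n : ℕ} (x : Fin n → ℝ) (σ : Equiv.Perm (Fin n)) :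
    vand (x ∘ σ) = (Equiv.Perm.sign σ : ℤ) * vand x := by
  rw [vand_eq_det, vand_eq_det, ← Matrix.det_permute]; rfl

theorem vand_ne_zero_iff {n : ℕ} (x : Fin n → ℝ) : vand x ≠ 0 ↔ Function.Injective x := by
  rw [vand_eq_det, Matrix.det_vandermonde_ne_zero_iff]

theorem vand_pos {n : ℕ} {x : Fin n → ℝ} (hx : StrictMono x) : 0 < vand x := by
  unfold vand
  refine Finset.prod_pos fun i _ => Finset.prod_pos fun j hj => ?_
  have := hx (Finset.mem_Ioi.1 hj)
  linarith

/-- exponential kernel matrix -/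
noncomputable def expMat {n : ℕ} (s : ℝ) (x y : Fin n → ℝ) : Matrix (Fin n) (Fin n) ℝ :=
  Matrix.of fun i j => Real.exp (s * (x i * y j))

theorem exp_zeros : ∀ (n : ℕ) (s : ℝ) (_ : s ≠ 0) (c x y : Fin n → ℝ), StrictMono x →
    Function.Injective y →
    (∀ i, ∑ j, c j * Real.exp (s * (x i * y j)) = 0) → c = 0 := by
  intro n
  induction n with
  | zero => intro s hs c x y _ _ _; exact Subsingleton.elim _ _
  | succ n ih =>
    intro s hs c x y hx hy h
    let g : ℝ → ℝ := fun t => ∑ j, c j * Real.exp (s * (t * (y j - y 0)))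
    have hg0 : ∀ i, g (x i) = 0 := by
      intro i
      have : g (x i) = Real.exp (-(s * (x i * y 0))) * ∑ j, c j * Real.exp (s * (x i * y j)) := by
        simp only [g]
        rw [Finset.mul_sum]
        refine Finset.sum_congr rfl fun j _ => ?_
        rw [mul_left_comm (Real.exp _), ← Real.exp_add]
        congr 2; ring
      rw [this, h i, mul_zero]
    have hgd : ∀ t, HasDerivAt g
        (∑ j, c j * (Real.exp (s * (t * (y j - y 0))) * (s * (1 * (y j - y 0))))) t := by
      intro t
      refine HasDerivAt.fun_sum fun j _ => ?_
      exact ((((hasDerivAt_id t).mul_const _).const_mul s).exp).const_mul (c j)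
    have hz : ∀ i : Fin n, ∃ z ∈ Set.Ioo (x i.castSucc) (x i.succ), deriv g z = 0 := by
      intro i
      refine exists_deriv_eq_zero (hx Fin.castSucc_lt_succ) ?_ ((hg0 _).trans (hg0 _).symm)
      exact fun t _ => (hgd t).continuousAt.continuousWithinAt
    choose z hz hz' using hz
    have hzm : StrictMono z := by
      rcases n with _ | n
      · exact fun a => a.elim0
      · rw [Fin.strictMono_iff_lt_succ]
        intro i
        exact (hz _).2.trans (by simpa using (hz i.succ).1)
    have key := ih s hs (fun j => c j.succ * (s * (y j.succ - y 0))) z (fun j => y j.succ - y 0)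
      hzm (fun a b hab => by
        have : y a.succ = y b.succ := by simpa using hab
        exact Fin.succ_injective _ (hy this)) (by
        intro i
        have := (hgd (z i)).deriv
        rw [hz' i, Fin.sum_univ_succ] at this
        simp only [sub_self, mul_zero, zero_add] at this
        rw [this]
        refine Finset.sum_congr rfl fun j _ => ?_
        ring)
    have hc : ∀ j : Fin n, c j.succ = 0 := by
      intro j
      have h1 := congrFun key j
      simp only [Pi.zero_apply, mul_eq_zero] at h1
      rcases h1 with h1 | h1 | h1
      · exact h1
      · exact absurd h1 hs
      · exact absurd (hy (sub_eq_zero.1 h1)) (Fin.succ_ne_zero j)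
    have h0 := h 0
    rw [Fin.sum_univ_succ] at h0
    simp only [hc, zero_mul, Finset.sum_const_zero, add_zero, mul_eq_zero, Real.exp_ne_zero,
      or_false] at h0
    funext j
    refine Fin.cases h0 (fun j => hc j) j

theorem expMat_det_ne {n : ℕ} {s : ℝ} (hs : s ≠ 0) {x y : Fin n → ℝ} (hx : StrictMono x)
    (hy : StrictMono y) : (expMat s x y).det ≠ 0 := by
  intro h
  obtain ⟨v, hv, hv'⟩ := Matrix.exists_mulVec_eq_zero_iff.2 h
  refine hv (exp_zeros n s hs v x y hx hy.injective fun i => ?_)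
  have := congrFun hv' i
  simp only [Matrix.mulVec, dotProduct, expMat, Matrix.of_apply, Pi.zero_apply] at this
  rw [← this]
  exact Finset.sum_congr rfl fun j _ => mul_comm _ _

theorem expMat_det_pos {n : ℕ} {s : ℝ} (hs : 0 < s) {x y : Fin n → ℝ} (hx : StrictMono x)
    (hy : StrictMono y) : 0 < (expMat s x y).det := by
  let f : ℝ → ℝ := fun t => (expMat s x (fun j => (1 - t) * (j : ℕ) + t * y j)).det
  have hf : Continuous f := by
    refine Continuous.matrix_det ?_
    refine continuous_matrix fun i j => ?_
    simp only [expMat, Matrix.of_apply]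
    fun_prop
  have hne : ∀ t ∈ Set.Icc (0:ℝ) 1, f t ≠ 0 := by
    intro t ht
    refine expMat_det_ne hs.ne' hx ?_
    intro a b hab
    have h1 : ((a : ℕ) : ℝ) < (b : ℕ) := by exact_mod_cast hab
    have h2 := hy hab
    simp only
    rcases ht.1.eq_or_lt with h | h
    · rw [← h]; simpa using hab
    · nlinarith [mul_pos h (sub_pos.2 h2), mul_nonneg (sub_nonneg.2 ht.2) (sub_pos.2 h1).le]
  have h0 : 0 < f 0 := by
    have : f 0 = vand (fun i => Real.exp (s * x i)) := by
      rw [vand_eq_det]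
      simp only [f]
      congr 1
      ext i j
      simp only [expMat, Matrix.of_apply, Matrix.vandermonde_apply, ← Real.exp_nat_mul]
      congr 1; ring
    rw [this]
    refine vand_pos fun a b hab => Real.exp_lt_exp.2 ?_
    exact mul_lt_mul_of_pos_left (hx hab) hs
  have h1 : f 1 = (expMat s x y).det := by simp [f]
  rw [← h1]
  by_contra hcon
  push Not at hcon
  obtain ⟨t, ht, ht'⟩ := intermediate_value_Icc' (zero_le_one) hf.continuousOn
    (show (0:ℝ) ∈ Set.Icc (f 1) (f 0) from ⟨hcon, h0.le⟩)
  exact hne t ht ht'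

theorem expMat_perm {n : ℕ} (s : ℝ) (x y : Fin n → ℝ) (σ τ : Equiv.Perm (Fin n)) :
    (expMat s (x ∘ σ) (y ∘ τ)).det =
      (Equiv.Perm.sign σ : ℤ) * ((Equiv.Perm.sign τ : ℤ) * (expMat s x y).det) := by
  rw [← Matrix.det_permute', ← Matrix.det_permute]; rfl

theorem sgn_sq {n : ℕ} (σ : Equiv.Perm (Fin n)) :
    (((Equiv.Perm.sign σ : ℤ) : ℝ)) * ((Equiv.Perm.sign σ : ℤ) : ℝ) = 1 := by
  rw [← Int.cast_mul, Int.units_coe_mul_self, Int.cast_one]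

theorem tp_pos {n : ℕ} {s : ℝ} (hs : 0 < s) {x y : Fin n → ℝ} (hx : Function.Injective x)
    (hy : Function.Injective y) : 0 < vand x * vand y * (expMat s x y).det := by
  have hx' : StrictMono (x ∘ Tuple.sort x) :=
    (Tuple.monotone_sort x).strictMono_of_injective (hx.comp (Equiv.injective _))
  have hy' : StrictMono (y ∘ Tuple.sort y) :=
    (Tuple.monotone_sort y).strictMono_of_injective (hy.comp (Equiv.injective _))
  have h := mul_pos (mul_pos (vand_pos hx') (vand_pos hy')) (expMat_det_pos hs hx' hy')
  rw [expMat_perm, vand_perm, vand_perm] at h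
  have e1 := sgn_sq (Tuple.sort x)
  have e2 := sgn_sq (Tuple.sort y)
  set a := (((Equiv.Perm.sign (Tuple.sort x) : ℤ)) : ℝ)
  set b := (((Equiv.Perm.sign (Tuple.sort y) : ℤ)) : ℝ)
  calc 0 < _ := h
    _ = (a * a) * (b * b) * (vand x * vand y * (expMat s x y).det) := by ring
    _ = _ := by rw [e1, e2]; ring

theorem tp_nonneg {n : ℕ} {s : ℝ} (hs : 0 < s) (x y : Fin n → ℝ) :
    0 ≤ vand x * vand y * (expMat s x y).det := by
  by_cases hx : Function.Injective x
  · by_cases hy : Function.Injective y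
    · exact (tp_pos hs hx hy).le
    · have : vand y = 0 := by
        by_contra h; exact hy ((vand_ne_zero_iff y).1 h)
      simp [this]
  · have : vand x = 0 := by
      by_contra h; exact hx ((vand_ne_zero_iff x).1 h)
    simp [this]
theorem vand_expand {n : ℕ} (x : Fin n → ℝ) :
    vand x = ∑ τ : Equiv.Perm (Fin n), ((Equiv.Perm.sign τ : ℤ) : ℝ) * ∏ i, x i ^ (τ i : ℕ) := by
  rw [vand_eq_det, ← Matrix.det_transpose, Matrix.det_apply']
  rfl

/-- bordered determinant -/
noncomputable def brd {n : ℕ} (A : Fin n → Fin (n+1) → ℝ) (v : Fin (n+1) → ℝ) : ℝ :=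
  ∑ σ : Equiv.Perm (Fin (n+1)), ((Equiv.Perm.sign σ : ℤ) : ℝ) *
    ((∏ i, A i (σ i.castSucc)) * v (σ (Fin.last n)))

/-- bordered matrix -/
noncomputable def brdMat {n : ℕ} (A : Fin n → Fin (n+1) → ℝ) (v : Fin (n+1) → ℝ) :
    Matrix (Fin (n+1)) (Fin (n+1)) ℝ :=
  Matrix.of (Fin.snoc (α := fun _ => Fin (n+1) → ℝ) A v)

theorem brd_eq_det {n : ℕ} (A : Fin n → Fin (n+1) → ℝ) (v : Fin (n+1) → ℝ) :
    brd A v = (brdMat A v).det := by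
  rw [← Matrix.det_transpose, Matrix.det_apply']
  unfold brd
  refine Finset.sum_congr rfl fun σ _ => ?_
  rw [Fin.prod_univ_castSucc]
  simp [brdMat]

theorem brd_row {n : ℕ} (A : Fin n → Fin (n+1) → ℝ) (i : Fin n) : brd A (A i) = 0 := by
  rw [brd_eq_det]
  refine Matrix.det_zero_of_row_eq (i := i.castSucc) (j := Fin.last n) (Fin.castSucc_lt_last i).ne ?_
  funext k
  simp [brdMat]

theorem brd_linear {n : ℕ} (A : Fin n → Fin (n+1) → ℝ) (v : Fin (n+1) → ℝ) :
    brd A v = ∑ j, v j * brd A (Pi.single j 1) := by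
  unfold brd
  simp_rw [Finset.mul_sum]
  rw [Finset.sum_comm]
  refine Finset.sum_congr rfl fun σ _ => ?_
  rw [Finset.sum_eq_single (σ (Fin.last n))]
  · simp; ring
  · intro b _ hb
    simp [Pi.single_eq_of_ne (Ne.symm hb)]
  · simp

theorem brd_vand {n : ℕ} (x : Fin n → ℝ) :
    brd (fun i j => x i ^ (j : ℕ)) (Pi.single (Fin.last n) 1) = vand x := by
  rw [brd_eq_det, Matrix.det_succ_row _ (Fin.last n), Finset.sum_eq_single (Fin.last n),
    vand_eq_det]
  · have h : (brdMat (fun i j => x i ^ (j : ℕ)) (Pi.single (Fin.last n) 1)).submatrix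
        (Fin.last n).succAbove (Fin.last n).succAbove = Matrix.vandermonde x := by
      ext i j
      simp [brdMat, Matrix.vandermonde_apply]
    rw [h]
    simp [brdMat, ← two_mul]
  · intro b _ hb
    simp [brdMat, hb]
  · simp

theorem brd_char {n : ℕ} (x : Fin n → ℝ) (ξ : ℝ) :
    brd (fun i j => x i ^ (j : ℕ)) (fun j => ξ ^ (j : ℕ)) = (∏ i, (ξ - x i)) * vand x := by
  have : brdMat (fun i j => x i ^ (j : ℕ)) (fun j => ξ ^ (j : ℕ)) =
      Matrix.vandermonde (Fin.snoc (α := fun _ => ℝ) x ξ) := by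
    ext i j
    refine Fin.lastCases ?_ (fun i => ?_) i <;> simp [brdMat, Matrix.vandermonde_apply]
  rw [brd_eq_det, this, ← vand_eq_det]
  have e : ∀ (m : ℕ) (z : Fin m → ℝ), vand z = ∏ i, ∏ j, if i < j then z j - z i else 1 := by
    intro m z
    unfold vand
    refine Finset.prod_congr rfl fun i _ => ?_
    rw [← Finset.prod_filter]
    refine Finset.prod_congr ?_ fun _ _ => rfl
    ext; simp
  rw [e, e, Fin.prod_univ_castSucc]
  simp only [Fin.prod_univ_castSucc, Fin.snoc_castSucc, Fin.snoc_last, Fin.castSucc_lt_castSucc_iff,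
    Fin.castSucc_lt_last, if_true, lt_irrefl, if_false, Finset.prod_mul_distrib]
  have : ∀ i : Fin n, ¬ (Fin.last n < i.castSucc) := fun i => (Fin.castSucc_lt_last i).not_gt
  simp only [this, if_false, Finset.prod_const_one, mul_one]
  ring

/-- bimoments -/
noncomputable def bim (w : ℝ → ℝ → ℝ) (j k : ℕ) : ℝ :=
  ∫ p : ℝ × ℝ, p.1 ^ j * p.2 ^ k * w p.1 p.2

/-- moment condition -/
def MomInt (w : ℝ → ℝ → ℝ) : Prop :=
  ∀ j k : ℕ, Integrable (fun p : ℝ × ℝ => p.1 ^ j * p.2 ^ k * w p.1 p.2)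

theorem mono_int {w : ℝ → ℝ → ℝ} (hw : MomInt w) {n : ℕ} (a b : Fin n → ℕ) :
    Integrable (fun p : (Fin n → ℝ) × (Fin n → ℝ) =>
      ∏ i, (p.1 i ^ a i * p.2 i ^ b i * w (p.1 i) (p.2 i))) ∧
    ∫ p : (Fin n → ℝ) × (Fin n → ℝ), ∏ i, (p.1 i ^ a i * p.2 i ^ b i * w (p.1 i) (p.2 i)) =
      ∏ i, bim w (a i) (b i) := by
  have mp := volume_measurePreserving_arrowProdEquivProdArrow ℝ ℝ (Fin n)
  constructor
  · rw [← mp.integrable_comp_emb (MeasurableEquiv.measurableEmbedding _)]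
    exact Integrable.fintype_prod
      (f := fun i (p : ℝ × ℝ) => p.1 ^ a i * p.2 ^ b i * w p.1 p.2) (fun i => hw (a i) (b i))
  · rw [← mp.integral_comp']
    exact integral_fintype_prod_volume_eq_prod
      (fun i (p : ℝ × ℝ) => p.1 ^ a i * p.2 ^ b i * w p.1 p.2)

theorem brd_int {w : ℝ → ℝ → ℝ} (hw : MomInt w) {n : ℕ} (v : Fin (n+1) → ℝ) :
    Integrable (fun p : (Fin n → ℝ) × (Fin n → ℝ) =>
      brd (fun i j => p.1 i ^ (j : ℕ)) v * vand p.2 * ∏ i, w (p.1 i) (p.2 i)) ∧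
    ∫ p : (Fin n → ℝ) × (Fin n → ℝ),
      brd (fun i j => p.1 i ^ (j : ℕ)) v * vand p.2 * ∏ i, w (p.1 i) (p.2 i) =
      ∑ τ : Equiv.Perm (Fin n), ((Equiv.Perm.sign τ : ℤ) : ℝ) *
        brd (fun i j => bim w j (τ i)) v := by
  have e : (fun p : (Fin n → ℝ) × (Fin n → ℝ) =>
      brd (fun i j => p.1 i ^ (j : ℕ)) v * vand p.2 * ∏ i, w (p.1 i) (p.2 i)) =
      fun p => ∑ τ : Equiv.Perm (Fin n), ∑ σ : Equiv.Perm (Fin (n+1)),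
        (((Equiv.Perm.sign τ : ℤ) : ℝ) * (((Equiv.Perm.sign σ : ℤ) : ℝ) * v (σ (Fin.last n)))) *
        ∏ i, (p.1 i ^ (σ i.castSucc : ℕ) * p.2 i ^ (τ i : ℕ) * w (p.1 i) (p.2 i)) := by
    funext p
    rw [vand_expand, brd, Finset.sum_mul_sum, Finset.sum_comm, Finset.sum_mul]
    refine Finset.sum_congr rfl fun τ _ => ?_
    rw [Finset.sum_mul]
    refine Finset.sum_congr rfl fun σ _ => ?_
    simp only [Finset.prod_mul_distrib]
    ring
  rw [e]
  have h1 : ∀ (τ : Equiv.Perm (Fin n)) (σ : Equiv.Perm (Fin (n+1))),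
      Integrable (fun p : (Fin n → ℝ) × (Fin n → ℝ) =>
        (((Equiv.Perm.sign τ : ℤ) : ℝ) * (((Equiv.Perm.sign σ : ℤ) : ℝ) * v (σ (Fin.last n)))) *
        ∏ i, (p.1 i ^ (σ i.castSucc : ℕ) * p.2 i ^ (τ i : ℕ) * w (p.1 i) (p.2 i))) :=
    fun τ σ => (mono_int hw _ _).1.const_mul _
  refine ⟨integrable_finsetSum _ fun τ _ => integrable_finsetSum _ fun σ _ => h1 τ σ, ?_⟩
  rw [integral_finsetSum _ fun τ _ => integrable_finsetSum _ fun σ _ => h1 τ σ]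
  refine Finset.sum_congr rfl fun τ _ => ?_
  rw [integral_finsetSum _ fun σ _ => h1 τ σ, brd, Finset.mul_sum]
  refine Finset.sum_congr rfl fun σ _ => ?_
  rw [integral_const_mul, (mono_int hw (fun i => (σ i.castSucc : ℕ)) (fun i => (τ i : ℕ))).2]
  ring

/-- bordered integral coefficient -/
noncomputable def cf (w : ℝ → ℝ → ℝ) (n : ℕ) (v : Fin (n+1) → ℝ) : ℝ :=
  ∑ τ : Equiv.Perm (Fin n), ((Equiv.Perm.sign τ : ℤ) : ℝ) * brd (fun i j => bim w j (τ i)) v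

theorem cf_linear (w : ℝ → ℝ → ℝ) (n : ℕ) (v : Fin (n+1) → ℝ) :
    cf w n v = ∑ j, v j * cf w n (Pi.single j 1) := by
  unfold cf
  simp_rw [Finset.mul_sum]
  rw [Finset.sum_comm]
  refine Finset.sum_congr rfl fun τ _ => ?_
  rw [brd_linear, Finset.mul_sum]
  exact Finset.sum_congr rfl fun j _ => by ring

theorem cf_zero (w : ℝ → ℝ → ℝ) (n : ℕ) (k : ℕ) (hk : k < n) :
    cf w n (fun j => bim w j k) = 0 := by
  unfold cf
  refine Finset.sum_eq_zero fun τ _ => ?_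
  have := brd_row (fun (i : Fin n) (j : Fin (n+1)) => bim w j (τ i)) (τ.symm ⟨k, hk⟩)
  simp only [Equiv.apply_symm_apply] at this
  rw [this, mul_zero]

theorem gauss_mom {b : ℝ} (hb : 0 < b) (j : ℕ) :
    Integrable (fun x : ℝ => x ^ j * Real.exp (-b * x ^ 2)) := by
  have h := integrable_rpow_mul_exp_neg_mul_sq hb (s := (j : ℝ))
    (by have : (0:ℝ) ≤ j := Nat.cast_nonneg j
        linarith)
  simpa only [Real.rpow_natCast] using h

theorem tm_cont (N : ℕ) (T : ℝ) (V₁ V₂ : Polynomial ℝ) {α : Type*} [TopologicalSpace α]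
    {f g : α → ℝ} (hf : Continuous f) (hg : Continuous g) :
    Continuous fun a => tmWeight N T V₁ V₂ (f a) (g a) := by
  unfold tmWeight
  have h1 := V₁.continuous.comp hf
  have h2 := V₂.continuous.comp hg
  simp only [Function.comp_def] at h1 h2
  fun_prop

theorem tm_mom (N : ℕ) (hN : 1 ≤ N) (T : ℝ) (hT : 0 < T) (V₁ V₂ : Polynomial ℝ)
    (hconf : ∃ c > (0 : ℝ), ∃ C : ℝ, ∀ x y : ℝ,
      c * (x ^ 2 + y ^ 2) - C ≤ V₁.eval x + V₂.eval y - x * y) :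
    MomInt (tmWeight N T V₁ V₂) := by
  obtain ⟨c, hc, C, h⟩ := hconf
  intro j k
  have hs : 0 < (N : ℝ) / T := div_pos (by exact_mod_cast hN) hT
  set s := (N : ℝ) / T with hsdef
  have h1 := ((gauss_mom (mul_pos hs hc) j).mul_prod (gauss_mom (mul_pos hs hc) k)).const_mul
    (Real.exp (s * C))
  refine h1.mono ?_ ?_
  · refine Continuous.aestronglyMeasurable ?_
    have := tm_cont N T V₁ V₂ continuous_fst (continuous_snd (X := ℝ) (Y := ℝ))
    fun_prop
  · refine Filter.Eventually.of_forall fun p => ?_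
    simp only [norm_mul, tmWeight, Real.norm_eq_abs, Real.abs_exp]
    rw [← hsdef]
    have e : Real.exp (-s * (V₁.eval p.1 + V₂.eval p.2 - p.1 * p.2)) ≤
        Real.exp (s * C) * (Real.exp (-(s * c) * p.1 ^ 2) * Real.exp (-(s * c) * p.2 ^ 2)) := by
      rw [← Real.exp_add, ← Real.exp_add, Real.exp_le_exp]
      nlinarith [mul_le_mul_of_nonneg_left (h p.1 p.2) hs.le]
    calc _ ≤ |p.1 ^ j| * |p.2 ^ k| * (Real.exp (s * C) *
          (Real.exp (-(s * c) * p.1 ^ 2) * Real.exp (-(s * c) * p.2 ^ 2))) := by gcongr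
      _ = _ := by ring

theorem Z_int {N : ℕ} {T : ℝ} {V₁ V₂ : Polynomial ℝ} (hw : MomInt (tmWeight N T V₁ V₂)) (n : ℕ) :
    Integrable (fun p : (Fin n → ℝ) × (Fin n → ℝ) =>
          vand p.1 * vand p.2 * ∏ i, tmWeight N T V₁ V₂ (p.1 i) (p.2 i)) ∧
    Zpart N T V₁ V₂ n = cf (tmWeight N T V₁ V₂) n (Pi.single (Fin.last n) 1) := by
  have h := brd_int hw (n := n) (Pi.single (Fin.last n) 1)
  simp only [brd_vand] at h
  exact h

theorem pi_eq {N : ℕ} {T : ℝ} {V₁ V₂ : Polynomial ℝ} (hw : MomInt (tmWeight N T V₁ V₂)) (n : ℕ)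
    (ξ : ℝ) : piPoly N T V₁ V₂ n ξ = ∑ j : Fin (n+1), ((Zpart N T V₁ V₂ n)⁻¹ *
      cf (tmWeight N T V₁ V₂) n (Pi.single j 1)) * ξ ^ (j : ℕ) := by
  have h := (brd_int hw (n := n) (fun j => ξ ^ (j : ℕ))).2
  simp only [brd_char] at h
  unfold piPoly
  have e : ∀ p : (Fin n → ℝ) × (Fin n → ℝ), (∏ i, (ξ - p.1 i)) *
      (vand p.1 * vand p.2 * ∏ i, tmWeight N T V₁ V₂ (p.1 i) (p.2 i)) =
      (∏ i, (ξ - p.1 i)) * vand p.1 * vand p.2 * ∏ i, tmWeight N T V₁ V₂ (p.1 i) (p.2 i) :=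
    fun p => by ring
  simp only [e]
  rw [h]
  change _ * cf _ _ _ = _
  rw [cf_linear, Finset.mul_sum]
  exact Finset.sum_congr rfl fun j _ => by ring

theorem pi_poly {N : ℕ} {T : ℝ} {V₁ V₂ : Polynomial ℝ} (hw : MomInt (tmWeight N T V₁ V₂)) (n : ℕ)
    (hZ : 0 < Zpart N T V₁ V₂ n) : ∃ p : Polynomial ℝ, p.Monic ∧ p.natDegree = n ∧
          ∀ ξ : ℝ, piPoly N T V₁ V₂ n ξ = p.eval ξ := by
  let a : Fin (n+1) → ℝ := fun j => (Zpart N T V₁ V₂ n)⁻¹ *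
      cf (tmWeight N T V₁ V₂) n (Pi.single j 1)
  have ha : a (Fin.last n) = 1 := by
    simp only [a]
    rw [← (Z_int hw n).2, inv_mul_cancel₀ hZ.ne']
  let q : Polynomial ℝ := ∑ j : Fin n, Polynomial.C (a j.castSucc) * Polynomial.X ^ (j : ℕ)
  have hq : q.degree < n := Polynomial.degree_sum_fin_lt _
  refine ⟨Polynomial.X ^ n + q, Polynomial.monic_X_pow_add hq, ?_, ?_⟩
  · rw [Polynomial.natDegree_add_eq_left_of_degree_lt, Polynomial.natDegree_X_pow]
    rwa [Polynomial.degree_X_pow]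
  · intro ξ
    rw [pi_eq hw]
    change ∑ j, a j * ξ ^ (j : ℕ) = _
    rw [Fin.sum_univ_castSucc, ha]
    simp [q, Polynomial.eval_finsetSum]
    ring

theorem pi_orth {N : ℕ} {T : ℝ} {V₁ V₂ : Polynomial ℝ} (hw : MomInt (tmWeight N T V₁ V₂)) (n : ℕ)
    (q : Polynomial ℝ) (hq : q.natDegree < n) :
    ∫ p : ℝ × ℝ, piPoly N T V₁ V₂ n p.1 * q.eval p.2 * tmWeight N T V₁ V₂ p.1 p.2 = 0 := by
  set w := tmWeight N T V₁ V₂ with hwdef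
  have e : ∀ p : ℝ × ℝ, piPoly N T V₁ V₂ n p.1 * q.eval p.2 * w p.1 p.2 =
      ∑ k ∈ Finset.range (q.natDegree + 1), ∑ j : Fin (n+1),
        (q.coeff k * ((Zpart N T V₁ V₂ n)⁻¹ * cf w n (Pi.single j 1))) *
          (p.1 ^ (j : ℕ) * p.2 ^ k * w p.1 p.2) := by
    intro p
    rw [pi_eq hw, Polynomial.eval_eq_sum_range, Finset.sum_mul_sum, Finset.sum_comm,
      Finset.sum_mul]
    refine Finset.sum_congr rfl fun k _ => ?_
    rw [Finset.sum_mul]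
    exact Finset.sum_congr rfl fun j _ => by ring
  simp only [e]
  have hi : ∀ (k : ℕ) (j : Fin (n+1)), Integrable (fun p : ℝ × ℝ =>
      (q.coeff k * ((Zpart N T V₁ V₂ n)⁻¹ * cf w n (Pi.single j 1))) *
          (p.1 ^ (j : ℕ) * p.2 ^ k * w p.1 p.2)) := fun k j => (hw j k).const_mul _
  rw [integral_finsetSum _ fun k _ => integrable_finsetSum _ fun j _ => hi k j]
  refine Finset.sum_eq_zero fun k hk => ?_
  rw [integral_finsetSum _ fun j _ => hi k j]
  simp only [integral_const_mul]
  have hz := cf_zero w n k (by have := Finset.mem_range.1 hk; omega)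
  rw [cf_linear] at hz
  calc _ = (q.coeff k * (Zpart N T V₁ V₂ n)⁻¹) * ∑ j : Fin (n+1),
        bim w j k * cf w n (Pi.single j 1) := by
        rw [Finset.mul_sum]
        exact Finset.sum_congr rfl fun j _ => by unfold bim; ring
    _ = 0 := by rw [hz, mul_zero]

theorem tm_swap (N : ℕ) (T : ℝ) (V₁ V₂ : Polynomial ℝ) (x y : ℝ) :
    tmWeight N T V₁ V₂ x y = tmWeight N T V₂ V₁ y x := by
  unfold tmWeight
  congr 1; ring

theorem int_swap {α : Type*} [MeasureSpace α] [SFinite (volume : Measure α)] (f : α × α → ℝ) :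
    ∫ p : α × α, f p = ∫ p : α × α, f p.swap :=
  (integral_prod_swap (μ := (volume : Measure α)) (ν := (volume : Measure α)) f).symm

theorem Z_swap (N : ℕ) (T : ℝ) (V₁ V₂ : Polynomial ℝ) (n : ℕ) :
    Zpart N T V₁ V₂ n = Zpart N T V₂ V₁ n := by
  unfold Zpart
  rw [int_swap]
  simp only [Prod.fst_swap, Prod.snd_swap, tm_swap N T V₁ V₂]
  congr 1; funext p; ring

theorem sigma_swap (N : ℕ) (T : ℝ) (V₁ V₂ : Polynomial ℝ) (n : ℕ) (η : ℝ) :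
    sigmaPoly N T V₁ V₂ n η = piPoly N T V₂ V₁ n η := by
  unfold sigmaPoly piPoly
  rw [int_swap, Z_swap]
  simp only [Prod.fst_swap, Prod.snd_swap, tm_swap N T V₁ V₂]
  congr 2; funext p; ring

theorem Z_pos (N : ℕ) (hN : 1 ≤ N) (T : ℝ) (hT : 0 < T) (V₁ V₂ : Polynomial ℝ)
    (hw : MomInt (tmWeight N T V₁ V₂)) (n : ℕ) : 0 < Zpart N T V₁ V₂ n := by
  have hs : 0 < (N : ℝ) / T := div_pos (by exact_mod_cast hN) hT
  have hI := (Z_int hw n).1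
  let F : (Fin n → ℝ) × (Fin n → ℝ) → ℝ := fun p =>
    vand p.1 * vand p.2 * ∏ i, tmWeight N T V₁ V₂ (p.1 i) (p.2 i)
  have hF : ∀ τ : Equiv.Perm (Fin n), Integrable (fun p : (Fin n → ℝ) × (Fin n → ℝ) =>
      F (p.1, p.2 ∘ τ)) ∧ ∫ p : (Fin n → ℝ) × (Fin n → ℝ), F (p.1, p.2 ∘ τ) =
        Zpart N T V₁ V₂ n := by
    intro τ
    have m1 := volume_measurePreserving_piCongrLeft (fun _ : Fin n => ℝ) τ.symm
    let E : (Fin n → ℝ) × (Fin n → ℝ) ≃ᵐ (Fin n → ℝ) × (Fin n → ℝ) :=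
      (MeasurableEquiv.refl _).prodCongr (MeasurableEquiv.piCongrLeft (fun _ => ℝ) τ.symm)
    have hE : ∀ p, E p = (p.1, p.2 ∘ τ) := by
      intro p
      refine Prod.ext rfl ?_
      funext i
      change (Equiv.piCongrLeft (fun _ => ℝ) τ.symm) p.2 i = p.2 (τ i)
      have := Equiv.piCongrLeft_apply_apply (fun _ : Fin n => ℝ) τ.symm p.2 (τ i)
      simpa using this
    have m2 : MeasurePreserving E volume volume :=
      (MeasurePreserving.id (volume : Measure (Fin n → ℝ))).prod m1
    constructor
    · have := (m2.integrable_comp_emb E.measurableEmbedding (g := F)).2 hI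
      simpa only [Function.comp_def, hE] using this
    · have := m2.integral_comp' (g := F)
      simp only [hE] at this
      exact this
  let H : (Fin n → ℝ) × (Fin n → ℝ) → ℝ := fun p => ∑ τ : Equiv.Perm (Fin n), F (p.1, p.2 ∘ τ)
  have hHi : Integrable H := integrable_finsetSum _ fun τ _ => (hF τ).1
  have hHint : ∫ p, H p = (Fintype.card (Equiv.Perm (Fin n)) : ℝ) * Zpart N T V₁ V₂ n := by
    simp only [H]
    rw [integral_finsetSum _ fun τ _ => (hF τ).1]
    simp [(hF _).2]
  have hHe : ∀ p, H p = (∏ i, Real.exp (-((N:ℝ)/T) * V₁.eval (p.1 i))) *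
      (∏ i, Real.exp (-((N:ℝ)/T) * V₂.eval (p.2 i))) *
      (vand p.1 * vand p.2 * (expMat ((N:ℝ)/T) p.1 p.2).det) := by
    intro p
    rw [← Matrix.det_transpose, Matrix.det_apply', Finset.mul_sum, Finset.mul_sum]
    refine Finset.sum_congr rfl fun τ _ => ?_
    simp only [F, vand_perm, Matrix.transpose_apply, expMat, Matrix.of_apply]
    have : ∏ i, tmWeight N T V₁ V₂ (p.1 i) ((p.2 ∘ τ) i) =
        (∏ i, Real.exp (-((N:ℝ)/T) * V₁.eval (p.1 i))) *
        (∏ i, Real.exp (-((N:ℝ)/T) * V₂.eval (p.2 i))) *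
        ∏ i, Real.exp ((N:ℝ)/T * (p.1 i * p.2 (τ i))) := by
      rw [← Equiv.prod_comp τ (fun i => Real.exp (-((N:ℝ)/T) * V₂.eval (p.2 i))),
        ← Finset.prod_mul_distrib, ← Finset.prod_mul_distrib]
      refine Finset.prod_congr rfl fun i _ => ?_
      rw [← Real.exp_add, ← Real.exp_add, tmWeight]
      congr 1
      simp only [Function.comp_apply]
      ring
    rw [this]
    ring
  have hpos1 : ∀ p : (Fin n → ℝ) × (Fin n → ℝ),
      0 < (∏ i, Real.exp (-((N:ℝ)/T) * V₁.eval (p.1 i))) *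
      (∏ i, Real.exp (-((N:ℝ)/T) * V₂.eval (p.2 i))) := fun p => by positivity
  have hH0 : 0 ≤ H := fun p => by
    rw [hHe]
    exact mul_nonneg (hpos1 p).le (tp_nonneg hs _ _)
  have hvc : ∀ {f : (Fin n → ℝ) × (Fin n → ℝ) → Fin n → ℝ}, Continuous f →
      Continuous fun p => vand (f p) := by
    intro f hf
    unfold vand
    fun_prop
  have hHc : Continuous H := by
    refine continuous_finsetSum _ fun τ _ => ?_
    refine Continuous.mul (Continuous.mul (hvc (by fun_prop)) (hvc ?_)) ?_
    · exact continuous_pi fun i => (continuous_apply (τ i)).comp continuous_snd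
    · refine continuous_finsetProd _ fun i _ => tm_cont _ _ _ _ ?_ ?_
      · exact (continuous_apply i).comp continuous_fst
      · exact (continuous_apply (τ i)).comp continuous_snd
  have hpt : 0 < ∫ p, H p := by
    rw [integral_pos_iff_support_of_nonneg hH0 hHi]
    refine hHc.isOpen_support.measure_pos _ ?_
    refine ⟨(fun i => ((i : ℕ) : ℝ), fun i => ((i : ℕ) : ℝ)), ?_⟩
    have hinj : Function.Injective (fun i : Fin n => ((i : ℕ) : ℝ)) := fun a b hab =>
      Fin.ext (Nat.cast_injective (R := ℝ) hab)
    rw [Function.mem_support, hHe]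
    exact (mul_pos (hpos1 _) (tp_pos hs hinj hinj)).ne'
  rw [hHint] at hpt
  exact pos_of_mul_pos_right hpt (Nat.cast_nonneg _)

theorem heine_biorthogonal
    (N : ℕ) (hN : 1 ≤ N) (T : ℝ) (hT : 0 < T) (V₁ V₂ : Polynomial ℝ)
    (hconf : ∃ c > (0 : ℝ), ∃ C : ℝ, ∀ x y : ℝ,
      c * (x ^ 2 + y ^ 2) - C ≤ V₁.eval x + V₂.eval y - x * y) :
    ∀ n : ℕ, 1 ≤ n →
      (Integrable (fun p : (Fin n → ℝ) × (Fin n → ℝ) =>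
          vand p.1 * vand p.2 * ∏ i, tmWeight N T V₁ V₂ (p.1 i) (p.2 i)) ∧
        0 < Zpart N T V₁ V₂ n) ∧
      ((∃ p : Polynomial ℝ, p.Monic ∧ p.natDegree = n ∧
          ∀ ξ : ℝ, piPoly N T V₁ V₂ n ξ = p.eval ξ) ∧
        (∃ q : Polynomial ℝ, q.Monic ∧ q.natDegree = n ∧
          ∀ η : ℝ, sigmaPoly N T V₁ V₂ n η = q.eval η)) ∧
      (∀ m : ℕ, m ≠ n →
        (∫ p : ℝ × ℝ,
          piPoly N T V₁ V₂ n p.1 * sigmaPoly N T V₁ V₂ m p.2 * tmWeight N T V₁ V₂ p.1 p.2)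
          = 0) := by
  have hconf' : ∃ c > (0 : ℝ), ∃ C : ℝ, ∀ x y : ℝ,
      c * (x ^ 2 + y ^ 2) - C ≤ V₂.eval x + V₁.eval y - x * y := by
    obtain ⟨c, hc, C, h⟩ := hconf
    refine ⟨c, hc, C, fun x y => ?_⟩
    have := h y x
    linarith
  have hw := tm_mom N hN T hT V₁ V₂ hconf
  have hw' := tm_mom N hN T hT V₂ V₁ hconf'
  have hp := fun n => pi_poly hw n (Z_pos N hN T hT V₁ V₂ hw n)
  have hp' := fun n => pi_poly hw' n (Z_pos N hN T hT V₂ V₁ hw' n)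
  intro n _
  refine ⟨⟨(Z_int hw n).1, Z_pos N hN T hT V₁ V₂ hw n⟩, ⟨hp n, ?_⟩, ?_⟩
  · simp only [sigma_swap]
    exact hp' n
  · intro m hm
    rcases lt_or_gt_of_ne hm with h | h
    · obtain ⟨q, _, hq, hq'⟩ := hp' m
      simp only [sigma_swap, hq']
      exact pi_orth hw n q (by omega)
    · obtain ⟨q, _, hq, hq'⟩ := hp n
      have := pi_orth hw' m q (by omega)
      rw [int_swap] at this
      simp only [Prod.fst_swap, Prod.snd_swap, tm_swap N T V₂ V₁] at this
      simp only [sigma_swap, hq']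
      rw [← this]
      congr 1; funext p; ring
end
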